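/- Let Ω ⊂⊂ ℂⁿ be a pseudoconvex domain with smooth boundary and Σ_∞ ⊂ ∂Ω the set of infinite type boundary points. Assume there exist a neighborhood V of Σ_∞ in ℂⁿ, a defining function ρ of Ω, and η₂ > 1 such that ρ^{η₂} is strictly plurisubharmonic on (ℂⁿ ∖ cl(Ω)) ∩ V. Then there exist a defining function ρ̃ of Ω and a neighborhood U of ∂Ω such that ρ̃^{η₂} is strictly plurisubharmonic on (ℂⁿ ∖ cl(Ω)) ∩ U. -/

import Mathlib

noncomputable section

open Complex Topology
open scoped ENNReal

/-- Wirtinger derivative `∂f/∂z_j`. -/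
def dz {n : ℕ} (j : Fin n) (f : (Fin n → ℂ) → ℂ) (z : Fin n → ℂ) : ℂ :=
  (fderiv ℝ f z (Pi.single j 1) - Complex.I * fderiv ℝ f z (Pi.single j Complex.I)) / 2

/-- Wirtinger derivative `∂f/∂z̄_j`. -/
def dzbar {n : ℕ} (j : Fin n) (f : (Fin n → ℂ) → ℂ) (z : Fin n → ℂ) : ℂ :=
  (fderiv ℝ f z (Pi.single j 1) + Complex.I * fderiv ℝ f z (Pi.single j Complex.I)) / 2

/-- Complexification of a real-valued function. -/
def cplx {n : ℕ} (ρ : (Fin n → ℂ) → ℝ) : (Fin n → ℂ) → ℂ := fun z => (ρ z : ℂ)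

/-- The Levi form `L_ρ(X,Y)(z) = Σ_{j,k} ∂²ρ/∂z_j∂z̄_k (z) X_j conj(Y_k)`. -/
def levi {n : ℕ} (ρ : (Fin n → ℂ) → ℝ) (X Y : Fin n → ℂ) (z : Fin n → ℂ) : ℂ :=
  ∑ j, ∑ k, dz j (fun w => dzbar k (cplx ρ) w) z * X j * (starRingEnd ℂ) (Y k)

/-- `Xf = Σ_j X_j ∂f/∂z_j` for a (1,0) vector `X`. -/
def dirDeriv {n : ℕ} (X : Fin n → ℂ) (f : (Fin n → ℂ) → ℂ) (z : Fin n → ℂ) : ℂ :=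
  ∑ j, X j * dz j f z

/-- `X̄f = Σ_j conj(X_j) ∂f/∂z̄_j`. -/
def dirDerivBar {n : ℕ} (X : Fin n → ℂ) (f : (Fin n → ℂ) → ℂ) (z : Fin n → ℂ) : ℂ :=
  ∑ j, (starRingEnd ℂ) (X j) * dzbar j f z

/-- Derivative of `f` along the (1,0) vector field `X`. -/
def fieldDeriv {n : ℕ} (X : (Fin n → ℂ) → (Fin n → ℂ)) (f : (Fin n → ℂ) → ℂ)
    (z : Fin n → ℂ) : ℂ :=
  dirDeriv (X z) f z

/-- Euclidean norm of the real gradient of `ρ`. -/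
def gradNorm {n : ℕ} (ρ : (Fin n → ℂ) → ℝ) (z : Fin n → ℂ) : ℝ :=
  Real.sqrt (∑ j, ((fderiv ℝ ρ z (Pi.single j 1)) ^ 2 +
    (fderiv ℝ ρ z (Pi.single j Complex.I)) ^ 2))

/-- The complex normal field `N_ρ`. -/
def nfield {n : ℕ} (ρ : (Fin n → ℂ) → ℝ) (z : Fin n → ℂ) : Fin n → ℂ := fun j =>
  ((Real.sqrt (∑ k, Complex.normSq (dz k (cplx ρ) z)) : ℝ) : ℂ)⁻¹ * dzbar j (cplx ρ) z

/-- Squared Euclidean norm of a vector in ℂⁿ. -/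
def enormSq {n : ℕ} (X : Fin n → ℂ) : ℝ := ∑ j, Complex.normSq (X j)

/-- `f` is strictly plurisubharmonic on `S`. -/
def StrictPSHOn {n : ℕ} (f : (Fin n → ℂ) → ℝ) (S : Set (Fin n → ℂ)) : Prop :=
  ∀ z ∈ S, ∀ X : Fin n → ℂ, X ≠ 0 → 0 < (levi f X X z).re

/-- `ρ` is a (global smooth) defining function of `Ω` on the neighborhood `V` of `cl Ω`. -/
structure IsDefFn {n : ℕ} (Ω V : Set (Fin n → ℂ)) (ρ : (Fin n → ℂ) → ℝ) : Prop where
  isOpen : IsOpen V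
  subset : closure Ω ⊆ V
  smooth : ContDiffOn ℝ (⊤ : ℕ∞) ρ V
  eq : Ω = {z ∈ V | ρ z < 0}
  grad_ne : ∀ z ∈ frontier Ω, fderiv ℝ ρ z ≠ 0

/-- The Levi form of `ρ` is positive semidefinite on complex tangent vectors at `z`. -/
def LeviPseudoconvexAt {n : ℕ} (ρ : (Fin n → ℂ) → ℝ) (z : Fin n → ℂ) : Prop :=
  ∀ X : Fin n → ℂ, dirDeriv X (cplx ρ) z = 0 → 0 ≤ (levi ρ X X z).re

/-- `Ω` is a (smoothly bounded, Levi) pseudoconvex domain. -/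
def IsPseudoconvex {n : ℕ} (Ω : Set (Fin n → ℂ)) : Prop :=
  ∃ (V : Set (Fin n → ℂ)) (ρ : (Fin n → ℂ) → ℝ), IsDefFn Ω V ρ ∧
    ∀ p ∈ frontier Ω, LeviPseudoconvexAt ρ p

/-- The set of Steinness exponents of `ρ`. -/
def steinExpSet {n : ℕ} (Ω : Set (Fin n → ℂ)) (ρ : (Fin n → ℂ) → ℝ) : Set ℝ :=
  {η : ℝ | 1 < η ∧ ∃ W : Set (Fin n → ℂ), IsOpen W ∧ frontier Ω ⊆ W ∧
    StrictPSHOn (fun z => ρ z ^ η) ((closure Ω)ᶜ ∩ W)}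

/-- The Steinness exponent `η̃_ρ` of a defining function `ρ` (`∞` if none exists). -/
def steinExp {n : ℕ} (Ω : Set (Fin n → ℂ)) (ρ : (Fin n → ℂ) → ℝ) : ℝ≥0∞ :=
  sInf (ENNReal.ofReal '' steinExpSet Ω ρ)

/-- The Steinness index `S(Ω)`. -/
def steinIndex {n : ℕ} (Ω : Set (Fin n → ℂ)) : ℝ≥0∞ :=
  ⨅ (V : Set (Fin n → ℂ)) (ρ : (Fin n → ℂ) → ℝ) (_ : IsDefFn Ω V ρ), steinExp Ω ρ

/-- The set of Diederich–Fornæss exponents of `ρ`. -/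
def dfExpSet {n : ℕ} (Ω : Set (Fin n → ℂ)) (ρ : (Fin n → ℂ) → ℝ) : Set ℝ :=
  {η : ℝ | 0 < η ∧ η < 1 ∧ StrictPSHOn (fun z => -((-ρ z) ^ η)) Ω}

/-- The Diederich–Fornæss exponent of `ρ` (`0` if no exponent exists). -/
def dfExp {n : ℕ} (Ω : Set (Fin n → ℂ)) (ρ : (Fin n → ℂ) → ℝ) : ℝ :=
  sSup (insert 0 (dfExpSet Ω ρ))

/-- The Diederich–Fornæss index `DF(Ω)`. -/
def dfIndex {n : ℕ} (Ω : Set (Fin n → ℂ)) : ℝ :=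
  sSup {t : ℝ | ∃ V ρ, IsDefFn Ω V ρ ∧ t = dfExp Ω ρ}

/-- `L` is a smooth (1,0) tangent vector field for `ρ` on `A`. -/
def IsTangentField {n : ℕ} (ρ : (Fin n → ℂ) → ℝ) (L : (Fin n → ℂ) → (Fin n → ℂ))
    (A : Set (Fin n → ℂ)) : Prop :=
  ContDiffOn ℝ (⊤ : ℕ∞) L A ∧ ∀ z ∈ A, dirDeriv (L z) (cplx ρ) z = 0

/-- The key differential inequality
`(1/(η₂−1))|L_ρ(L,N)|²/‖∇ρ‖² − (1/2)(N L_ρ(L,L))/‖∇ρ‖ ≤ 0` at `p`. -/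
def keyIneqAt {n : ℕ} (ρ : (Fin n → ℂ) → ℝ) (L : (Fin n → ℂ) → (Fin n → ℂ)) (η₂ : ℝ)
    (p : Fin n → ℂ) : Prop :=
  1 / (η₂ - 1) * Complex.normSq (levi ρ (L p) (nfield ρ p) p) / (gradNorm ρ p) ^ 2 -
    1 / 2 * (fieldDeriv (nfield ρ) (fun w => levi ρ (L w) (L w) w) p).re / gradNorm ρ p ≤ 0

/-- The strict version of the key differential inequality. -/
def strictKeyIneqAt {n : ℕ} (ρ : (Fin n → ℂ) → ℝ) (L : (Fin n → ℂ) → (Fin n → ℂ)) (η₂ : ℝ)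
    (p : Fin n → ℂ) : Prop :=
  1 / (η₂ - 1) * Complex.normSq (levi ρ (L p) (nfield ρ p) p) / (gradNorm ρ p) ^ 2 -
    1 / 2 * (fieldDeriv (nfield ρ) (fun w => levi ρ (L w) (L w) w) p).re / gradNorm ρ p < 0

/-- `cl Ω` has a strong Stein neighborhood basis. -/
def HasStrongSteinBasis {n : ℕ} (Ω : Set (Fin n → ℂ)) : Prop :=
  ∃ (V : Set (Fin n → ℂ)) (ρ : (Fin n → ℂ) → ℝ), IsDefFn Ω V ρ ∧ ∃ ε₀ : ℝ, 0 < ε₀ ∧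
    (∀ z ∈ V, 0 ≤ ρ z → ρ z < ε₀ → fderiv ℝ ρ z ≠ 0) ∧
    ∀ ε : ℝ, 0 ≤ ε → ε < ε₀ → ∀ z ∈ V, ρ z = ε → LeviPseudoconvexAt ρ z

/-- Vanishing order at `0` of a holomorphic function `ℂ → ℂ` (`∞` if all derivatives vanish). -/
def orderC (h : ℂ → ℂ) : ℕ∞ :=
  sInf ((fun k : ℕ => (k : ℕ∞)) '' {k : ℕ | iteratedDeriv k h 0 ≠ 0})

/-- Vanishing order at `0` of a real-valued function on `ℂ`. -/
def orderR (g : ℂ → ℝ) : ℕ∞ :=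
  sInf ((fun k : ℕ => (k : ℕ∞)) '' {k : ℕ | iteratedFDeriv ℝ k g 0 ≠ 0})

/-- `ν(γ)`: minimal vanishing order at `0` of the components of `γ − p`. -/
def curveOrder {n : ℕ} (γ : ℂ → Fin n → ℂ) (p : Fin n → ℂ) : ℕ∞ :=
  ⨅ j, orderC (fun t => γ t j - p j)

/-- `p` is a boundary point of finite D'Angelo 1-type (w.r.t. the defining function `ρ`). -/
def FiniteTypePt {n : ℕ} (ρ : (Fin n → ℂ) → ℝ) (p : Fin n → ℂ) : Prop :=
  ∃ M : ℕ, ∀ γ : ℂ → Fin n → ℂ, (∀ j, AnalyticAt ℂ (fun t => γ t j) 0) → γ 0 = p →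
    ¬ (∀ᶠ t in nhds (0 : ℂ), γ t = p) →
    orderR (fun t => ρ (γ t)) ≤ (M : ℕ∞) * curveOrder γ p

namespace Stein

section

variable {n : ℕ}

/-- The `*`-algebra of smooth complex-valued functions on `ℂⁿ`. -/
def Sm (n : ℕ) : StarSubalgebra ℂ ((Fin n → ℂ) → ℂ) where
  carrier := {f | ContDiff ℝ (⊤ : ℕ∞) f}
  mul_mem' {f g} (hf : ContDiff ℝ (⊤ : ℕ∞) f) (hg : ContDiff ℝ (⊤ : ℕ∞) g) := by
    change ContDiff ℝ (⊤ : ℕ∞) (fun x => f x * g x); exact hf.mul hg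
  add_mem' {f g} (hf : ContDiff ℝ (⊤ : ℕ∞) f) (hg : ContDiff ℝ (⊤ : ℕ∞) g) := by
    change ContDiff ℝ (⊤ : ℕ∞) (fun x => f x + g x); exact hf.add hg
  algebraMap_mem' c := by
    change ContDiff ℝ (⊤ : ℕ∞) (fun _ => c); exact contDiff_const
  star_mem' {f} (hf : ContDiff ℝ (⊤ : ℕ∞) f) := by
    change ContDiff ℝ (⊤ : ℕ∞) (conjCLE ∘ f); exact conjCLE.contDiff.comp hf

lemma Sm_contDiff (f : Sm n) : ContDiff ℝ (⊤ : ℕ∞) (f : (Fin n → ℂ) → ℂ) := f.2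

lemma Sm_differentiable (f : Sm n) : Differentiable ℝ (f : (Fin n → ℂ) → ℂ) :=
  (Sm_contDiff f).differentiable (by simp)

lemma Sm_continuous (f : Sm n) : Continuous (f : (Fin n → ℂ) → ℂ) := (Sm_contDiff f).continuous

/-- The derivative of smooth functions in the direction of a constant real vector. -/
def pd (v : Fin n → ℂ) : Derivation ℂ (Sm n) (Sm n) :=
  Derivation.mk'
    { toFun := fun f => ⟨fun z => fderiv ℝ (f : (Fin n → ℂ) → ℂ) z v,
        ((Sm_contDiff f).fderiv_right (m := (⊤ : ℕ∞)) (by simp)).clm_apply contDiff_const⟩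
      map_add' := fun f g => by
        ext z
        simp [fderiv_add (Sm_differentiable f z) (Sm_differentiable g z)]
      map_smul' := fun c f => by
        ext z
        simp [fderiv_const_smul (Sm_differentiable f z)] }
    (fun f g => by
      ext z
      simp [fderiv_mul (Sm_differentiable f z) (Sm_differentiable g z)])

lemma pd_apply (v : Fin n → ℂ) (f : Sm n) (z : Fin n → ℂ) :
    (pd v f : (Fin n → ℂ) → ℂ) z = fderiv ℝ (f : (Fin n → ℂ) → ℂ) z v := rfl

lemma two_le_smooth : (2 : WithTop ℕ∞) ≤ ((⊤ : ℕ∞) : WithTop ℕ∞) :=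
  WithTop.coe_le_coe.2 (le_top : (2 : ℕ∞) ≤ ⊤)

lemma two_le_top_minSmoothness : minSmoothness ℝ 2 ≤ ((⊤ : ℕ∞) : WithTop ℕ∞) := by
  simpa using two_le_smooth

lemma pd_comm (u v : Fin n → ℂ) (f : Sm n) : pd u (pd v f) = pd v (pd u f) := by
  ext z
  have h1 : DifferentiableAt ℝ (fderiv ℝ (f : (Fin n → ℂ) → ℂ)) z :=
    ((Sm_contDiff f).fderiv_right (m := (⊤ : ℕ∞)) (by simp)).differentiable (by simp) z
  have key : ∀ u v : Fin n → ℂ, (pd u (pd v f) : (Fin n → ℂ) → ℂ) z =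
      fderiv ℝ (fderiv ℝ (f : (Fin n → ℂ) → ℂ)) z u v := by
    intro u v
    rw [pd_apply]
    change fderiv ℝ (fun w => fderiv ℝ (f : (Fin n → ℂ) → ℂ) w v) z u = _
    rw [fderiv_clm_apply h1 (differentiableAt_const v)]
    simp
  rw [key, key]
  exact ((Sm_contDiff f).contDiffAt.isSymmSndFDerivAt
    two_le_top_minSmoothness).eq u v

lemma pd_star (v : Fin n → ℂ) (f : Sm n) : pd v (star f) = star (pd v f) := by
  ext z
  have h := (conjCLE.toContinuousLinearMap.hasFDerivAt (x := f.1 z)).comp z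
    (Sm_differentiable f z).hasFDerivAt
  have h2 : fderiv ℝ (fun w => (starRingEnd ℂ) (f.1 w)) z = _ := h.fderiv
  change fderiv ℝ (fun w => (starRingEnd ℂ) (f.1 w)) z v = _
  rw [h2]
  rfl

/-- `∂/∂z_j` as a derivation of smooth functions. -/
def dl (j : Fin n) : Derivation ℂ (Sm n) (Sm n) :=
  (1 / 2 : ℂ) • (pd (Pi.single j 1) - I • pd (Pi.single j I))

/-- `∂/∂z̄_j` as a derivation of smooth functions. -/
def db (j : Fin n) : Derivation ℂ (Sm n) (Sm n) :=
  (1 / 2 : ℂ) • (pd (Pi.single j 1) + I • pd (Pi.single j I))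

lemma dl_apply (j : Fin n) (f : Sm n) (z : Fin n → ℂ) :
    (dl j f : (Fin n → ℂ) → ℂ) z = dz j f z := by
  simp [dl, dz, pd_apply]; ring

lemma db_apply (j : Fin n) (f : Sm n) (z : Fin n → ℂ) :
    (db j f : (Fin n → ℂ) → ℂ) z = dzbar j f z := by
  simp [db, dzbar, pd_apply]; ring

lemma dl_star (j : Fin n) (f : Sm n) : dl j (star f) = star (db j f) := by
  ext z
  simp [dl, db, pd_star]; ring

lemma db_star (j : Fin n) (f : Sm n) : db j (star f) = star (dl j f) := by
  rw [← star_star (db j _), ← dl_star, star_star]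

lemma dl_dl (j k : Fin n) (f : Sm n) : dl j (dl k f) = dl k (dl j f) := by
  simp only [dl, Derivation.smul_apply, Derivation.sub_apply, Derivation.map_smul, map_sub,
    pd_comm (Pi.single j _) (Pi.single k _), smul_sub, smul_comm I (1/2 : ℂ)]
  abel

lemma db_db (j k : Fin n) (f : Sm n) : db j (db k f) = db k (db j f) := by
  simp only [db, Derivation.smul_apply, Derivation.add_apply, Derivation.map_smul, map_add,
    pd_comm (Pi.single j _) (Pi.single k _), smul_add, smul_comm I (1/2 : ℂ)]
  abel

lemma dl_db (j k : Fin n) (f : Sm n) : dl j (db k f) = db k (dl j f) := by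
  simp only [dl, db, Derivation.smul_apply, Derivation.add_apply, Derivation.sub_apply,
    Derivation.map_smul,
    map_add, map_sub,
    pd_comm (Pi.single j _) (Pi.single k _), smul_add, smul_sub, smul_comm I (1/2 : ℂ)]
  abel

/-- The coordinate functions. -/
def co (j : Fin n) : Sm n :=
  ⟨fun z => z j, show ContDiff ℝ (⊤ : ℕ∞) (fun z : Fin n → ℂ => z j) from contDiff_apply ℝ ℂ j⟩

lemma co_apply (j : Fin n) (z : Fin n → ℂ) : (co j : (Fin n → ℂ) → ℂ) z = z j := rfl

lemma pd_co (v : Fin n → ℂ) (j : Fin n) : pd v (co j) = algebraMap ℂ (Sm n) (v j) := by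
  ext z
  rw [pd_apply]
  have : HasFDerivAt (co j : (Fin n → ℂ) → ℂ)
    (ContinuousLinearMap.proj j : (Fin n → ℂ) →L[ℝ] ℂ) z :=
    (ContinuousLinearMap.proj j : (Fin n → ℂ) →L[ℝ] ℂ).hasFDerivAt
  rw [this.fderiv]; rfl

lemma dl_co (i j : Fin n) : dl i (co j) = if i = j then 1 else 0 := by
  by_cases h : i = j
  · subst h
    ext z
    simp [dl, pd_co, Algebra.algebraMap_eq_smul_one]; ring
  · ext z
    simp [dl, pd_co, h, Algebra.algebraMap_eq_smul_one, Ne.symm h]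

lemma db_co (i j : Fin n) : db i (co j) = 0 := by
  by_cases h : i = j
  · subst h
    ext z
    simp [db, pd_co, Algebra.algebraMap_eq_smul_one]
  · ext z
    simp [db, pd_co, Algebra.algebraMap_eq_smul_one, Ne.symm h]

/-- Evaluation at a point. -/
def ev (q : Fin n → ℂ) : Sm n →ₐ[ℂ] ℂ :=
  (Pi.evalAlgHom ℂ (fun _ : Fin n → ℂ => ℂ) q).comp (Sm n).subtype.toAlgHom

lemma ev_apply (q : Fin n → ℂ) (f : Sm n) : ev q f = (f : (Fin n → ℂ) → ℂ) q := rfl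

lemma ev_star (q : Fin n → ℂ) (f : Sm n) : ev q (star f) = (starRingEnd ℂ) (ev q f) := rfl

end

section

variable {n : ℕ}

/-- Words in two letters, which will act as a `(1,0)` vector field (`true`) and its
conjugate (`false`). -/
abbrev Fr : Type := FreeAlgebra ℂ Bool

/-- A letter of the free algebra. -/
abbrev lett (b : Bool) : Fr := FreeAlgebra.ι ℂ b

/-- The conjugate algebra structure on the free algebra. -/
@[reducible] def conjAlg : Algebra ℂ Fr :=
  RingHom.toAlgebra' ((algebraMap ℂ Fr).comp (starRingEnd ℂ))
    (fun c x => Algebra.commutes (R := ℂ) ((starRingEnd ℂ) c) x)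

/-- The conjugate-linear automorphism exchanging the two letters. -/
def conjF : Fr →+* Fr :=
  RingHomClass.toRingHom (@FreeAlgebra.lift ℂ Bool _ Fr _ conjAlg (fun b => lett !b))

lemma conjF_lett (b : Bool) : conjF (lett b) = lett !b :=
  @FreeAlgebra.lift_ι_apply ℂ Bool _ Fr _ conjAlg (fun b => lett !b) b

lemma conjF_algebraMap (c : ℂ) :
    conjF (algebraMap ℂ Fr c) = algebraMap ℂ Fr ((starRingEnd ℂ) c) :=
  @AlgHom.commutes ℂ Fr Fr _ _ _ _ conjAlg _ c

lemma conjF_smul (c : ℂ) (P : Fr) : conjF (c • P) = (starRingEnd ℂ) c • conjF P := by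
  rw [Algebra.smul_def, map_mul, conjF_algebraMap, ← Algebra.smul_def]

lemma conjF_conjF (P : Fr) : conjF (conjF P) = P := by
  induction P using FreeAlgebra.induction with
  | grade0 c => simp [conjF_algebraMap]
  | grade1 b => simp [conjF_lett]
  | mul a b ha hb => simp [ha, hb]
  | add a b ha hb => simp [ha, hb]

lemma sum_derivation_apply {ι : Type*} (s : Finset ι) (D : ι → Derivation ℂ (Sm n) (Sm n))
    (f : Sm n) : (∑ i ∈ s, D i) f = ∑ i ∈ s, D i f := by
  have := map_sum (Derivation.coeFnAddMonoidHom (R := ℂ) (A := Sm n) (M := Sm n)) D s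
  have h := congrFun this f
  rw [Finset.sum_apply] at h
  exact h

/-- The vector field `X = Σ X_j ∂/∂z_j` (for `true`) or its conjugate (for `false`). -/
def fld (X : Fin n → Sm n) : Bool → Derivation ℂ (Sm n) (Sm n)
  | true => ∑ j, X j • dl j
  | false => ∑ j, star (X j) • db j

lemma fld_star (X : Fin n → Sm n) (b : Bool) (f : Sm n) :
    fld X b (star f) = star (fld X (!b) f) := by
  cases b <;> simp [fld, sum_derivation_apply, dl_star, db_star]

/-- The action of words on smooth functions. -/
def act (X : Fin n → Sm n) : Fr →ₐ[ℂ] Module.End ℂ (Sm n) :=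
  FreeAlgebra.lift ℂ fun b => (fld X b : Sm n →ₗ[ℂ] Sm n)

lemma act_lett (X : Fin n → Sm n) (b : Bool) (f : Sm n) : act X (lett b) f = fld X b f := by
  simp [act]

lemma act_star (X : Fin n → Sm n) (P : Fr) (f : Sm n) :
    act X P (star f) = star (act X (conjF P) f) := by
  induction P using FreeAlgebra.induction generalizing f with
  | grade0 c =>
    ext z
    rw [conjF_algebraMap]
    simp [Algebra.algebraMap_eq_smul_one]
  | grade1 b => rw [conjF_lett, act_lett, act_lett, fld_star]
  | mul a b ha hb => simp [ha, hb]
  | add a b ha hb => simp [ha, hb]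

/-- The Lie algebra generated by the two letters. -/
def lieF : Submodule ℂ Fr :=
  sInf {L | (∀ b, lett b ∈ L) ∧ ∀ x ∈ L, ∀ y ∈ L, x * y - y * x ∈ L}

lemma lett_mem (b : Bool) : lett b ∈ lieF := Submodule.mem_sInf.2 fun _ hL => hL.1 b

lemma lieF_lie {x y : Fr} (hx : x ∈ lieF) (hy : y ∈ lieF) : x * y - y * x ∈ lieF :=
  Submodule.mem_sInf.2 fun _ hL =>
    hL.2 x (Submodule.mem_sInf.1 hx _ hL) y (Submodule.mem_sInf.1 hy _ hL)

lemma lieF_induction {p : Fr → Prop} (hl : ∀ b, p (lett b))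
    (hadd : ∀ x y, p x → p y → p (x + y)) (hsmul : ∀ (c : ℂ) x, p x → p (c • x))
    (hlie : ∀ x y, p x → p y → p (x * y - y * x)) {u : Fr} (hu : u ∈ lieF) : p u := by
  let L : Submodule ℂ Fr :=
    { carrier := {x | p x}
      add_mem' := fun hx hy => hadd _ _ hx hy
      zero_mem' := by
        have := hsmul 0 _ (hl true)
        rw [zero_smul] at this
        exact this
      smul_mem' := fun c x hx => hsmul c x hx }
  exact Submodule.mem_sInf.1 hu L ⟨hl, fun x hx y hy => hlie x y hx hy⟩

lemma conjF_mem {u : Fr} (hu : u ∈ lieF) : conjF u ∈ lieF := by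
  refine lieF_induction (p := fun u => conjF u ∈ lieF) ?_ ?_ ?_ ?_ hu
  · intro b
    rw [conjF_lett]; exact lett_mem _
  · intro x y hx hy
    rw [map_add]; exact lieF.add_mem hx hy
  · intro c x hx
    rw [conjF_smul]; exact lieF.smul_mem _ hx
  · intro x y hx hy
    rw [map_sub, map_mul, map_mul]; exact lieF_lie hx hy

lemma act_mul (X : Fin n → Sm n) {u : Fr} (hu : u ∈ lieF) (f g : Sm n) :
    act X u (f * g) = f * act X u g + g * act X u f := by
  refine lieF_induction (p := fun u => ∀ f g, act X u (f * g) = f * act X u g + g * act X u f)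
    ?_ ?_ ?_ ?_ hu f g
  · intro b f g
    simp [act_lett]
  · intro x y hx hy f g
    simp only [map_add, LinearMap.add_apply, hx, hy]; ring
  · intro c x hx f g
    simp only [map_smul, LinearMap.smul_apply, hx, smul_add, mul_smul_comm]
  · intro x y hx hy f g
    simp only [map_sub, map_mul, Module.End.mul_apply, LinearMap.sub_apply, hx, hy, map_add]; ring

/-- Words acting on the antiholomorphic factors of a function. -/
def opG (X : Fin n → Sm n) : Fr →ₐ[ℂ] Module.End ℂ ((Sm n →ₗ[ℂ] Sm n)) :=
  FreeAlgebra.lift ℂ fun b =>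
    { toFun := fun g => (fld X b : Sm n →ₗ[ℂ] Sm n) ∘ₗ g - bif b then
        ∑ j, LinearMap.mulLeft ℂ (X j) ∘ₗ g ∘ₗ (dl j : Sm n →ₗ[ℂ] Sm n) else 0
      map_add' := fun g h => by
        ext1 f
        cases b <;> simp [LinearMap.sum_apply, mul_add, Finset.sum_add_distrib]
        abel
      map_smul' := fun c g => by
        ext1 f
        cases b <;> simp [LinearMap.sum_apply, smul_sub, Finset.smul_sum] }

lemma opG_true (X : Fin n → Sm n) (g : (Sm n →ₗ[ℂ] Sm n)) (f : Sm n) :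
    opG X (lett true) g f = fld X true (g f) - ∑ j, X j * g (dl j f) := by
  simp [opG, LinearMap.sum_apply]

lemma opG_false (X : Fin n → Sm n) (g : (Sm n →ₗ[ℂ] Sm n)) (f : Sm n) :
    opG X (lett false) g f = fld X false (g f) := by
  simp [opG]

/-- The action of a letter on operator-valued linear forms. -/
def letB (X : Fin n → Sm n) (b : Bool) (β : Fr →ₗ[ℂ] (Sm n →ₗ[ℂ] Sm n)) :
    Fr →ₗ[ℂ] (Sm n →ₗ[ℂ] Sm n) where
  toFun Q := (fld X b : Sm n →ₗ[ℂ] Sm n) ∘ₗ β Q - β (lett b * Q)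
  map_add' P Q := by
    ext1 f
    simp only [map_add, mul_add, LinearMap.sub_apply, LinearMap.add_apply, LinearMap.comp_apply]
    abel
  map_smul' c Q := by
    ext1 f
    simp only [map_smul, mul_smul_comm, LinearMap.sub_apply, LinearMap.smul_apply,
      LinearMap.comp_apply, smul_sub, RingHom.id_apply]

/-- Words acting on operator-valued linear forms by the Leibniz rule. -/
def opB (X : Fin n → Sm n) : Fr →ₐ[ℂ] Module.End ℂ (Fr →ₗ[ℂ] (Sm n →ₗ[ℂ] Sm n)) :=
  FreeAlgebra.lift ℂ fun b =>
    { toFun := letB X b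
      map_add' := fun β γ => by
        ext1 Q
        ext1 f
        simp only [letB, LinearMap.coe_mk, AddHom.coe_mk, LinearMap.sub_apply,
          LinearMap.add_apply, LinearMap.comp_apply, map_add]
        abel
      map_smul' := fun c β => by
        ext1 Q
        ext1 f
        simp only [letB, LinearMap.coe_mk, AddHom.coe_mk, LinearMap.sub_apply,
          LinearMap.smul_apply, LinearMap.comp_apply, map_smul, smul_sub, RingHom.id_apply] }

lemma opB_lett (X : Fin n → Sm n) (b : Bool) (β : Fr →ₗ[ℂ] (Sm n →ₗ[ℂ] Sm n)) (Q : Fr)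
    (f : Sm n) : opB X (lett b) β Q f = fld X b (β Q f) - β (lett b * Q) f := by
  simp [opB, letB]

/-- The operator form of the first argument `1`. -/
def formB₀ (X : Fin n → Sm n) : Fr →ₗ[ℂ] (Sm n →ₗ[ℂ] Sm n) :=
  (LinearMap.applyₗ (LinearMap.id : Sm n →ₗ[ℂ] Sm n)).comp (opG X).toLinearMap

lemma formB₀_apply (X : Fin n → Sm n) (Q : Fr) : formB₀ X Q = opG X Q LinearMap.id := rfl

/-- The polarized action: on a product `f g` with `f` holomorphic and `g` antiholomorphic,
`polB X P Q (f g) = (P f) (Q g)`. -/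
def polB (X : Fin n → Sm n) (P Q : Fr) : (Sm n →ₗ[ℂ] Sm n) := opB X P (formB₀ X) Q

lemma polB_lett_mul (X : Fin n → Sm n) (b : Bool) (P Q : Fr) (f : Sm n) :
    polB X (lett b * P) Q f = fld X b (polB X P Q f) - polB X P (lett b * Q) f := by
  rw [polB, map_mul (opB X), Module.End.mul_apply, opB_lett]; rfl

lemma polB_add_left (X : Fin n → Sm n) (P P' Q : Fr) :
    polB X (P + P') Q = polB X P Q + polB X P' Q := by simp [polB]

lemma polB_smul_left (X : Fin n → Sm n) (c : ℂ) (P Q : Fr) :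
    polB X (c • P) Q = c • polB X P Q := by simp [polB]

lemma polB_add_right (X : Fin n → Sm n) (P Q Q' : Fr) :
    polB X P (Q + Q') = polB X P Q + polB X P Q' := by simp [polB]

lemma polB_smul_right (X : Fin n → Sm n) (c : ℂ) (P Q : Fr) :
    polB X P (c • Q) = c • polB X P Q := by simp [polB]

lemma polB_sub_left (X : Fin n → Sm n) (P P' Q : Fr) :
    polB X (P - P') Q = polB X P Q - polB X P' Q := by
  have : P - P' = P + (-1 : ℂ) • P' := by rw [neg_one_smul, sub_eq_add_neg]
  rw [this, polB_add_left, polB_smul_left]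
  ext1 f
  rw [LinearMap.add_apply, LinearMap.smul_apply, LinearMap.sub_apply, neg_one_smul,
    sub_eq_add_neg]

lemma polB_sub_right (X : Fin n → Sm n) (P Q Q' : Fr) :
    polB X P (Q - Q') = polB X P Q - polB X P Q' := by simp [polB]

lemma polB_one_one (X : Fin n → Sm n) (f : Sm n) : polB X 1 1 f = f := by
  simp [polB, formB₀_apply]

lemma polB_leibniz (X : Fin n → Sm n) {u : Fr} (hu : u ∈ lieF) (P Q : Fr) (f : Sm n) :
    act X u (polB X P Q f) = polB X (u * P) Q f + polB X P (u * Q) f := by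
  refine lieF_induction (p := fun u => ∀ P Q, act X u (polB X P Q f) =
    polB X (u * P) Q f + polB X P (u * Q) f) ?_ ?_ ?_ ?_ hu P Q
  · intro b P Q
    rw [act_lett, polB_lett_mul]; ring
  · intro x y hx hy P Q
    simp only [map_add, LinearMap.add_apply, hx, hy, add_mul, polB_add_left, polB_add_right]
    ring
  · intro c x hx P Q
    simp only [map_smul, LinearMap.smul_apply, hx, smul_add, smul_mul_assoc, polB_smul_left,
      polB_smul_right]
  · intro x y hx hy P Q
    simp only [map_sub, map_mul, Module.End.mul_apply, LinearMap.sub_apply, hx, hy, map_add,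
      sub_mul, polB_sub_left, polB_sub_right, mul_assoc]
    ring

lemma polB_mul_false (X : Fin n → Sm n) (P Q : Fr) : polB X (P * lett false) Q = 0 := by
  have h : opB X (lett false) (formB₀ X) = 0 := by
    ext1 Q
    ext1 f
    rw [opB_lett, formB₀_apply, formB₀_apply, map_mul (opG X), Module.End.mul_apply, opG_false]
    simp
  rw [polB, map_mul (opB X), Module.End.mul_apply, h]; simp

lemma polB_mul_true (X : Fin n → Sm n) (P Q : Fr) : polB X P (Q * lett true) = 0 := by
  have h : ∀ β : Fr →ₗ[ℂ] (Sm n →ₗ[ℂ] Sm n), (∀ Q, β (Q * lett true) = 0) →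
      ∀ Q, opB X P β (Q * lett true) = 0 := by
    induction P using FreeAlgebra.induction with
    | grade0 c =>
      intro β hβ Q
      simp [Algebra.algebraMap_eq_smul_one, hβ]
    | grade1 b =>
      intro β hβ Q
      ext1 f
      rw [opB_lett, ← mul_assoc, hβ, hβ]; simp
    | mul a b ha hb =>
      intro β hβ Q
      rw [map_mul (opB X), Module.End.mul_apply]
      exact ha _ (hb β hβ) Q
    | add a b ha hb =>
      intro β hβ Q
      simp [ha β hβ, hb β hβ]
  refine h _ (fun Q => ?_) Q
  rw [formB₀_apply, map_mul (opG X), Module.End.mul_apply]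
  have : opG X (lett true) LinearMap.id = 0 := by
    ext1 f
    rw [opG_true]
    simp [fld, sum_derivation_apply]
  rw [this, map_zero]

/-- On products of a holomorphic and an antiholomorphic function, `polB` acts on the factors. -/
lemma polB_mul (X : Fin n → Sm n) (P Q : Fr) {f g : Sm n} (hf : ∀ j, db j f = 0)
    (hg : ∀ j, dl j g = 0) : polB X P Q (f * g) = act X P f * act X Q g := by
  have h1 : ∀ Q : Fr, ∀ T : (Sm n →ₗ[ℂ] Sm n), ∀ s, (∀ f, (∀ j, db j f = 0) →
      T (f * g) = f * s) → ∀ f, (∀ j, db j f = 0) → opG X Q T (f * g) = f * act X Q s := by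
    intro Q
    induction Q using FreeAlgebra.induction with
    | grade0 c =>
      intro T s hT f hf
      simp [Algebra.algebraMap_eq_smul_one, hT f hf]
    | grade1 b =>
      intro T s hT f hf
      cases b
      · rw [opG_false, hT f hf, act_lett]
        have : fld X false f = 0 := by simp [fld, sum_derivation_apply, hf]
        simp [this]
      · rw [opG_true, hT f hf, act_lett]
        have h2 : ∀ j, T (dl j (f * g)) = dl j f * s := by
          intro j
          rw [Derivation.leibniz, hg, smul_zero, zero_add, smul_eq_mul, mul_comm, hT]
          intro k
          rw [← dl_db, hf, map_zero]
        simp only [h2]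
        rw [Derivation.leibniz, smul_eq_mul, smul_eq_mul]
        have h3 : s * fld X true f = ∑ j, X j * (dl j f * s) := by
          simp only [fld, sum_derivation_apply, Derivation.smul_apply, smul_eq_mul,
            Finset.mul_sum]
          exact Finset.sum_congr rfl fun j _ => by ring
        rw [h3]; ring
    | mul a b ha hb =>
      intro T s hT f hf
      rw [map_mul (opG X), Module.End.mul_apply, map_mul (act X), Module.End.mul_apply]
      exact ha _ _ (hb T s hT) f hf
    | add a b ha hb =>
      intro T s hT f hf
      simp [ha T s hT f hf, hb T s hT f hf, mul_add]
  have h2 : ∀ β : Fr →ₗ[ℂ] (Sm n →ₗ[ℂ] Sm n), ∀ r, (∀ Q, β Q (f * g) = r * act X Q g) →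
      ∀ Q, opB X P β Q (f * g) = act X P r * act X Q g := by
    induction P using FreeAlgebra.induction with
    | grade0 c =>
      intro β r hβ Q
      simp [Algebra.algebraMap_eq_smul_one, hβ]
    | grade1 b =>
      intro β r hβ Q
      rw [opB_lett, hβ, hβ, act_lett, map_mul (act X), Module.End.mul_apply, act_lett,
        Derivation.leibniz]
      simp only [smul_eq_mul]; ring
    | mul a b ha hb =>
      intro β r hβ Q
      rw [map_mul (opB X), Module.End.mul_apply, map_mul (act X), Module.End.mul_apply]
      exact ha _ _ (hb β r hβ) Q
    | add a b ha hb =>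
      intro β r hβ Q
      simp [ha β r hβ, hb β r hβ, add_mul]
  exact h2 _ f (fun Q => h1 Q LinearMap.id g (fun f _ => rfl) f hf) Q

end

section

variable {n m : ℕ}

/-- All derivatives of order less than `k` vanish at `q`. -/
def Flat (q : Fin n → ℂ) : ℕ → Sm n → Prop
  | 0, _ => True
  | k + 1, f => ev q f = 0 ∧ ∀ v, Flat q k (pd v f)

lemma Flat.zero (q : Fin n → ℂ) (k : ℕ) : Flat q k 0 := by
  induction k with
  | zero => trivial
  | succ k ih => exact ⟨map_zero _, fun v => by rw [map_zero]; exact ih⟩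

lemma Flat.add {q : Fin n → ℂ} {k : ℕ} {f g : Sm n} (hf : Flat q k f) (hg : Flat q k g) :
    Flat q k (f + g) := by
  induction k generalizing f g with
  | zero => trivial
  | succ k ih =>
    exact ⟨by rw [map_add, hf.1, hg.1, add_zero], fun v => by
      rw [map_add]; exact ih (hf.2 v) (hg.2 v)⟩

lemma Flat.smul {q : Fin n → ℂ} {k : ℕ} {f : Sm n} (c : ℂ) (hf : Flat q k f) :
    Flat q k (c • f) := by
  induction k generalizing f with
  | zero => trivial
  | succ k ih =>
    exact ⟨by rw [map_smul, hf.1, smul_zero], fun v => by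
      rw [Derivation.map_smul]; exact ih (hf.2 v)⟩

lemma Flat.sub {q : Fin n → ℂ} {k : ℕ} {f g : Sm n} (hf : Flat q k f) (hg : Flat q k g) :
    Flat q k (f - g) := by
  have : f - g = f + (-1 : ℂ) • g := by rw [neg_one_smul, sub_eq_add_neg]
  rw [this]; exact hf.add (hg.smul _)

lemma Flat.sum {q : Fin n → ℂ} {k : ℕ} {ι : Type*} {s : Finset ι} {f : ι → Sm n}
    (hf : ∀ i ∈ s, Flat q k (f i)) : Flat q k (∑ i ∈ s, f i) := by
  classical
  induction s using Finset.induction_on with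
  | empty => exact Flat.zero q k
  | insert a s ha ih =>
    rw [Finset.sum_insert ha]
    exact (hf a (by simp)).add (ih fun i hi => hf i (by simp [hi]))

lemma Flat.of_succ {q : Fin n → ℂ} {k : ℕ} {f : Sm n} (hf : Flat q (k + 1) f) : Flat q k f := by
  induction k generalizing f with
  | zero => trivial
  | succ k ih => exact ⟨hf.1, fun v => ih (hf.2 v)⟩

lemma Flat.mono {q : Fin n → ℂ} {k l : ℕ} {f : Sm n} (hf : Flat q l f) (h : k ≤ l) :
    Flat q k f := by
  induction l, h using Nat.le_induction with
  | base => exact hf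
  | succ l _ ih => exact ih hf.of_succ

lemma Flat.star {q : Fin n → ℂ} {k : ℕ} {f : Sm n} (hf : Flat q k f) : Flat q k (star f) := by
  induction k generalizing f with
  | zero => trivial
  | succ k ih =>
    exact ⟨by rw [ev_star, hf.1, map_zero], fun v => by rw [pd_star]; exact ih (hf.2 v)⟩

lemma Flat.mul {q : Fin n → ℂ} {k l : ℕ} {f g : Sm n} (hf : Flat q k f) (hg : Flat q l g) :
    Flat q (k + l) (f * g) := by
  induction k generalizing l f g with
  | zero =>
    clear hf
    rw [zero_add]
    induction l generalizing f g with
    | zero => trivial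
    | succ l ih =>
      refine ⟨by rw [map_mul, hg.1, mul_zero], fun v => ?_⟩
      rw [Derivation.leibniz, smul_eq_mul, smul_eq_mul]
      refine (ih (hg.2 v)).add ?_
      rw [mul_comm]
      exact ih hg.of_succ
  | succ k ih =>
    rw [Nat.succ_add_eq_add_succ]
    induction l generalizing f g with
    | zero =>
      refine ⟨by rw [map_mul, hf.1, zero_mul], fun v => ?_⟩
      rw [Derivation.leibniz, smul_eq_mul, smul_eq_mul]
      refine (ih (l := 0) hf.of_succ trivial).add ?_
      rw [mul_comm]
      exact ih (l := 0) (hf.2 v) trivial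
    | succ l ihl =>
      refine ⟨by rw [map_mul, hf.1, zero_mul], fun v => ?_⟩
      rw [Derivation.leibniz, smul_eq_mul, smul_eq_mul]
      refine (ihl hf (hg.2 v)).add ?_
      rw [mul_comm]
      exact ih (hf.2 v) hg

lemma Flat.mul_left {q : Fin n → ℂ} {k : ℕ} {f : Sm n} (g : Sm n) (hf : Flat q k f) :
    Flat q k (g * f) := by
  simpa using Flat.mul (k := 0) (f := g) trivial hf

lemma Flat.mul_right {q : Fin n → ℂ} {k : ℕ} {f : Sm n} (g : Sm n) (hf : Flat q k f) :
    Flat q k (f * g) := by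
  rw [mul_comm]; exact hf.mul_left g

lemma Flat.dl {q : Fin n → ℂ} {k : ℕ} {f : Sm n} (j : Fin n) (hf : Flat q (k + 1) f) :
    Flat q k (dl j f) :=
  ((hf.2 _).sub ((hf.2 _).smul I)).smul (1 / 2 : ℂ)

lemma Flat.db {q : Fin n → ℂ} {k : ℕ} {f : Sm n} (j : Fin n) (hf : Flat q (k + 1) f) :
    Flat q k (db j f) :=
  ((hf.2 _).add ((hf.2 _).smul I)).smul (1 / 2 : ℂ)

lemma fderiv_eq_sum (f : Sm n) (z v : Fin n → ℂ) :
    fderiv ℝ (f : (Fin n → ℂ) → ℂ) z v =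
      ∑ j, (ev z (dl j f) * v j + ev z (db j f) * (starRingEnd ℂ) (v j)) := by
  have hv : v = ∑ j, ((v j).re • (Pi.single j 1 : Fin n → ℂ) +
      (v j).im • (Pi.single j I : Fin n → ℂ)) := by
    ext i
    simp only [Finset.sum_apply, Pi.add_apply, Pi.smul_apply, Pi.single_apply]
    rw [Finset.sum_eq_single i (fun b _ hb => by simp [Ne.symm hb]) (by simp)]
    simp [mul_comm]
    simpa [mul_comm] using (re_add_im (v i)).symm
  conv_lhs => rw [hv]
  rw [map_sum]
  refine Finset.sum_congr rfl fun j _ => ?_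
  rw [ev_apply, ev_apply, dl_apply, db_apply, dz, dzbar, map_add, map_smul, map_smul]
  have h1 : v j = (v j).re + (v j).im * I := (re_add_im (v j)).symm
  have h2 : (starRingEnd ℂ) (v j) = (v j).re - (v j).im * I := by
    apply Complex.ext <;> simp
  rw [h2]
  nth_rw 3 [h1]
  simp only [real_smul]
  generalize fderiv ℝ (f : (Fin n → ℂ) → ℂ) z (Pi.single j 1) = a
  generalize fderiv ℝ (f : (Fin n → ℂ) → ℂ) z (Pi.single j I) = b
  linear_combination (b * (v j).im) * I_sq

lemma pd_eq_sum (f : Sm n) (v : Fin n → ℂ) :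
    pd v f = ∑ j, (v j • dl j f + (starRingEnd ℂ) (v j) • db j f) := by
  ext z
  rw [← ev_apply, ← ev_apply, map_sum, ev_apply, pd_apply, fderiv_eq_sum]
  refine Finset.sum_congr rfl fun j _ => ?_
  rw [map_add, map_smul, map_smul, smul_eq_mul, smul_eq_mul, mul_comm, mul_comm (v j),
    mul_comm (ev z (db j f))]

lemma Flat.succ_of {q : Fin n → ℂ} {k : ℕ} {f : Sm n} (h0 : ev q f = 0)
    (h1 : ∀ j, Flat q k (Stein.dl j f)) (h2 : ∀ j, Flat q k (Stein.db j f)) :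
    Flat q (k + 1) f :=
  ⟨h0, fun v => by
    rw [pd_eq_sum]
    exact Flat.sum fun j _ => ((h1 j).smul _).add ((h2 j).smul _)⟩

/-- Functions vanishing to order `k` are `O(‖v‖ ^ k)`. -/
lemma Flat.bound {q : Fin n → ℂ} {k : ℕ} {f : Sm n} (hf : Flat q k f) :
    ∃ C, 0 ≤ C ∧ ∀ v : Fin n → ℂ, ‖v‖ ≤ 1 → ‖ev (q + v) f‖ ≤ C * ‖v‖ ^ k := by
  induction k generalizing f with
  | zero =>
    obtain ⟨C, hC⟩ := (isCompact_closedBall q 1).exists_bound_of_continuousOn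
      (Sm_continuous f).continuousOn
    refine ⟨|C|, abs_nonneg _, fun v hv => ?_⟩
    rw [pow_zero, mul_one]
    exact (hC (q + v) (by simpa using hv)).trans (le_abs_self C)
  | succ k ih =>
    choose C1 h1 h1' using fun j => ih (hf.dl j)
    choose C2 h2 h2' using fun j => ih (hf.db j)
    refine ⟨∑ j, (C1 j + C2 j), Finset.sum_nonneg fun j _ => add_nonneg (h1 j) (h2 j),
      fun v hv => ?_⟩
    have key : ∀ x ∈ segment ℝ q (q + v), ‖fderiv ℝ (f : (Fin n → ℂ) → ℂ) x‖ ≤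
        (∑ j, (C1 j + C2 j)) * ‖v‖ ^ k := by
      intro x hx
      rw [segment_eq_image'] at hx
      obtain ⟨s, hs, rfl⟩ := hx
      have hsv : ‖s • v‖ ≤ ‖v‖ := by
        rw [norm_smul, Real.norm_of_nonneg hs.1]
        exact mul_le_of_le_one_left (norm_nonneg _) hs.2
      simp only [add_sub_cancel_left]
      refine ContinuousLinearMap.opNorm_le_bound _ (by
        have := Finset.sum_nonneg fun j (_ : j ∈ Finset.univ) => add_nonneg (h1 j) (h2 j)
        positivity) fun u => ?_
      rw [fderiv_eq_sum, Finset.sum_mul, Finset.sum_mul]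
      refine (norm_sum_le _ _).trans (Finset.sum_le_sum fun j _ => ?_)
      refine (norm_add_le _ _).trans ?_
      rw [norm_mul, norm_mul, RCLike.norm_conj, ← add_mul, add_mul (C1 j)]
      have hp : ‖s • v‖ ^ k ≤ ‖v‖ ^ k := by gcongr
      refine mul_le_mul (add_le_add ?_ ?_) (norm_le_pi_norm u j) (norm_nonneg _) ?_
      · exact (h1' j _ (hsv.trans hv)).trans (mul_le_mul_of_nonneg_left hp (h1 j))
      · exact (h2' j _ (hsv.trans hv)).trans (mul_le_mul_of_nonneg_left hp (h2 j))
      · have := h1 j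
        have := h2 j
        positivity
    have := (convex_segment q (q + v)).norm_image_sub_le_of_norm_fderiv_le (𝕜 := ℝ)
      (fun x _ => Sm_differentiable f x) key (left_mem_segment ℝ q (q + v))
      (right_mem_segment ℝ q (q + v))
    rw [add_sub_cancel_left, ← ev_apply, ← ev_apply, hf.1, sub_zero] at this
    rw [pow_succ, ← mul_assoc]
    exact this

lemma Flat.iteratedFDeriv {q : Fin n → ℂ} {k : ℕ} {f : Sm n} (hf : Flat q (k + 1) f) :
    iteratedFDeriv ℝ k (f : (Fin n → ℂ) → ℂ) q = 0 := by
  induction k generalizing f with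
  | zero =>
    ext u
    rw [iteratedFDeriv_zero_apply]
    exact hf.1
  | succ k ih =>
    ext u
    rw [iteratedFDeriv_succ_apply_right]
    have h1 : ContDiffAt ℝ k (fderiv ℝ (f : (Fin n → ℂ) → ℂ)) q :=
      ((Sm_contDiff f).fderiv_right (m := k) (by exact_mod_cast le_top)).contDiffAt
    have h2 := ((ContinuousLinearMap.apply ℝ ℂ (u (Fin.last k))).iteratedFDeriv_comp_left
      h1 (i := k) le_rfl)
    have h3 := ih (hf.2 (u (Fin.last k)))
    have h4 : ((pd (u (Fin.last k)) f : Sm n) : (Fin n → ℂ) → ℂ) =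
      ⇑(ContinuousLinearMap.apply ℝ ℂ (u (Fin.last k))) ∘ fderiv ℝ (f : (Fin n → ℂ) → ℂ) := rfl
    rw [h4, h2] at h3
    have h5 := congrArg (fun φ => φ (Fin.init u)) h3
    simpa using h5

/-- Composition with a smooth map. -/
def cmp (w : Fin n → Sm m) : Sm n →ₐ[ℂ] Sm m where
  toFun f := ⟨fun t => (f : (Fin n → ℂ) → ℂ) fun j => (w j : (Fin m → ℂ) → ℂ) t,
    show ContDiff ℝ (⊤ : ℕ∞) _ from
      (Sm_contDiff f).comp (contDiff_pi.2 fun j => Sm_contDiff (w j))⟩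
  map_one' := rfl
  map_mul' _ _ := rfl
  map_zero' := rfl
  map_add' _ _ := rfl
  commutes' _ := rfl

lemma ev_cmp (w : Fin n → Sm m) (f : Sm n) (t : Fin m → ℂ) :
    ev t (cmp w f) = ev (fun j => ev t (w j)) f := rfl

lemma cmp_star (w : Fin n → Sm m) (f : Sm n) : cmp w (star f) = star (cmp w f) := rfl

lemma cmp_co (w : Fin n → Sm m) (j : Fin n) : cmp w (co j) = w j := rfl

lemma pd_cmp (w : Fin n → Sm m) (f : Sm n) (v : Fin m → ℂ) :
    pd v (cmp w f) = ∑ j, (cmp w (dl j f) * pd v (w j) + cmp w (db j f) * star (pd v (w j))) := by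
  ext t
  have hw : HasFDerivAt (fun t => fun j => (w j : (Fin m → ℂ) → ℂ) t)
      (ContinuousLinearMap.pi fun j => fderiv ℝ (w j : (Fin m → ℂ) → ℂ) t) t :=
    hasFDerivAt_pi.2 fun j => (Sm_differentiable (w j) t).hasFDerivAt
  have h : HasFDerivAt (cmp w f : (Fin m → ℂ) → ℂ) _ t :=
    HasFDerivAt.comp (g := (f : (Fin n → ℂ) → ℂ)) t
      (Sm_differentiable f (fun j => (w j : (Fin m → ℂ) → ℂ) t)).hasFDerivAt hw
  rw [pd_apply, h.fderiv, ContinuousLinearMap.comp_apply, fderiv_eq_sum, ← ev_apply, map_sum]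
  rfl

lemma Flat.cmp {w : Fin n → Sm m} {f : Sm n} {t : Fin m → ℂ} {k : ℕ}
    (hf : Flat (fun j => ev t (w j)) k f) : Flat t k (cmp w f) := by
  induction k generalizing f with
  | zero => trivial
  | succ k ih =>
    refine ⟨hf.1, fun v => ?_⟩
    rw [pd_cmp]
    exact Flat.sum fun j _ => ((ih (hf.dl j)).mul_right _).add ((ih (hf.db j)).mul_right _)

end

section

variable {n : ℕ}

/-- Operators of finite order. -/
def FinOrd (D : Sm n →ₗ[ℂ] Sm n) : Prop :=
  ∃ K, ∀ q k f, Flat q (K + k) f → Flat q k (D f)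

lemma FinOrd.id : FinOrd (LinearMap.id : Sm n →ₗ[ℂ] Sm n) :=
  ⟨0, fun q k f h => by simpa using h⟩

lemma FinOrd.zero : FinOrd (0 : Sm n →ₗ[ℂ] Sm n) :=
  ⟨0, fun q k _ _ => Flat.zero q k⟩

lemma FinOrd.add {D E : Sm n →ₗ[ℂ] Sm n} (hD : FinOrd D) (hE : FinOrd E) : FinOrd (D + E) := by
  obtain ⟨K, hK⟩ := hD
  obtain ⟨L, hL⟩ := hE
  exact ⟨K + L, fun q k f h => (hK q k f (h.mono (by omega))).add (hL q k f (h.mono (by omega)))⟩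

lemma FinOrd.smul {D : Sm n →ₗ[ℂ] Sm n} (c : ℂ) (hD : FinOrd D) : FinOrd (c • D) := by
  obtain ⟨K, hK⟩ := hD
  exact ⟨K, fun q k f h => (hK q k f h).smul c⟩

lemma FinOrd.sub {D E : Sm n →ₗ[ℂ] Sm n} (hD : FinOrd D) (hE : FinOrd E) : FinOrd (D - E) := by
  have : D - E = D + (-1 : ℂ) • E := by
    ext1 f
    rw [LinearMap.add_apply, LinearMap.smul_apply, LinearMap.sub_apply, neg_one_smul,
      sub_eq_add_neg]
  rw [this]; exact hD.add (hE.smul _)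

lemma FinOrd.comp {D E : Sm n →ₗ[ℂ] Sm n} (hD : FinOrd D) (hE : FinOrd E) :
    FinOrd (D ∘ₗ E) := by
  obtain ⟨K, hK⟩ := hD
  obtain ⟨L, hL⟩ := hE
  exact ⟨L + K, fun q k f h => hK q k _ (hL q _ f (h.mono (by omega)))⟩

lemma FinOrd.sum {ι : Type*} {s : Finset ι} {D : ι → (Sm n →ₗ[ℂ] Sm n)}
    (hD : ∀ i, FinOrd (D i)) : FinOrd (∑ i ∈ s, D i) := by
  classical
  induction s using Finset.induction_on with
  | empty => exact FinOrd.zero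
  | insert a s ha ih => rw [Finset.sum_insert ha]; exact (hD a).add ih

lemma FinOrd.mulLeft (g : Sm n) : FinOrd (LinearMap.mulLeft ℂ g) :=
  ⟨0, fun q k f h => by rw [zero_add] at h; exact h.mul_left g⟩

lemma FinOrd.dl (j : Fin n) : FinOrd (dl j : Sm n →ₗ[ℂ] Sm n) :=
  ⟨1, fun q k f h => Flat.dl j (by rwa [add_comm] at h)⟩

lemma FinOrd.fld (X : Fin n → Sm n) (b : Bool) : FinOrd (fld X b : Sm n →ₗ[ℂ] Sm n) := by
  refine ⟨1, fun q k f h => ?_⟩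
  rw [add_comm] at h
  change Flat q k (Stein.fld X b f)
  cases b
  · simp only [Stein.fld, sum_derivation_apply]
    exact Flat.sum fun j _ => (h.db j).mul_left _
  · simp only [Stein.fld, sum_derivation_apply]
    exact Flat.sum fun j _ => (h.dl j).mul_left _

lemma finOrd_opG (X : Fin n → Sm n) (Q : Fr) {g : Sm n →ₗ[ℂ] Sm n} (hg : FinOrd g) :
    FinOrd (opG X Q g) := by
  induction Q using FreeAlgebra.induction generalizing g with
  | grade0 c =>
    rw [AlgHom.commutes, Algebra.algebraMap_eq_smul_one]
    exact hg.smul c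
  | grade1 b =>
    cases b
    · have : opG X (lett false) g = (Stein.fld X false : Sm n →ₗ[ℂ] Sm n) ∘ₗ g := by
        ext1 f; rw [opG_false]; rfl
      rw [this]; exact (FinOrd.fld X _).comp hg
    · have : opG X (lett true) g = (Stein.fld X true : Sm n →ₗ[ℂ] Sm n) ∘ₗ g -
          ∑ j, LinearMap.mulLeft ℂ (X j) ∘ₗ g ∘ₗ (Stein.dl j : Sm n →ₗ[ℂ] Sm n) := by
        ext1 f; rw [opG_true, LinearMap.sub_apply, LinearMap.sum_apply]; rfl
      rw [this]
      exact ((FinOrd.fld X _).comp hg).sub (FinOrd.sum fun j =>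
        (FinOrd.mulLeft _).comp (hg.comp (FinOrd.dl j)))
  | mul a b ha hb =>
    rw [map_mul (opG X), Module.End.mul_apply]
    exact ha (hb hg)
  | add a b ha hb =>
    rw [map_add, LinearMap.add_apply]
    exact (ha hg).add (hb hg)

lemma finOrd_polB (X : Fin n → Sm n) (P Q : Fr) : FinOrd (polB X P Q) := by
  have h : ∀ β : Fr →ₗ[ℂ] (Sm n →ₗ[ℂ] Sm n), (∀ Q, FinOrd (β Q)) →
      ∀ Q, FinOrd (opB X P β Q) := by
    induction P using FreeAlgebra.induction with
    | grade0 c =>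
      intro β hβ Q
      rw [AlgHom.commutes, Algebra.algebraMap_eq_smul_one]
      exact (hβ Q).smul c
    | grade1 b =>
      intro β hβ Q
      have : opB X (lett b) β Q = (Stein.fld X b : Sm n →ₗ[ℂ] Sm n) ∘ₗ β Q - β (lett b * Q) := by
        ext1 f; rw [opB_lett]; rfl
      rw [this]
      exact ((FinOrd.fld X _).comp (hβ Q)).sub (hβ _)
    | mul a b ha hb =>
      intro β hβ Q
      rw [map_mul (opB X), Module.End.mul_apply]
      exact ha _ (hb β hβ) Q
    | add a b ha hb =>
      intro β hβ Q
      rw [map_add]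
      exact (ha β hβ Q).add (hb β hβ Q)
  exact h _ (fun Q => finOrd_opG X Q FinOrd.id) Q

/-- Holomorphic polynomials. -/
def HP (n : ℕ) : Subalgebra ℂ (Sm n) := Algebra.adjoin ℂ (Set.range co)

lemma co_mem_HP (j : Fin n) : co j ∈ HP n := Algebra.subset_adjoin ⟨j, rfl⟩

lemma db_HP {f : Sm n} (hf : f ∈ HP n) (j : Fin n) : db j f = 0 := by
  induction hf using Algebra.adjoin_induction with
  | mem x hx => obtain ⟨i, rfl⟩ := hx; exact db_co j i
  | algebraMap c => exact Derivation.map_algebraMap _ c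
  | add x y _ _ hx hy => rw [map_add, hx, hy, add_zero]
  | mul x y _ _ hx hy => rw [Derivation.leibniz, hx, hy, smul_zero, smul_zero, add_zero]

lemma dl_star_HP {f : Sm n} (hf : f ∈ HP n) (j : Fin n) : dl j (star f) = 0 := by
  rw [dl_star, db_HP hf, star_zero]

lemma dl_mem_HP {f : Sm n} (hf : f ∈ HP n) (j : Fin n) : dl j f ∈ HP n := by
  induction hf using Algebra.adjoin_induction with
  | mem x hx =>
    obtain ⟨i, rfl⟩ := hx
    rw [dl_co]
    split_ifs
    · exact (HP n).one_mem
    · exact (HP n).zero_mem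
  | algebraMap c => rw [Derivation.map_algebraMap]; exact (HP n).zero_mem
  | add x y _ _ hx hy => rw [map_add]; exact (HP n).add_mem hx hy
  | mul x y h1 h2 hx hy =>
    rw [Derivation.leibniz]
    exact (HP n).add_mem ((HP n).mul_mem h1 hy) ((HP n).mul_mem h2 hx)

lemma act_HP (X : Fin n → Sm n) {Z : Fr} (hZ : Z ∈ lieF) {f : Sm n} (hf : f ∈ HP n) :
    act X Z f = ∑ j, dl j f * act X Z (co j) := by
  have h1 : act X Z 1 = 0 := by
    have := act_mul X hZ 1 1
    simpa using this
  induction hf using Algebra.adjoin_induction with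
  | mem x hx =>
    obtain ⟨i, rfl⟩ := hx
    simp [dl_co]
  | algebraMap c =>
    rw [Algebra.algebraMap_eq_smul_one, map_smul, h1, smul_zero]
    simp
  | add x y _ _ hx hy => simp only [map_add, hx, hy, add_mul, Finset.sum_add_distrib]
  | mul x y _ _ hx hy =>
    rw [act_mul X hZ, hx, hy, Finset.mul_sum, Finset.mul_sum, ← Finset.sum_add_distrib]
    refine Finset.sum_congr rfl fun j _ => ?_
    rw [Derivation.leibniz, smul_eq_mul, smul_eq_mul]; ring

/-- The span of products of holomorphic and antiholomorphic polynomials. -/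
def HA (n : ℕ) : Submodule ℂ (Sm n) :=
  Submodule.span ℂ {f | ∃ F ∈ HP n, ∃ G ∈ HP n, f = F * star G}

/-- The derivations `∂/∂z_j` and `∂/∂z̄_j`. -/
def dd : Fin n ⊕ Fin n → Derivation ℂ (Sm n) (Sm n) := Sum.elim dl db

lemma dd_comm (i j : Fin n ⊕ Fin n) (f : Sm n) : dd i (dd j f) = dd j (dd i f) := by
  rcases i with i | i <;> rcases j with j | j
  · exact dl_dl i j f
  · exact dl_db i j f
  · exact (dl_db j i f).symm
  · exact db_db i j f

/-- The formal Taylor terms (without factorials). -/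
def tk : ℕ → Sm n → MvPolynomial (Fin n ⊕ Fin n) (Sm n)
  | 0, f => MvPolynomial.C f
  | k + 1, f => ∑ i, MvPolynomial.X i * tk k (dd i f)

lemma tk_homogeneous (k : ℕ) (f : Sm n) : (tk k f).IsHomogeneous k := by
  induction k generalizing f with
  | zero => exact MvPolynomial.isHomogeneous_C _ _
  | succ k ih =>
    refine MvPolynomial.IsHomogeneous.sum _ _ _ fun i _ => ?_
    rw [add_comm]
    exact (MvPolynomial.isHomogeneous_X _ i).mul (ih _)

lemma pderiv_tk (k : ℕ) (f : Sm n) (i : Fin n ⊕ Fin n) :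
    MvPolynomial.pderiv i (tk (k + 1) f) = ((k : ℂ) + 1) • tk k (dd i f) := by
  have hs : ∀ k, ∀ f : Sm n, MvPolynomial.pderiv i (tk (k + 1) f) =
      ∑ j, (MvPolynomial.X j * MvPolynomial.pderiv i (tk k (dd j f))) + tk k (dd i f) := by
    intro k f
    rw [tk, map_sum]
    simp only [Derivation.leibniz, MvPolynomial.pderiv_X, smul_eq_mul, Finset.sum_add_distrib]
    congr 1
    rw [Finset.sum_eq_single i]
    · simp
    · intro b _ hb
      simp [hb]
    · simp
  induction k generalizing f with
  | zero => rw [hs]; simp [tk]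
  | succ k ih =>
    rw [hs]
    simp only [ih, mul_smul_comm]
    rw [← Finset.smul_sum]
    have : ∑ j, MvPolynomial.X j * tk k (dd i (dd j f)) = tk (k + 1) (dd i f) := by
      rw [tk]; simp only [dd_comm i]
    rw [this]
    push_cast
    module

/-- The Taylor polynomial of degree `K` at `q`, in the variables `z - q`, `conj (z - q)`. -/
def jet (q : Fin n → ℂ) (K : ℕ) (f : Sm n) : MvPolynomial (Fin n ⊕ Fin n) ℂ :=
  ∑ k ∈ Finset.range K, (k.factorial : ℂ)⁻¹ • MvPolynomial.map (ev q : Sm n →+* ℂ) (tk k f)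

/-- The functions `z - q`, `conj (z - q)`. -/
def zz (q : Fin n → ℂ) : Fin n ⊕ Fin n → Sm n :=
  Sum.elim (fun j => co j - algebraMap ℂ _ (q j)) fun j => star (co j - algebraMap ℂ _ (q j))

lemma dd_zz (q : Fin n → ℂ) (i j : Fin n ⊕ Fin n) :
    dd i (zz q j) = if i = j then 1 else 0 := by
  have h : ∀ j, dl j (star (co (n := n) j)) = 0 := fun j => dl_star_HP (co_mem_HP j) j
  rcases i with i | i <;> rcases j with j | j
  · simp [dd, zz, dl_co]
  · simp [dd, zz, dl_star, db_co]
  · simp [dd, zz, db_co]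
  · simp only [dd, zz, Sum.elim_inr, db_star, map_sub, dl_co, Derivation.map_algebraMap, sub_zero,
      Sum.inr.injEq]
    split_ifs <;> simp

lemma ev_zz (q : Fin n → ℂ) (j : Fin n ⊕ Fin n) : ev q (zz q j) = 0 := by
  rcases j with j | j
  · simp [zz, ev_apply, co_apply, Algebra.algebraMap_eq_smul_one]
  · simp [zz, ev_apply, co_apply, Algebra.algebraMap_eq_smul_one]

lemma dd_aeval_zz (q : Fin n → ℂ) (i : Fin n ⊕ Fin n) (p : MvPolynomial (Fin n ⊕ Fin n) ℂ) :
    dd i (MvPolynomial.aeval (zz q) p) = MvPolynomial.aeval (zz q) (MvPolynomial.pderiv i p) := by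
  induction p using MvPolynomial.induction_on with
  | C a => simp
  | add p p' h h' => simp [h, h']
  | mul_X p j h =>
    rw [map_mul, Derivation.leibniz, Derivation.leibniz, h, MvPolynomial.aeval_X, dd_zz,
      MvPolynomial.pderiv_X, map_add]
    simp only [smul_eq_mul, map_mul, MvPolynomial.aeval_X, Pi.single_apply]
    congr 2
    by_cases h : i = j
    · simp [h]
    · simp [h, Ne.symm h]

lemma pderiv_jet (q : Fin n → ℂ) (K : ℕ) (f : Sm n) (i : Fin n ⊕ Fin n) :
    MvPolynomial.pderiv i (jet q (K + 1) f) = jet q K (dd i f) := by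
  rw [jet, jet, Finset.sum_range_succ', map_add, map_sum]
  have h0 : MvPolynomial.pderiv i (((0 : ℕ).factorial : ℂ)⁻¹ •
      MvPolynomial.map (ev q : Sm n →+* ℂ) (tk 0 f)) = 0 := by
    rw [Derivation.map_smul, tk, MvPolynomial.map_C, MvPolynomial.pderiv_C, smul_zero]
  rw [h0, add_zero]
  refine Finset.sum_congr rfl fun k _ => ?_
  rw [Derivation.map_smul, MvPolynomial.pderiv_map, pderiv_tk]
  have : MvPolynomial.map (ev q : Sm n →+* ℂ) (((k : ℂ) + 1) • tk k (dd i f)) =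
      ((k : ℂ) + 1) • MvPolynomial.map (ev q : Sm n →+* ℂ) (tk k (dd i f)) := by
    ext m
    simp only [MvPolynomial.coeff_map, MvPolynomial.coeff_smul, RingHom.coe_coe, map_smul]
  rw [this, smul_smul]
  congr 1
  have : (k : ℂ) + 1 ≠ 0 := by exact_mod_cast k.succ_ne_zero
  have : (k.factorial : ℂ) ≠ 0 := by exact_mod_cast k.factorial_ne_zero
  rw [Nat.factorial_succ]
  push_cast
  field_simp

lemma ev_aeval_jet (q : Fin n → ℂ) (K : ℕ) (f : Sm n) :
    ev q (MvPolynomial.aeval (zz q) (jet q (K + 1) f)) = ev q f := by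
  have h : ∀ p : MvPolynomial (Fin n ⊕ Fin n) ℂ, ev q (MvPolynomial.aeval (zz q) p) =
      MvPolynomial.eval 0 p := by
    intro p
    have : (ev q).comp (MvPolynomial.aeval (zz q)) =
        MvPolynomial.aeval (0 : Fin n ⊕ Fin n → ℂ) := by
      ext j
      simp [ev_zz]
    rw [← AlgHom.comp_apply, this]; exact MvPolynomial.eval₂_id p
  rw [h, jet, Finset.sum_range_succ', map_add, map_sum, Finset.sum_eq_zero]
  · simp [tk]
  · intro k _
    rw [MvPolynomial.smul_eval, MvPolynomial.eval_map, tk, MvPolynomial.eval₂_sum,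
      Finset.sum_eq_zero, mul_zero]
    intro i _
    rw [MvPolynomial.eval₂_mul, MvPolynomial.eval₂_X]; simp

lemma flat_sub_jet (q : Fin n → ℂ) (K : ℕ) (f : Sm n) :
    Flat q K (f - MvPolynomial.aeval (zz q) (jet q K f)) := by
  induction K generalizing f with
  | zero => trivial
  | succ K ih =>
    have h : ∀ i, Flat q K (dd i (f - MvPolynomial.aeval (zz q) (jet q (K + 1) f))) := by
      intro i
      rw [map_sub, dd_aeval_zz, pderiv_jet]
      exact ih _
    exact Flat.succ_of (by rw [map_sub, ev_aeval_jet, sub_self]) (fun j => h (Sum.inl j))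
      fun j => h (Sum.inr j)

lemma aeval_zz_monomial (q : Fin n → ℂ) (μ : Fin n ⊕ Fin n →₀ ℕ) (c : ℂ) :
    MvPolynomial.aeval (zz q) (MvPolynomial.monomial μ c) =
      c • ((∏ j, (zz q (Sum.inl j)) ^ μ (Sum.inl j)) *
        star (∏ j, (zz q (Sum.inl j)) ^ μ (Sum.inr j))) := by
  rw [MvPolynomial.aeval_monomial, Finsupp.prod_fintype _ _ (by simp), Fintype.prod_sum_type,
    star_prod, Algebra.smul_def]
  simp only [star_pow]
  rfl

lemma zz_inl_mem (q : Fin n → ℂ) (j : Fin n) : zz q (Sum.inl j) ∈ HP n :=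
  (HP n).sub_mem (co_mem_HP j) ((HP n).algebraMap_mem _)

lemma aeval_zz_mem (q : Fin n → ℂ) (p : MvPolynomial (Fin n ⊕ Fin n) ℂ) :
    MvPolynomial.aeval (zz q) p ∈ HA n := by
  induction p using MvPolynomial.induction_on' with
  | monomial μ c =>
    rw [aeval_zz_monomial]
    refine (HA n).smul_mem _ (Submodule.subset_span ⟨_, ?_, _, ?_, rfl⟩) <;>
    exact Subalgebra.prod_mem _ fun j _ => Subalgebra.pow_mem _ (zz_inl_mem q j) _
  | add p p' h h' => rw [map_add]; exact (HA n).add_mem h h'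

lemma exists_HA (q : Fin n → ℂ) (K : ℕ) (f : Sm n) : ∃ τ ∈ HA n, Flat q K (f - τ) :=
  ⟨_, aeval_zz_mem q _, flat_sub_jet q K f⟩

lemma ev_eq_zero_of_flat {q : Fin n → ℂ} {f : Sm n} (hf : Flat q 1 f) : ev q f = 0 := hf.1

/-- Conjugation symmetry of the polarized action. -/
lemma polB_star (X : Fin n → Sm n) (P Q : Fr) (f : Sm n) :
    polB X P Q (star f) = star (polB X (conjF Q) (conjF P) f) := by
  have h : ∀ f ∈ HA n, polB X P Q (star f) = star (polB X (conjF Q) (conjF P) f) := by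
    intro f hf
    induction hf using Submodule.span_induction with
    | mem x hx =>
      obtain ⟨F, hF, G, hG, rfl⟩ := hx
      rw [star_mul, star_star, polB_mul X P Q (db_HP hG) (dl_star_HP hF),
        polB_mul X _ _ (db_HP hF) (dl_star_HP hG), star_mul, act_star X Q F,
        act_star X (conjF P) G, conjF_conjF, star_star]
    | zero => simp
    | add x y _ _ hx hy => simp only [star_add, map_add, hx, hy]
    | smul c x _ hx => simp only [star_smul, map_smul, hx]
  obtain ⟨K, hK⟩ := finOrd_polB X P Q
  obtain ⟨L, hL⟩ := finOrd_polB X (conjF Q) (conjF P)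
  ext q
  obtain ⟨τ, hτ, hfl⟩ := exists_HA q (K + L + 1) f
  have h1 := (hK q 1 _ ((hfl.star).mono (by omega))).1
  have h2 := (hL q 1 _ (hfl.mono (by omega))).1
  rw [star_sub, map_sub, map_sub, sub_eq_zero] at h1
  rw [map_sub, map_sub, sub_eq_zero] at h2
  rw [← ev_apply, ← ev_apply, h1, ev_star, h2, h τ hτ, ev_star]

end

section

variable {n : ℕ}

/-- The formal exponential `f ↦ ∑ tᵃ / a! (Yᵃ f)(q)`. -/
def Ex (X : Fin n → Sm n) (q : Fin n → ℂ) (Y : Fr) : Sm n →ₗ[ℂ] PowerSeries ℂ where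
  toFun f := PowerSeries.mk fun a => (a.factorial : ℂ)⁻¹ * ev q (act X (Y ^ a) f)
  map_add' f g := by ext a; simp [mul_add]
  map_smul' c f := by ext a; simp; ring

lemma coeff_Ex (X : Fin n → Sm n) (q : Fin n → ℂ) (Y : Fr) (f : Sm n) (a : ℕ) :
    PowerSeries.coeff a (Ex X q Y f) = (a.factorial : ℂ)⁻¹ * ev q (act X (Y ^ a) f) := by
  simp [Ex]

lemma coeff_succ_Ex (X : Fin n → Sm n) (q : Fin n → ℂ) (Y : Fr) (f : Sm n) (a : ℕ) :
    PowerSeries.coeff (a + 1) (Ex X q Y f) * ((a : ℂ) + 1) =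
      PowerSeries.coeff a (Ex X q Y (act X Y f)) := by
  rw [coeff_Ex, coeff_Ex, pow_succ, map_mul, Module.End.mul_apply, Nat.factorial_succ]
  have : (a : ℂ) + 1 ≠ 0 := by exact_mod_cast a.succ_ne_zero
  push_cast
  field_simp

lemma Ex_mul (X : Fin n → Sm n) (q : Fin n → ℂ) {Y : Fr} (hY : Y ∈ lieF) (f g : Sm n) :
    Ex X q Y (f * g) = Ex X q Y f * Ex X q Y g := by
  ext k
  induction k generalizing f g with
  | zero =>
    rw [PowerSeries.coeff_mul]
    simp [coeff_Ex]
  | succ k ih =>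
    have hk : (k : ℂ) + 1 ≠ 0 := by exact_mod_cast k.succ_ne_zero
    have hd : ∀ f, PowerSeries.derivative ℂ (Ex X q Y f) = Ex X q Y (act X Y f) := by
      intro f
      ext a
      rw [PowerSeries.coeff_derivative, coeff_succ_Ex]
    apply mul_right_cancel₀ hk
    rw [coeff_succ_Ex, act_mul X hY, map_add, map_add, ih, ih]
    have := PowerSeries.coeff_derivative (Ex X q Y f * Ex X q Y g) k
    rw [← this, Derivation.leibniz, hd, hd, map_add, smul_eq_mul, smul_eq_mul]

lemma act_one (X : Fin n → Sm n) {Z : Fr} (hZ : Z ∈ lieF) : act X Z 1 = 0 := by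
  have := act_mul X hZ 1 1
  simpa using this

lemma Ex_one (X : Fin n → Sm n) (q : Fin n → ℂ) {Y : Fr} (hY : Y ∈ lieF) : Ex X q Y 1 = 1 := by
  ext k
  rw [coeff_Ex, PowerSeries.coeff_one]
  cases k with
  | zero => simp
  | succ k => simp [pow_succ, act_one X hY]

/-- The coordinate of `ℂ¹`. -/
abbrev tt : Sm 1 := co 0

/-- Truncated power series as functions on `ℂ`. -/
def trf (N : ℕ) : PowerSeries ℂ →ₗ[ℂ] Sm 1 where
  toFun s := ∑ a ∈ Finset.range N, PowerSeries.coeff a s • tt ^ a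
  map_add' s s' := by simp [add_smul, Finset.sum_add_distrib]
  map_smul' c s := by simp [mul_smul, Finset.smul_sum]

lemma trf_apply (N : ℕ) (s : PowerSeries ℂ) :
    trf N s = ∑ a ∈ Finset.range N, PowerSeries.coeff a s • tt ^ a := rfl

lemma flat_tt : Flat 0 1 tt := ⟨by simp [ev_apply, co_apply], fun _ => trivial⟩

lemma flat_tt_pow (a : ℕ) : Flat 0 a (tt ^ a) := by
  induction a with
  | zero => trivial
  | succ a ih => rw [pow_succ]; exact ih.mul flat_tt

lemma flat_tt_mul_star (a b : ℕ) : Flat 0 (a + b) (tt ^ a * star tt ^ b) := by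
  rw [← star_pow]
  exact (flat_tt_pow a).mul (flat_tt_pow b).star

lemma sum_prod_range_flat (N : ℕ) (c : ℕ → ℕ → Sm 1) (hc : ∀ a b, Flat 0 (a + b) (c a b)) :
    Flat 0 N (∑ a ∈ Finset.range N, ∑ b ∈ Finset.range N, c a b -
      ∑ k ∈ Finset.range N, ∑ p ∈ Finset.HasAntidiagonal.antidiagonal k, c p.1 p.2) := by
  rw [← Finset.sum_product' (Finset.range N) (Finset.range N) c]
  have h1 : ∑ k ∈ Finset.range N, ∑ p ∈ Finset.HasAntidiagonal.antidiagonal k, c p.1 p.2 =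
      ∑ p ∈ (Finset.range N ×ˢ Finset.range N).filter (fun p => p.1 + p.2 < N), c p.1 p.2 := by
    rw [← Finset.sum_fiberwise_of_maps_to (t := Finset.range N) (g := fun p : ℕ × ℕ => p.1 + p.2)]
    · refine Finset.sum_congr rfl fun k hk => Finset.sum_congr ?_ fun _ _ => rfl
      ext ⟨a, b⟩
      simp only [Finset.HasAntidiagonal.mem_antidiagonal, Finset.mem_filter, Finset.mem_product,
        Finset.mem_range] at hk ⊢
      omega
    · intro p hp
      simpa using (Finset.mem_filter.1 hp).2
  rw [h1, ← Finset.sum_filter_add_sum_filter_not (Finset.range N ×ˢ Finset.range N)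
    (fun p => p.1 + p.2 < N), add_sub_cancel_left]
  refine Flat.sum fun p hp => (hc p.1 p.2).mono ?_
  have := (Finset.mem_filter.1 hp).2
  omega

lemma trf_mul (N : ℕ) (s s' : PowerSeries ℂ) :
    Flat 0 N (trf N s * trf N s' - trf N (s * s')) := by
  have h := sum_prod_range_flat N (fun a b => PowerSeries.coeff a s • tt ^ a *
    PowerSeries.coeff b s' • tt ^ b) fun a b =>
      (((flat_tt_pow a).smul _).mul ((flat_tt_pow b).smul _))
  rw [trf_apply N s, trf_apply N s', Finset.sum_mul_sum]
  convert h using 2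
  rw [trf_apply]
  refine Finset.sum_congr rfl fun k _ => ?_
  rw [PowerSeries.coeff_mul, Finset.sum_smul]
  refine Finset.sum_congr rfl fun p hp => ?_
  rw [smul_mul_smul_comm, ← pow_add, Finset.HasAntidiagonal.mem_antidiagonal.1 hp]

lemma ev_trf (N : ℕ) (hN : 0 < N) (s : PowerSeries ℂ) :
    ev 0 (trf N s) = PowerSeries.coeff 0 s := by
  rw [trf_apply, map_sum, Finset.sum_eq_single 0]
  · simp
  · intro b _ hb
    simp [ev_apply, co_apply, hb]
  · intro h; simp at h; omega

/-- The curve `t ↦ exp(t Y) q`, truncated. -/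
def crv (X : Fin n → Sm n) (q : Fin n → ℂ) (Y : Fr) (N : ℕ) (j : Fin n) : Sm 1 :=
  trf N (Ex X q Y (co j))

lemma ev_crv (X : Fin n → Sm n) (q : Fin n → ℂ) (Y : Fr) {N : ℕ} (hN : 0 < N) :
    (fun j => ev 0 (crv X q Y N j)) = q := by
  funext j
  rw [crv, ev_trf N hN, coeff_Ex]
  simp [ev_apply, co_apply]

lemma Flat.congr_mul {m : ℕ} {q : Fin m → ℂ} {N : ℕ} {f f' g g' : Sm m} (hf : Flat q N (f - f'))
    (hg : Flat q N (g - g')) : Flat q N (f * g - f' * g') := by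
  have : f * g - f' * g' = (f - f') * g + f' * (g - g') := by ring
  rw [this]; exact (hf.mul_right _).add (hg.mul_left _)

lemma Flat.trans {m : ℕ} {q : Fin m → ℂ} {N : ℕ} {f g h : Sm m} (hf : Flat q N (f - g))
    (hg : Flat q N (g - h)) : Flat q N (f - h) := by
  have : f - h = (f - g) + (g - h) := by ring
  rw [this]; exact hf.add hg

lemma cmp_crv (X : Fin n → Sm n) (q : Fin n → ℂ) {Y : Fr} (hY : Y ∈ lieF) (N : ℕ) {f : Sm n}
    (hf : f ∈ HP n) : Flat 0 N (cmp (crv X q Y N) f - trf N (Ex X q Y f)) := by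
  rcases Nat.eq_zero_or_pos N with rfl | hN
  · trivial
  induction hf using Algebra.adjoin_induction with
  | mem x hx =>
    obtain ⟨i, rfl⟩ := hx
    rw [cmp_co, crv, sub_self]; exact Flat.zero _ _
  | algebraMap c =>
    have : trf N (1 : PowerSeries ℂ) = 1 := by
      rw [trf_apply, Finset.sum_eq_single 0]
      · simp
      · intro b _ hb; simp [PowerSeries.coeff_one, hb]
      · intro h; simp at h; omega
    rw [Algebra.algebraMap_eq_smul_one, map_smul, map_smul, map_smul, map_one, Ex_one X q hY, this,
      sub_self]
    exact Flat.zero _ _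
  | add x y _ _ hx hy =>
    have := hx.add hy
    simp only [map_add]
    convert this using 1; ring
  | mul x y _ _ hx hy =>
    rw [map_mul, Ex_mul X q hY]
    exact (hx.congr_mul hy).trans (trf_mul N _ _)

/-- The double Taylor polynomial with coefficients `polB (Yᵃ P) (Yᵇ Q) ρ (q) / (a! b!)`. -/
def dbl (X : Fin n → Sm n) (q : Fin n → ℂ) (Y P Q : Fr) (N : ℕ) : Sm n →ₗ[ℂ] Sm 1 where
  toFun f := ∑ a ∈ Finset.range N, ∑ b ∈ Finset.range N,
    ((a.factorial : ℂ)⁻¹ * (b.factorial : ℂ)⁻¹ * ev q (polB X (Y ^ a * P) (Y ^ b * Q) f)) •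
      (tt ^ a * star tt ^ b)
  map_add' f g := by simp [mul_add, add_smul, Finset.sum_add_distrib]
  map_smul' c f := by
    simp only [map_smul, smul_eq_mul, RingHom.id_apply, Finset.smul_sum, smul_smul]
    exact Finset.sum_congr rfl fun a _ => Finset.sum_congr rfl fun b _ => by
      congr 1; ring

lemma dbl_apply (X : Fin n → Sm n) (q : Fin n → ℂ) (Y P Q : Fr) (N : ℕ) (f : Sm n) :
    dbl X q Y P Q N f = ∑ a ∈ Finset.range N, ∑ b ∈ Finset.range N,
    ((a.factorial : ℂ)⁻¹ * (b.factorial : ℂ)⁻¹ * ev q (polB X (Y ^ a * P) (Y ^ b * Q) f)) •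
      (tt ^ a * star tt ^ b) := rfl

lemma dbl_mul (X : Fin n → Sm n) (q : Fin n → ℂ) {Y : Fr} (hY : conjF Y = Y) (P Q : Fr) (N : ℕ)
    {F G : Sm n} (hF : F ∈ HP n) (hG : G ∈ HP n) :
    dbl X q Y P (conjF Q) N (F * star G) =
      trf N (Ex X q Y (act X P F)) * star (trf N (Ex X q Y (act X Q G))) := by
  rw [dbl_apply, trf_apply, trf_apply, star_sum, Finset.sum_mul_sum]
  refine Finset.sum_congr rfl fun a _ => Finset.sum_congr rfl fun b _ => ?_
  rw [polB_mul X _ _ (db_HP hF) (dl_star_HP hG), star_smul, smul_mul_smul_comm, star_pow, map_mul,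
    act_star, map_mul conjF, map_pow, hY, conjF_conjF, coeff_Ex, coeff_Ex, ev_star,
    map_mul (act X), map_mul (act X), Module.End.mul_apply, Module.End.mul_apply]
  congr 1
  simp only [star_mul', RCLike.star_def, map_inv₀, map_natCast]
  ring

lemma flat_sub_dbl (X : Fin n → Sm n) (q : Fin n → ℂ) {Y : Fr} (hY : conjF Y = Y) (P Q : Fr)
    (N : ℕ) (Λ : Sm n →ₗ[ℂ] Sm 1) {K : ℕ} (hΛ : ∀ f, Flat q K f → Flat 0 N (Λ f))
    (h : ∀ F ∈ HP n, ∀ G ∈ HP n, Flat 0 N (Λ (F * star G) -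
      trf N (Ex X q Y (act X P F)) * star (trf N (Ex X q Y (act X Q G))))) (f : Sm n) :
    Flat 0 N (Λ f - dbl X q Y P (conjF Q) N f) := by
  have h1 : ∀ f ∈ HA n, Flat 0 N (Λ f - dbl X q Y P (conjF Q) N f) := by
    intro f hf
    induction hf using Submodule.span_induction with
    | mem x hx =>
      obtain ⟨F, hF, G, hG, rfl⟩ := hx
      rw [dbl_mul X q hY P Q N hF hG]; exact h F hF G hG
    | zero => rw [map_zero, map_zero, sub_zero]; exact Flat.zero _ _
    | add x y _ _ hx hy =>
      simp only [map_add]; convert hx.add hy using 1; ring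
    | smul c x _ hx =>
      simp only [map_smul]; convert hx.smul c using 1; rw [smul_sub]
  choose L hL using fun a b => finOrd_polB X (Y ^ a * P) (Y ^ b * conjF Q)
  let M := ∑ a ∈ Finset.range N, ∑ b ∈ Finset.range N, (L a b + 1)
  obtain ⟨τ, hτ, hfl⟩ := exists_HA q (K + M) f
  have h2 : dbl X q Y P (conjF Q) N (f - τ) = 0 := by
    rw [dbl_apply]
    refine Finset.sum_eq_zero fun a ha => Finset.sum_eq_zero fun b hb => ?_
    have h3 : L a b + 1 ≤ M :=
      (Finset.single_le_sum (f := fun b => L a b + 1) (fun _ _ => Nat.zero_le _) hb).trans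
        (Finset.single_le_sum (f := fun a => ∑ b ∈ Finset.range N, (L a b + 1))
          (fun _ _ => Nat.zero_le _) ha)
    have := (hL a b q 1 _ (hfl.mono (by omega))).1
    rw [this, mul_zero, zero_smul]
  have h3 := (hΛ _ (hfl.mono (by omega))).add (h1 τ hτ)
  rw [map_sub, sub_eq_zero] at h2
  rw [h2]
  convert h3 using 1
  rw [map_sub]; ring

/-- The coefficients of the expansion along `exp(iεY)`. -/
def coE (X : Fin n → Sm n) (ρ : Sm n) (q : Fin n → ℂ) (Y P Q : Fr) (k : ℕ) : ℂ :=
  ∑ p ∈ Finset.HasAntidiagonal.antidiagonal k, I ^ p.1 * (-I) ^ p.2 *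
    ((p.1.factorial : ℂ)⁻¹ * (p.2.factorial : ℂ)⁻¹ *
      ev q (polB X (Y ^ p.1 * P) (Y ^ p.2 * Q) ρ))

/-- The point `iε` of `ℂ¹`. -/
def pt (ε : ℝ) : Fin 1 → ℂ := fun _ => I * ε

lemma norm_pt (ε : ℝ) : ‖pt ε‖ = |ε| := by
  rw [show pt ε = fun _ => I * ε from rfl, pi_norm_const, norm_mul]
  simp

lemma dbl_expansion (X : Fin n → Sm n) (ρ : Sm n) (q : Fin n → ℂ) (Y P Q : Fr) (N : ℕ) {g : Sm 1}
    (hg : Flat 0 N (g - dbl X q Y P Q N ρ)) : ∃ C, 0 ≤ C ∧ ∀ ε : ℝ, 0 ≤ ε → ε ≤ 1 →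
      ‖ev (pt ε) g - ∑ k ∈ Finset.range N, (ε : ℂ) ^ k * coE X ρ q Y P Q k‖ ≤ C * ε ^ N := by
  have h1 := hg.trans (sum_prod_range_flat N (fun a b => ((a.factorial : ℂ)⁻¹ *
    (b.factorial : ℂ)⁻¹ * ev q (polB X (Y ^ a * P) (Y ^ b * Q) ρ)) • (tt ^ a * star tt ^ b))
    fun a b => (flat_tt_mul_star a b).smul _)
  obtain ⟨C, hC, h⟩ := h1.bound
  refine ⟨C, hC, fun ε h0 h1 => ?_⟩
  have h2 := h (pt ε) (by rw [norm_pt, abs_of_nonneg h0]; exact h1)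
  rw [norm_pt, abs_of_nonneg h0, zero_add, map_sub] at h2
  convert h2 using 3
  rw [map_sum]
  refine Finset.sum_congr rfl fun k _ => ?_
  rw [map_sum, coE, Finset.mul_sum]
  refine Finset.sum_congr rfl fun p hp => ?_
  rw [map_smul, map_mul, map_pow, map_pow, ev_star]
  have h3 : ev (pt ε) tt = I * ε := rfl
  rw [h3, map_mul, conj_I, conj_ofReal, ← Finset.HasAntidiagonal.mem_antidiagonal.1 hp, smul_eq_mul]
  ring

end

section

variable {n : ℕ}

/-- The lower bound for the Levi form near a boundary point of a pseudoconvex domain. -/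
def PscAt (ρ : Sm n) (q : Fin n → ℂ) : Prop :=
  ∃ C : ℝ, 0 ≤ C ∧ ∀ᶠ z in 𝓝 q, ∀ Z : Fin n → ℂ,
    -C * (‖ev z ρ‖ * ‖Z‖ ^ 2 + ‖Z‖ * ‖∑ j, Z j * ev z (dl j ρ)‖) ≤
      (∑ j, ∑ k, ev z (dl j (db k ρ)) * Z j * (starRingEnd ℂ) (Z k)).re

lemma flat_star_sub {m k : ℕ} {q : Fin m → ℂ} {f g : Sm m} (h : Flat q k (f - g)) :
    Flat q k (star f - star g) := by
  have := h.star
  have e : star (f - g) = star f - star g := by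
    apply Subtype.ext; funext z; exact map_sub (starRingEnd ℂ) _ _
  rwa [e] at this

/-- The displaced vector field. -/
def dsp (X : Fin n → Sm n) (q : Fin n → ℂ) (Y Z : Fr) (N : ℕ) (j : Fin n) : Sm 1 :=
  trf N (Ex X q Y (act X Z (co j)))

lemma sum_cmp_dsp (X : Fin n → Sm n) (q : Fin n → ℂ) {Y Z : Fr} (hY : Y ∈ lieF) (hZ : Z ∈ lieF)
    (N : ℕ) {F : Sm n} (hF : F ∈ HP n) :
    Flat 0 N (∑ j, cmp (crv X q Y N) (dl j F) * dsp X q Y Z N j -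
      trf N (Ex X q Y (act X Z F))) := by
  rw [act_HP X hZ hF, map_sum, map_sum, ← Finset.sum_sub_distrib]
  refine Flat.sum fun j _ => ?_
  rw [Ex_mul X q hY]
  refine Flat.trans (Flat.congr_mul (cmp_crv X q hY N (dl_mem_HP hF j)) (g' := dsp X q Y Z N j) ?_)
    (trf_mul N _ _)
  rw [sub_self]; exact Flat.zero _ _

section Displacement

variable (X : Fin n → Sm n) (ρ : Sm n) (q : Fin n → ℂ) {Y Z : Fr} (hY : Y ∈ lieF)
  (hYr : conjF Y = Y) (hZ : Z ∈ lieF) (N : ℕ)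

include hY hYr in
lemma flat_value : Flat 0 (N + 1) (cmp (crv X q Y (N + 1)) ρ - dbl X q Y 1 1 (N + 1) ρ) := by
  have := flat_sub_dbl X q hYr 1 1 (N + 1) (cmp (crv X q Y (N + 1))).toLinearMap (K := N + 1)
    (fun f hf => by
      refine Flat.cmp (w := crv X q Y (N + 1)) ?_
      rw [ev_crv X q Y (Nat.succ_pos N)]; exact hf)
    (fun F hF G hG => by
      rw [AlgHom.toLinearMap_apply, map_mul, cmp_star, map_one, Module.End.one_apply,
        Module.End.one_apply]
      refine (cmp_crv X q hY _ hF).congr_mul ?_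
      exact flat_star_sub (cmp_crv X q hY _ hG)) ρ
  rwa [map_one] at this

include hY hYr hZ in
lemma flat_gradient : Flat 0 (N + 1) (∑ j, cmp (crv X q Y (N + 1)) (dl j ρ) *
    dsp X q Y Z (N + 1) j - dbl X q Y Z 1 (N + 1) ρ) := by
  have := flat_sub_dbl X q hYr Z 1 (N + 1)
    { toFun := fun f => ∑ j, cmp (crv X q Y (N + 1)) (dl j f) * dsp X q Y Z (N + 1) j
      map_add' := fun f g => by simp [add_mul, Finset.sum_add_distrib]
      map_smul' := fun c f => by simp [Finset.smul_sum] } (K := N + 1 + 1)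
    (fun f hf => by
      simp only [LinearMap.coe_mk, AddHom.coe_mk]
      refine Flat.sum fun j _ => Flat.mul_right _ ?_
      refine Flat.cmp (w := crv X q Y (N + 1)) ?_
      rw [ev_crv X q Y (Nat.succ_pos N)]; exact hf.dl j)
    (fun F hF G hG => by
      simp only [LinearMap.coe_mk, AddHom.coe_mk]
      have h : ∑ j, cmp (crv X q Y (N + 1)) (dl j (F * star G)) * dsp X q Y Z (N + 1) j =
          (∑ j, cmp (crv X q Y (N + 1)) (dl j F) * dsp X q Y Z (N + 1) j) *
            star (cmp (crv X q Y (N + 1)) G) := by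
        rw [Finset.sum_mul]
        refine Finset.sum_congr rfl fun j _ => ?_
        rw [Derivation.leibniz, dl_star_HP hG, smul_zero, zero_add, smul_eq_mul, map_mul, cmp_star]
        ring
      rw [h, map_one, Module.End.one_apply]
      refine (sum_cmp_dsp X q hY hZ _ hF).congr_mul ?_
      exact flat_star_sub (cmp_crv X q hY _ hG)) ρ
  rwa [map_one] at this

include hY hYr hZ in
lemma flat_levi : Flat 0 (N + 1) (∑ j, ∑ k, cmp (crv X q Y (N + 1)) (dl j (db k ρ)) *
    (dsp X q Y Z (N + 1) j * star (dsp X q Y Z (N + 1) k)) -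
      dbl X q Y Z (conjF Z) (N + 1) ρ) := by
  refine flat_sub_dbl X q hYr Z Z (N + 1)
    { toFun := fun f => ∑ j, ∑ k, cmp (crv X q Y (N + 1)) (dl j (db k f)) *
        (dsp X q Y Z (N + 1) j * star (dsp X q Y Z (N + 1) k))
      map_add' := fun f g => by simp [add_mul, Finset.sum_add_distrib]
      map_smul' := fun c f => by simp [Finset.smul_sum] } (K := N + 1 + 1 + 1)
    (fun f hf => by
      simp only [LinearMap.coe_mk, AddHom.coe_mk]
      refine Flat.sum fun j _ => Flat.sum fun k _ => Flat.mul_right _ ?_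
      refine Flat.cmp (w := crv X q Y (N + 1)) ?_
      rw [ev_crv X q Y (Nat.succ_pos N)]; exact (hf.db k).dl j)
    (fun F hF G hG => ?_) ρ
  simp only [LinearMap.coe_mk, AddHom.coe_mk]
  have h : ∑ j, ∑ k, cmp (crv X q Y (N + 1)) (dl j (db k (F * star G))) *
      (dsp X q Y Z (N + 1) j * star (dsp X q Y Z (N + 1) k)) =
      (∑ j, cmp (crv X q Y (N + 1)) (dl j F) * dsp X q Y Z (N + 1) j) *
        star (∑ k, cmp (crv X q Y (N + 1)) (dl k G) * dsp X q Y Z (N + 1) k) := by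
    rw [star_sum, Finset.sum_mul_sum]
    refine Finset.sum_congr rfl fun j _ => Finset.sum_congr rfl fun k _ => ?_
    rw [Derivation.leibniz, db_HP hF, smul_zero, add_zero, db_star, smul_eq_mul,
      Derivation.leibniz, dl_star_HP (dl_mem_HP hG k), smul_zero, zero_add, smul_eq_mul, map_mul,
      cmp_star, star_mul']
    ring
  rw [h]
  refine (sum_cmp_dsp X q hY hZ _ hF).congr_mul ?_
  exact flat_star_sub (sum_cmp_dsp X q hY hZ _ hG)

include hY hYr hZ in
/-- Positivity of the first nontrivial Levi coefficient along a displaced vector field. -/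
theorem displacement (hpsc : PscAt ρ q) (h1 : ∀ k ≤ N, coE X ρ q Y 1 1 k = 0)
    (h2 : ∀ k ≤ N, coE X ρ q Y Z 1 k = 0) (h3 : ∀ k < N, coE X ρ q Y Z (conjF Z) k = 0) :
    0 ≤ (coE X ρ q Y Z (conjF Z) N).re := by
  obtain ⟨C, hC, hlow⟩ := hpsc
  obtain ⟨C1, hC1, e1⟩ := dbl_expansion X ρ q Y 1 1 (N + 1) (flat_value X ρ q hY hYr N)
  obtain ⟨C2, hC2, e2⟩ := dbl_expansion X ρ q Y Z 1 (N + 1) (flat_gradient X ρ q hY hYr hZ N)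
  obtain ⟨C3, hC3, e3⟩ := dbl_expansion X ρ q Y Z (conjF Z) (N + 1)
    (flat_levi X ρ q hY hYr hZ N)
  choose B hB0 hB using fun j => Flat.bound (q := 0) (k := 0) (f := dsp X q Y Z (N + 1) j) trivial
  set w := crv X q Y (N + 1) with hw
  set zv : ℝ → Fin n → ℂ := fun ε j => ev (pt ε) (dsp X q Y Z (N + 1) j) with hzv
  set B' := ∑ j, B j
  have hB' : 0 ≤ B' := Finset.sum_nonneg fun j _ => hB0 j
  have hz : ∀ ε : ℝ, 0 ≤ ε → ε ≤ 1 → ‖zv ε‖ ≤ B' := by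
    intro ε h0 h1
    refine (pi_norm_le_iff_of_nonneg hB').2 fun j => ?_
    have := hB j (pt ε) (by rw [norm_pt, abs_of_nonneg h0]; exact h1)
    rw [zero_add, pow_zero, mul_one] at this
    exact this.trans (Finset.single_le_sum (fun j _ => hB0 j) (Finset.mem_univ j))
  have hcont : Continuous fun ε : ℝ => fun j => ev (pt ε) (w j) := by
    refine continuous_pi fun j => ?_
    have : Continuous pt := continuous_pi fun _ => by
      change Continuous fun ε : ℝ => I * (ε : ℂ)
      fun_prop
    exact (Sm_continuous (w j)).comp this
  have h0 : (fun j => ev (pt 0) (w j)) = q := by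
    have : pt 0 = 0 := by ext; simp [pt]
    rw [this]; exact ev_crv X q Y (Nat.succ_pos N)
  have hev : ∀ᶠ ε in 𝓝[>] (0 : ℝ), -(C3 + C * (C1 * B' ^ 2 + B' * C2)) * ε ≤
      (coE X ρ q Y Z (conjF Z) N).re := by
    have ht : Filter.Tendsto (fun ε : ℝ => fun j => ev (pt ε) (w j)) (𝓝[>] 0) (𝓝 q) := by
      have := hcont.tendsto 0
      rw [h0] at this
      exact this.mono_left nhdsWithin_le_nhds
    filter_upwards [ht.eventually hlow, self_mem_nhdsWithin,
      nhdsWithin_le_nhds (Iio_mem_nhds (zero_lt_one' ℝ))] with ε hl hpos hlt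
    have hpos : 0 < ε := hpos
    have hle : ε ≤ 1 := le_of_lt hlt
    have l := hl (zv ε)
    have a1 := e1 ε hpos.le hle
    have a2 := e2 ε hpos.le hle
    have a3 := e3 ε hpos.le hle
    have s1 : ∑ k ∈ Finset.range (N + 1), (ε : ℂ) ^ k * coE X ρ q Y 1 1 k = 0 :=
      Finset.sum_eq_zero fun k hk => by
        rw [h1 k (Nat.lt_succ_iff.1 (Finset.mem_range.1 hk)), mul_zero]
    have s2 : ∑ k ∈ Finset.range (N + 1), (ε : ℂ) ^ k * coE X ρ q Y Z 1 k = 0 :=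
      Finset.sum_eq_zero fun k hk => by
        rw [h2 k (Nat.lt_succ_iff.1 (Finset.mem_range.1 hk)), mul_zero]
    have s3 : ∑ k ∈ Finset.range (N + 1), (ε : ℂ) ^ k * coE X ρ q Y Z (conjF Z) k =
        (ε : ℂ) ^ N * coE X ρ q Y Z (conjF Z) N := by
      rw [Finset.sum_range_succ, Finset.sum_eq_zero fun k hk => by
        rw [h3 k (Finset.mem_range.1 hk), mul_zero], zero_add]
    rw [s1, sub_zero] at a1
    rw [s2, sub_zero] at a2
    rw [s3] at a3
    have b1 : ev (pt ε) (cmp w ρ) = ev (fun j => ev (pt ε) (w j)) ρ := rfl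
    have b2 : ev (pt ε) (∑ j, cmp w (dl j ρ) * dsp X q Y Z (N + 1) j) =
        ∑ j, zv ε j * ev (fun j => ev (pt ε) (w j)) (dl j ρ) := by
      rw [map_sum]
      exact Finset.sum_congr rfl fun j _ => by rw [map_mul, mul_comm]; rfl
    have b3 : ev (pt ε) (∑ j, ∑ k, cmp w (dl j (db k ρ)) *
        (dsp X q Y Z (N + 1) j * star (dsp X q Y Z (N + 1) k))) =
        ∑ j, ∑ k, ev (fun j => ev (pt ε) (w j)) (dl j (db k ρ)) * zv ε j *
          (starRingEnd ℂ) (zv ε k) := by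
      rw [map_sum]
      refine Finset.sum_congr rfl fun j _ => ?_
      rw [map_sum]
      exact Finset.sum_congr rfl fun k _ => by rw [map_mul, map_mul, ← mul_assoc]; rfl
    rw [b1] at a1
    rw [b2] at a2
    rw [b3] at a3
    set S3 := ∑ j, ∑ k, ev (fun j => ev (pt ε) (w j)) (dl j (db k ρ)) * zv ε j *
          (starRingEnd ℂ) (zv ε k)
    have c3 : S3.re - ε ^ N * (coE X ρ q Y Z (conjF Z) N).re ≤ C3 * ε ^ (N + 1) := by
      refine le_trans ?_ a3
      refine le_trans (le_of_eq ?_) (re_le_norm _)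
      rw [sub_re, ← ofReal_pow, re_ofReal_mul]
    have hzb := hz ε hpos.le hle
    have c1 : ‖ev (fun j => ev (pt ε) (w j)) ρ‖ * ‖zv ε‖ ^ 2 ≤ C1 * ε ^ (N + 1) * B' ^ 2 := by
      gcongr
    have c2 : ‖zv ε‖ * ‖∑ j, zv ε j * ev (fun j => ev (pt ε) (w j)) (dl j ρ)‖ ≤
        B' * (C2 * ε ^ (N + 1)) := by gcongr
    have c4 := mul_le_mul_of_nonneg_left (add_le_add c1 c2) hC
    have hεN : 0 < ε ^ N := pow_pos hpos N
    refine le_of_mul_le_mul_left ?_ hεN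
    have e : ε ^ (N + 1) = ε ^ N * ε := pow_succ ε N
    rw [e] at c3 c4
    linarith
  refine le_of_tendsto ?_ hev
  have : Filter.Tendsto (fun ε : ℝ => -(C3 + C * (C1 * B' ^ 2 + B' * C2)) * ε) (𝓝 0)
      (𝓝 (-(C3 + C * (C1 * B' ^ 2 + B' * C2)) * 0)) := Filter.tendsto_id.const_mul _
  rw [mul_zero] at this
  exact this.mono_left nhdsWithin_le_nhds

end Displacement

end

/-- Operators of order at most one. -/
def gen : Submodule ℂ Fr := 1 ⊔ lieF

lemma one_le_gen : (1 : Submodule ℂ Fr) ≤ gen := le_sup_left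

lemma lieF_le_gen : lieF ≤ gen := le_sup_right

lemma gen_pow_mono {a b : ℕ} (h : a ≤ b) : gen ^ a ≤ gen ^ b :=
  pow_le_pow_right₀ one_le_gen h

lemma one_mem_gen_pow (a : ℕ) : (1 : Fr) ∈ gen ^ a :=
  gen_pow_mono (Nat.zero_le a) (by rw [pow_zero]; exact Submodule.one_le.1 le_rfl)

lemma mul_mem_gen_pow {a b : ℕ} {P Q : Fr} (hP : P ∈ gen ^ a) (hQ : Q ∈ gen ^ b) :
    P * Q ∈ gen ^ (a + b) := by
  rw [pow_add]; exact Submodule.mul_mem_mul hP hQ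

lemma lie_mul_mem {a : ℕ} {u P : Fr} (hu : u ∈ lieF) (hP : P ∈ gen ^ a) :
    u * P ∈ gen ^ (a + 1) := by
  rw [pow_succ']; exact Submodule.mul_mem_mul (lieF_le_gen hu) hP

lemma mul_lie_mem {a : ℕ} {u P : Fr} (hu : u ∈ lieF) (hP : P ∈ gen ^ a) :
    P * u ∈ gen ^ (a + 1) := by
  rw [pow_succ]; exact Submodule.mul_mem_mul hP (lieF_le_gen hu)

lemma pow_mem_gen {a : ℕ} {u : Fr} (hu : u ∈ lieF) : u ^ a ∈ gen ^ a :=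
  Submodule.pow_mem_pow _ (lieF_le_gen hu) a

/-- Elements of `gen ^ (a + 1)` are spanned by `gen ^ a` and `lieF * gen ^ a`. -/
lemma gen_pow_succ_le {a : ℕ} {N : Submodule ℂ Fr} (h0 : gen ^ a ≤ N)
    (h1 : ∀ u ∈ lieF, ∀ P ∈ gen ^ a, u * P ∈ N) : gen ^ (a + 1) ≤ N := by
  rw [pow_succ', Submodule.mul_le]
  intro g hg P hP
  obtain ⟨c, hc, u, hu, rfl⟩ := Submodule.mem_sup.1 hg
  obtain ⟨c, rfl⟩ := Submodule.mem_one.1 hc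
  rw [add_mul, ← Algebra.smul_def]
  exact N.add_mem (N.smul_mem _ (h0 hP)) (h1 u hu P hP)

lemma gen_pow_succ_le' {a : ℕ} {N : Submodule ℂ Fr} (h0 : gen ^ a ≤ N)
    (h1 : ∀ u ∈ lieF, ∀ P ∈ gen ^ a, P * u ∈ N) : gen ^ (a + 1) ≤ N := by
  rw [pow_succ, Submodule.mul_le]
  intro P hP g hg
  obtain ⟨c, hc, u, hu, rfl⟩ := Submodule.mem_sup.1 hg
  obtain ⟨c, rfl⟩ := Submodule.mem_one.1 hc
  rw [mul_add, ← Algebra.commutes, ← Algebra.smul_def]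
  exact N.add_mem (N.smul_mem _ (h0 hP)) (h1 u hu P hP)

lemma lie_comm_mem {a : ℕ} {u P : Fr} (hu : u ∈ lieF) (hP : P ∈ gen ^ a) :
    u * P - P * u ∈ gen ^ a := by
  have key : ∀ a, gen ^ a ≤ (gen ^ a).comap (LinearMap.mulLeft ℂ u - LinearMap.mulRight ℂ u) := by
    intro a
    induction a with
    | zero =>
      intro P hP
      rw [pow_zero] at hP ⊢
      obtain ⟨c, rfl⟩ := Submodule.mem_one.1 hP
      have := Algebra.commutes c u
      simp [this]
    | succ a ih =>
      refine gen_pow_succ_le (fun P hP => gen_pow_mono a.le_succ (ih hP)) fun v hv P hP => ?_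
      have h1 := ih hP
      simp only [Submodule.mem_comap, LinearMap.sub_apply, LinearMap.mulLeft_apply,
        LinearMap.mulRight_apply] at h1 ⊢
      have e : u * (v * P) - v * P * u = (u * v - v * u) * P + v * (u * P - P * u) := by
        noncomm_ring
      rw [e]
      exact Submodule.add_mem _ (lie_mul_mem (lieF_lie hu hv) hP) (lie_mul_mem hv h1)
  exact key a hP

lemma conjF_gen {a : ℕ} {P : Fr} (hP : P ∈ gen ^ a) : conjF P ∈ gen ^ a := by
  let L : ℕ → Submodule ℂ Fr := fun a =>
    { carrier := {P | conjF P ∈ gen ^ a}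
      add_mem' := fun {x y} hx hy => by
        change conjF (x + y) ∈ gen ^ a
        rw [map_add]; exact Submodule.add_mem _ hx hy
      zero_mem' := by
        change conjF 0 ∈ gen ^ a
        rw [map_zero]; exact Submodule.zero_mem _
      smul_mem' := fun c x hx => by
        change conjF (c • x) ∈ gen ^ a
        rw [conjF_smul]; exact Submodule.smul_mem _ _ hx }
  have key : ∀ a, gen ^ a ≤ L a := by
    intro a
    induction a with
    | zero =>
      intro P hP
      rw [pow_zero] at hP
      obtain ⟨c, rfl⟩ := Submodule.mem_one.1 hP
      change conjF (algebraMap ℂ Fr c) ∈ gen ^ 0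
      rw [conjF_algebraMap, pow_zero]
      exact Submodule.mem_one.2 ⟨_, rfl⟩
    | succ a ih =>
      refine gen_pow_succ_le (fun P hP => ?_) fun v hv P hP => ?_
      · exact gen_pow_mono a.le_succ (ih hP)
      · change conjF (v * P) ∈ gen ^ (a + 1)
        rw [map_mul]
        exact lie_mul_mem (conjF_mem hv) (ih hP)
  exact key a hP

section Polarization

lemma coeff_mem_of_forall {E : Type*} [AddCommGroup E] [Module ℂ E] (N : Submodule ℂ E) (m : ℕ)
    (c : ℕ → E) (h : ∀ t : ℝ, ∑ i ∈ Finset.range m, (t : ℂ) ^ i • c i ∈ N) {i : ℕ} (hi : i < m) :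
    c i ∈ N := by
  by_contra hc
  obtain ⟨f, hf, hN⟩ := Submodule.exists_le_ker_of_notMem hc
  set p : Polynomial ℂ := ∑ i ∈ Finset.range m, Polynomial.monomial i (f (c i)) with hp
  have hz : p = 0 := by
    refine Polynomial.eq_zero_of_infinite_isRoot p ?_
    refine (Set.infinite_range_of_injective Complex.ofReal_injective).mono ?_
    rintro _ ⟨t, rfl⟩
    have := hN (h t)
    rw [LinearMap.mem_ker, map_sum] at this
    simp only [map_smul, smul_eq_mul] at this
    simp only [Set.mem_ofPred_eq, Polynomial.IsRoot, hp, Polynomial.eval_finsetSum,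
      Polynomial.eval_monomial]
    rw [← this]
    exact Finset.sum_congr rfl fun _ _ => mul_comm _ _
  have : p.coeff i = f (c i) := by
    rw [hp, Polynomial.finsetSum_coeff]
    simp [Polynomial.coeff_monomial, hi]
  rw [hz, Polynomial.coeff_zero] at this
  exact hf this.symm

/-- The polynomial `(u + t v) ^ m`. -/
def powP (u v : Fr) (m : ℕ) : Polynomial Fr := (Polynomial.C u + Polynomial.C v * Polynomial.X) ^ m

lemma powP_eval (u v : Fr) (m : ℕ) (t : ℂ) :
    (u + t • v) ^ m = ∑ i ∈ Finset.range (m + 1), t ^ i • (powP u v m).coeff i := by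
  set ψ := Polynomial.eval₂RingHom' (RingHom.id Fr) (algebraMap ℂ Fr t)
    (fun a => (Algebra.commutes t a).symm) with hψ
  have h1 : ψ (powP u v m) = (u + t • v) ^ m := by
    rw [powP, map_pow, map_add, map_mul]
    simp [hψ, Polynomial.eval₂RingHom', Algebra.smul_def, Algebra.commutes]
  have hd : (powP u v m).natDegree < m + 1 := by
    refine Nat.lt_succ_of_le ((Polynomial.natDegree_pow_le).trans ?_)
    have : (Polynomial.C u + Polynomial.C v * Polynomial.X).natDegree ≤ 1 := by
      rw [add_comm]; exact Polynomial.natDegree_linear_le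
    nlinarith
  rw [← h1]
  change Polynomial.eval₂ _ _ _ = _
  rw [Polynomial.eval₂_eq_sum_range' _ hd]
  refine Finset.sum_congr rfl fun i _ => ?_
  rw [RingHom.id_apply, ← map_pow, ← Algebra.commutes, ← Algebra.smul_def]

lemma powP_coeff_one (u v : Fr) (hu : u ∈ lieF) (hv : v ∈ lieF) (m : ℕ) :
    (powP u v (m + 1)).coeff 1 - ((m + 1 : ℕ) : ℂ) • (u ^ m * v) ∈ gen ^ m := by
  have c0 : ∀ m, (powP u v m).coeff 0 = u ^ m := by
    intro m
    simp only [powP, Polynomial.coeff_zero_eq_eval_zero]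
    rw [← Polynomial.coeff_zero_eq_eval_zero]
    induction m with
    | zero => simp
    | succ m ih => rw [pow_succ, Polynomial.mul_coeff_zero, ih, pow_succ]; simp
  have c1 : ∀ m, (powP u v (m + 1)).coeff 1 = (powP u v m).coeff 1 * u + u ^ m * v := by
    intro m
    rw [← c0 m, powP, pow_succ, mul_add, ← mul_assoc, Polynomial.coeff_add,
      Polynomial.coeff_mul_C, Polynomial.coeff_mul_X, Polynomial.coeff_mul_C]; rfl
  induction m with
  | zero =>
    rw [c1]
    simp [powP, Polynomial.coeff_one]
  | succ m ih =>
    rw [c1]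
    have e : (powP u v (m + 1)).coeff 1 * u + u ^ (m + 1) * v -
        ((m + 1 + 1 : ℕ) : ℂ) • (u ^ (m + 1) * v) =
        ((powP u v (m + 1)).coeff 1 - ((m + 1 : ℕ) : ℂ) • (u ^ m * v)) * u +
          ((m + 1 : ℕ) : ℂ) • (u ^ m * (v * u - u * v)) := by
      rw [sub_mul, smul_mul_assoc, mul_sub, pow_succ u m]
      simp only [smul_sub, mul_assoc]
      push_cast
      module
    rw [e]
    exact Submodule.add_mem _ (mul_lie_mem hu ih)
      (Submodule.smul_mem _ _ (mul_lie_mem (lieF_lie hv hu) (pow_mem_gen hu)))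

lemma gen_pow_le_of_pow_mem (m : ℕ) (N : Submodule ℂ Fr) (h0 : ∀ j < m, gen ^ j ≤ N)
    (h1 : ∀ u ∈ lieF, u ^ m ∈ N) : gen ^ m ≤ N := by
  induction m generalizing N with
  | zero =>
    rw [pow_zero, Submodule.one_le]
    simpa using h1 (lett true) (lett_mem _)
  | succ m ih =>
    refine gen_pow_succ_le' (h0 m m.lt_succ_self) fun v hv => ?_
    refine ih (N.comap (LinearMap.mulRight ℂ v)) (fun j hj P hP => ?_) fun u hu => ?_
    · exact h0 (j + 1) (by omega) (mul_lie_mem hv hP)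
    · have hc := coeff_mem_of_forall N (m + 1 + 1) (fun i => (powP u v (m + 1)).coeff i)
        (fun t => by
          rw [← powP_eval]
          exact h1 _ (lieF.add_mem hu (lieF.smul_mem _ hv))) (i := 1) (by omega)
      have := N.sub_mem hc (h0 m m.lt_succ_self (powP_coeff_one u v hu hv m))
      rw [sub_sub_cancel] at this
      have h2 := N.smul_mem ((m + 1 : ℕ) : ℂ)⁻¹ this
      rwa [smul_smul, inv_mul_cancel₀ (by exact_mod_cast Nat.succ_ne_zero m), one_smul] at h2

lemma gen_pow_le_of_real_pow_mem (m : ℕ) (N : Submodule ℂ Fr) (h0 : ∀ j < m, gen ^ j ≤ N)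
    (h1 : ∀ u ∈ lieF, conjF u = u → u ^ m ∈ N) : gen ^ m ≤ N := by
  refine gen_pow_le_of_pow_mem m N h0 fun u hu => ?_
  set y := (2 : ℂ)⁻¹ • (u + conjF u) with hy
  set w := (2 * I : ℂ)⁻¹ • (u - conjF u) with hw
  have hym : y ∈ lieF := lieF.smul_mem _ (lieF.add_mem hu (conjF_mem hu))
  have hwm : w ∈ lieF := lieF.smul_mem _ (lieF.sub_mem hu (conjF_mem hu))
  have hyr : conjF y = y := by
    rw [hy, conjF_smul, map_add, conjF_conjF, add_comm, map_inv₀, map_ofNat]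
  have hwr : conjF w = w := by
    rw [hw, conjF_smul, map_sub, conjF_conjF, map_inv₀, map_mul, map_ofNat, conj_I, mul_neg,
      inv_neg, neg_smul, ← smul_neg, neg_sub]
  have e : u = y + I • w := by
    rw [hy, hw, smul_smul]
    have : I * (2 * I)⁻¹ = (2 : ℂ)⁻¹ := by field_simp
    rw [this]; module
  rw [e, powP_eval]
  refine N.sum_mem fun i hi => N.smul_mem _ ?_
  refine coeff_mem_of_forall N (m + 1) (fun i => (powP y w m).coeff i) (fun t => ?_)
    (Finset.mem_range.1 hi)
  rw [← powP_eval]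
  refine h1 _ (lieF.add_mem hym (lieF.smul_mem _ hwm)) ?_
  rw [map_add, hyr, conjF_smul, hwr, conj_ofReal]

end Polarization

section Isotropy

variable {T : Type*} {B : Fr →ₗ[ℂ] Fr →ₗ[ℂ] (T → ℂ)}

/-- Coefficients of the expansion of a form along a displaced pair. -/
def cE (B : Fr →ₗ[ℂ] Fr →ₗ[ℂ] (T → ℂ)) (Y P Q : Fr) (k : ℕ) : T → ℂ :=
  ∑ p ∈ Finset.HasAntidiagonal.antidiagonal k,
    (I ^ p.1 * (-I) ^ p.2 * ((p.1.factorial : ℂ)⁻¹ * (p.2.factorial : ℂ)⁻¹)) •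
      B (Y ^ p.1 * P) (Y ^ p.2 * Q)

/-- The formal properties of the polarized action on a defining function along a set to which the
null field is tangent. -/
structure IsPol (B : Fr →ₗ[ℂ] Fr →ₗ[ℂ] (T → ℂ)) : Prop where
  leib : ∀ u ∈ lieF, ∀ P Q, B P Q = 0 → B (u * P) Q + B P (u * Q) = 0
  mul_false : ∀ P Q, B (P * lett false) Q = 0
  mul_true : ∀ P Q, B P (Q * lett true) = 0
  one_one : B 1 1 = 0
  conj : ∀ P Q, star (B P Q) = B (conjF Q) (conjF P)
  null : B (lett true) (lett false) = 0
  disp : ∀ Y ∈ lieF, conjF Y = Y → ∀ Z ∈ lieF, ∀ N, (∀ k ≤ N, cE B Y 1 1 k = 0) →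
    (∀ k ≤ N, cE B Y Z 1 k = 0) → (∀ k < N, cE B Y Z (conjF Z) k = 0) →
    ∀ t, 0 ≤ (cE B Y Z (conjF Z) N t).re

/-- Vanishing of the form up to total order `k`. -/
def VanTo (B : Fr →ₗ[ℂ] Fr →ₗ[ℂ] (T → ℂ)) (k : ℕ) : Prop :=
  ∀ a b, a + b ≤ k → ∀ P ∈ gen ^ a, ∀ Q ∈ gen ^ b, B P Q = 0

/-- The elements of the Lie algebra which annihilate the form at the next order. -/
def nullS (B : Fr →ₗ[ℂ] Fr →ₗ[ℂ] (T → ℂ)) (k : ℕ) : Submodule ℂ Fr where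
  carrier := {U | U ∈ lieF ∧ ∀ a b, a + b ≤ k → ∀ P ∈ gen ^ a, ∀ Q ∈ gen ^ b, B (U * P) Q = 0}
  add_mem' := fun {x y} hx hy => ⟨lieF.add_mem hx.1 hy.1, fun a b h P hP Q hQ => by
    rw [add_mul, map_add, LinearMap.add_apply, hx.2 a b h P hP Q hQ, hy.2 a b h P hP Q hQ,
      add_zero]⟩
  zero_mem' := ⟨lieF.zero_mem, fun a b h P hP Q hQ => by simp⟩
  smul_mem' := fun c x hx => ⟨lieF.smul_mem c hx.1, fun a b h P hP Q hQ => by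
    rw [smul_mul_assoc, map_smul, LinearMap.smul_apply, hx.2 a b h P hP Q hQ, smul_zero]⟩

lemma cE_eq_zero {Y P Q : Fr} {k : ℕ} (h : ∀ a b, a + b = k → B (Y ^ a * P) (Y ^ b * Q) = 0) :
    cE B Y P Q k = 0 :=
  Finset.sum_eq_zero fun p hp => by
    rw [h p.1 p.2 (Finset.HasAntidiagonal.mem_antidiagonal.1 hp), smul_zero]

lemma cE_neg (Y P Q : Fr) (k : ℕ) : cE B (-Y) P Q k = (-1 : ℂ) ^ k • cE B Y P Q k := by
  rw [cE, cE, Finset.smul_sum]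
  refine Finset.sum_congr rfl fun p hp => ?_
  have h := Finset.HasAntidiagonal.mem_antidiagonal.1 hp
  have e : ∀ a (Z : Fr), (-Y) ^ a * Z = (-1 : ℂ) ^ a • (Y ^ a * Z) := by
    intro a Z
    rw [← smul_mul_assoc, ← smul_pow, neg_smul, one_smul]
  rw [e, e, map_smul, map_smul, LinearMap.smul_apply, smul_smul, smul_smul, smul_smul, ← h, pow_add]
  congr 1
  ring

lemma cE_add_left (Y P P' Q : Fr) (k : ℕ) : cE B Y (P + P') Q k = cE B Y P Q k + cE B Y P' Q k := by
  simp only [cE, mul_add, map_add, LinearMap.add_apply, smul_add, Finset.sum_add_distrib]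

lemma cE_add_right (Y P Q Q' : Fr) (k : ℕ) :
    cE B Y P (Q + Q') k = cE B Y P Q k + cE B Y P Q' k := by
  simp only [cE, mul_add, map_add, smul_add, Finset.sum_add_distrib]

lemma cE_smul_left (c : ℂ) (Y P Q : Fr) (k : ℕ) : cE B Y (c • P) Q k = c • cE B Y P Q k := by
  simp only [cE, mul_smul_comm, map_smul, LinearMap.smul_apply, Finset.smul_sum]
  exact Finset.sum_congr rfl fun _ _ => smul_comm _ _ _

lemma cE_smul_right (c : ℂ) (Y P Q : Fr) (k : ℕ) : cE B Y P (c • Q) k = c • cE B Y P Q k := by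
  simp only [cE, mul_smul_comm, map_smul, Finset.smul_sum]
  exact Finset.sum_congr rfl fun _ _ => smul_comm _ _ _

/-- The common value of the coefficient sums. -/
def fsum (k : ℕ) : ℂ :=
  ∑ p ∈ Finset.HasAntidiagonal.antidiagonal k, ((p.1.factorial : ℂ)⁻¹ * (p.2.factorial : ℂ)⁻¹)

lemma fsum_eq (k : ℕ) : ∃ r : ℝ, 0 < r ∧ fsum k = r := by
  refine ⟨∑ p ∈ Finset.HasAntidiagonal.antidiagonal k,
    ((p.1.factorial : ℝ)⁻¹ * (p.2.factorial : ℝ)⁻¹), ?_, ?_⟩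
  · refine Finset.sum_pos (fun p _ => by positivity) ⟨(0, k), ?_⟩
    rw [Finset.HasAntidiagonal.mem_antidiagonal]; simp
  · simp [fsum]

lemma cE_of_sign {Y P Q : Fr} {k : ℕ} {v : T → ℂ}
    (h : ∀ a b, a + b = k → B (Y ^ a * P) (Y ^ b * Q) = (-1 : ℂ) ^ b • v) :
    cE B Y P Q k = (I ^ k * fsum k) • v := by
  rw [cE, fsum, Finset.mul_sum, Finset.sum_smul]
  refine Finset.sum_congr rfl fun p hp => ?_
  have hp := Finset.HasAntidiagonal.mem_antidiagonal.1 hp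
  rw [h p.1 p.2 hp, smul_smul, ← hp, pow_add, neg_pow I]
  congr 1
  have : ((-1 : ℂ) ^ p.2) * (-1) ^ p.2 = 1 := by rw [← mul_pow]; norm_num
  linear_combination (I ^ p.1 * I ^ p.2 * ((p.1.factorial : ℂ)⁻¹ * (p.2.factorial : ℂ)⁻¹)) * this

namespace IsPol

variable (hB : IsPol B) {k : ℕ} (hk : VanTo B k)

include hB

lemma swap {u P Q : Fr} (hu : u ∈ lieF) (h : B P Q = 0) : B P (u * Q) = -B (u * P) Q :=
  eq_neg_of_add_eq_zero_right (hB.leib u hu P Q h)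

lemma cE_conj {Y : Fr} (hY : conjF Y = Y) (P Q : Fr) (k : ℕ) :
    star (cE B Y P Q k) = cE B Y (conjF Q) (conjF P) k := by
  rw [cE, cE, star_sum, ← Finset.Nat.sum_antidiagonal_swap]
  refine Finset.sum_congr rfl fun p _ => ?_
  rw [star_smul, hB.conj, map_mul conjF, map_mul conjF, map_pow conjF, map_pow conjF, hY]
  simp
  congr 1
  ring

include hk

lemma null_right {U : Fr} (hU : U ∈ nullS B k) {a b : ℕ} (h : a + b ≤ k) {P Q : Fr}
    (hP : P ∈ gen ^ a) (hQ : Q ∈ gen ^ b) : B P (U * Q) = 0 := by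
  rw [hB.swap hU.1 (hk a b h P hP Q hQ), hU.2 a b h P hP Q hQ, neg_zero]

omit hB in
lemma null_left' {U : Fr} (hU : U ∈ nullS B k) {a b : ℕ} (h : a + b ≤ k) {P Q : Fr}
    (hP : P ∈ gen ^ a) (hQ : Q ∈ gen ^ b) : B (P * U) Q = 0 := by
  have e : P * U = U * P - (U * P - P * U) := by abel
  rw [e, map_sub, LinearMap.sub_apply, hU.2 a b h P hP Q hQ,
    hk a b h _ (lie_comm_mem hU.1 hP) Q hQ, sub_zero]

lemma null_right' {U : Fr} (hU : U ∈ nullS B k) {a b : ℕ} (h : a + b ≤ k) {P Q : Fr}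
    (hP : P ∈ gen ^ a) (hQ : Q ∈ gen ^ b) : B P (Q * U) = 0 := by
  have e : Q * U = U * Q - (U * Q - Q * U) := by abel
  rw [e, map_sub, hB.null_right hk hU h hP hQ,
    hk a b h _ hP _ (lie_comm_mem hU.1 hQ), sub_zero]

lemma false_mem : lett false ∈ nullS B k := by
  refine ⟨lett_mem _, fun a b h P hP Q hQ => ?_⟩
  have e : lett false * P = P * lett false + (lett false * P - P * lett false) := by abel
  rw [e, map_add, LinearMap.add_apply, hB.mul_false,
    hk a b h _ (lie_comm_mem (lett_mem _) hP) Q hQ, add_zero]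

lemma true_mem : lett true ∈ nullS B k := by
  refine ⟨lett_mem _, fun a b h P hP Q hQ => ?_⟩
  have e : lett true * Q = Q * lett true + (lett true * Q - Q * lett true) := by abel
  have := hB.swap (lett_mem true) (hk a b h P hP Q hQ)
  rw [e, map_add, hB.mul_true, hk a b h _ hP _ (lie_comm_mem (lett_mem _) hQ), add_zero] at this
  rw [← neg_eq_zero, ← this]

lemma conj_mem {U : Fr} (hU : U ∈ nullS B k) : conjF U ∈ nullS B k := by
  refine ⟨conjF_mem hU.1, fun a b h P hP Q hQ => ?_⟩
  have := hB.conj (conjF Q) (U * conjF P)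
  rw [hB.null_right hk hU (by omega) (conjF_gen hQ) (conjF_gen hP), star_zero, map_mul, conjF_conjF,
    conjF_conjF] at this
  exact this.symm

/-- Moving all factors to the left. -/
lemma move {a b : ℕ} {Y P Q : Fr} (hY : Y ∈ lieF) {c d : ℕ} (hP : P ∈ gen ^ c) (hQ : Q ∈ gen ^ d)
    (h : c + a + (b + d) ≤ k + 1) :
    B (Y ^ a * P) (Y ^ b * Q) = (-1 : ℂ) ^ b • B (Y ^ (a + b) * P) Q := by
  induction b generalizing a with
  | zero => simp
  | succ b ih =>
    have hz : B (Y ^ a * P) (Y ^ b * Q) = 0 :=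
      hk (a + c) (b + d) (by omega) _ (mul_mem_gen_pow (pow_mem_gen hY) hP) _
        (mul_mem_gen_pow (pow_mem_gen hY) hQ)
    rw [pow_succ' Y b, mul_assoc, hB.swap hY hz, ← mul_assoc, ← pow_succ', ih (by omega),
      show a + 1 + b = a + (b + 1) by ring, pow_succ (-1 : ℂ), mul_neg_one, neg_smul]

lemma disp_null {Y Z : Fr} (hY : Y ∈ lieF) (hYr : conjF Y = Y) (hZ : Z ∈ nullS B k) (t : T) :
    0 ≤ (cE B Y Z (conjF Z) k t).re := by
  refine hB.disp Y hY hYr Z hZ.1 k (fun j hj => ?_) (fun j hj => ?_) (fun j hj => ?_) t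
  · refine cE_eq_zero fun a b h => ?_
    rw [mul_one, mul_one]
    exact hk a b (by omega) _ (pow_mem_gen hY) _ (pow_mem_gen hY)
  · refine cE_eq_zero fun a b h => ?_
    rw [mul_one]
    exact null_left' hk hZ (a := a) (b := b) (by omega) (pow_mem_gen hY) (pow_mem_gen hY)
  · refine cE_eq_zero fun a b h => ?_
    exact null_left' hk hZ (a := a) (b := b + 1) (by omega) (pow_mem_gen hY)
      (mul_lie_mem (conjF_mem hZ.1) (pow_mem_gen hY))

lemma cE_null_eq_zero {Y U : Fr} (hY : Y ∈ lieF) (hYr : conjF Y = Y) (hU : U ∈ nullS B k)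
    (hpar : k = 0 ∨ Odd k) : cE B Y (lett true) (conjF U) k = 0 := by
  funext t
  have hXm := hB.true_mem hk
  have expand : ∀ s : ℂ, (cE B Y (s • lett true + U) (conjF (s • lett true + U)) k t).re =
      normSq s * (cE B Y (lett true) (lett false) k t).re +
        2 * (s * cE B Y (lett true) (conjF U) k t).re + (cE B Y U (conjF U) k t).re := by
    intro s
    have hc := congrFun (hB.cE_conj hYr (lett true) (conjF U) k) t
    rw [conjF_conjF, Pi.star_apply] at hc
    rw [map_add, conjF_smul, conjF_lett, Bool.not_true] at *
    simp only [cE_add_left, cE_add_right, cE_smul_left, cE_smul_right, Pi.add_apply, Pi.smul_apply,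
      smul_eq_mul]
    rw [← hc]
    simp only [add_re, add_im, mul_re, mul_im, RCLike.star_def, conj_re, conj_im, normSq_apply]
    ring
  have pos : ∀ s : ℂ, 0 ≤ (cE B Y (s • lett true + U) (conjF (s • lett true + U)) k t).re :=
    fun s => hB.disp_null hk hY hYr ((nullS B k).add_mem ((nullS B k).smul_mem s hXm) hU) t
  have hnull : (cE B Y (lett true) (lett false) k t).re = 0 := by
    rcases hpar with rfl | hodd
    · simp [cE, hB.null]
    · have h1 := hB.disp_null hk hY hYr hXm t
      have h2 := hB.disp_null hk (lieF.neg_mem hY) (by rw [map_neg, hYr]) hXm t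
      rw [cE_neg, hodd.neg_one_pow, conjF_lett, Bool.not_true] at h2
      rw [conjF_lett, Bool.not_true] at h1
      simp only [neg_smul, one_smul, Pi.neg_apply, neg_re] at h2
      linarith
  set v := cE B Y (lett true) (conjF U) k t with hv
  set r := (cE B Y U (conjF U) k t).re
  have key : ∀ s : ℂ, 0 ≤ 2 * (s * v).re + r := by
    intro s
    have := pos s
    rw [expand, hnull, mul_zero, zero_add] at this
    exact this
  by_contra hne
  have hn : 0 < normSq v := normSq_pos.2 hne
  have := key (-(((|r| + 1) / normSq v : ℝ) : ℂ) * (starRingEnd ℂ) v)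
  have e : -(((|r| + 1) / normSq v : ℝ) : ℂ) * (starRingEnd ℂ) v * v = ((-(|r| + 1) : ℝ) : ℂ) := by
    rw [mul_assoc, mul_comm _ v, mul_conj]
    push_cast
    have : (normSq v : ℂ) ≠ 0 := by exact_mod_cast hn.ne'
    field_simp
  rw [e, ofReal_re] at this
  have h2 := le_abs_self r
  have h3 := abs_nonneg r
  linarith

lemma bracket_mem {W : Fr} (hW : W ∈ nullS B k) (hpar : k = 0 ∨ Odd k) :
    lett true * W - W * lett true ∈ nullS B k := by
  set V := lett true * W - W * lett true with hV
  have hVl : V ∈ lieF := lieF_lie (lett_mem _) hW.1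
  have h1 : ∀ Y ∈ lieF, conjF Y = Y → B (V * Y ^ k) 1 = 0 := by
    intro Y hY hYr
    have h0 := hB.cE_null_eq_zero hk hY hYr (hB.conj_mem hk hW) hpar
    rw [conjF_conjF, cE_of_sign (v := B (V * Y ^ k) 1)] at h0
    · obtain ⟨r, hr, hr'⟩ := fsum_eq k
      rw [hr'] at h0
      refine (smul_eq_zero.1 h0).resolve_left ?_
      exact mul_ne_zero (pow_ne_zero _ I_ne_zero) (ofReal_ne_zero.2 hr.ne')
    · intro a b hab
      have hYa : Y ^ a ∈ gen ^ a := pow_mem_gen hY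
      have hYb : Y ^ b ∈ gen ^ b := pow_mem_gen hY
      have s1 : B (Y ^ a) (Y ^ b * W) = 0 := hB.null_right' hk hW (by omega) hYa hYb
      have s2 := hB.swap (lett_mem true) s1
      have e1 : lett true * (Y ^ b * W) = (lett true * Y ^ b - Y ^ b * lett true) * W + Y ^ b * V +
          Y ^ b * W * lett true := by rw [hV]; noncomm_ring
      have e2 : lett true * Y ^ a =
          Y ^ a * lett true + (lett true * Y ^ a - Y ^ a * lett true) := by
        abel
      rw [e1, map_add, map_add, hB.mul_true, add_zero,
        hB.null_right' hk hW (show a + b ≤ k by omega) hYa (lie_comm_mem (lett_mem _) hYb),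
        zero_add, e2, map_add, LinearMap.add_apply,
        hB.null_right' hk hW (show a + b ≤ k by omega) (lie_comm_mem (lett_mem _) hYa) hYb,
        add_zero] at s2
      have s3 := hB.move hk (a := a) (b := b) (c := 0) (d := 1) (P := 1) (Q := V) hY
        (one_mem_gen_pow 0) (by rw [pow_one]; exact lieF_le_gen hVl) (by omega)
      have s4 := hB.swap hVl (hk k 0 (by omega) (Y ^ k) (pow_mem_gen hY) 1 (one_mem_gen_pow 0))
      rw [mul_one] at s4
      rw [mul_one, mul_one, hab, s4, smul_neg] at s3
      rw [s3, neg_inj] at s2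
      exact s2.symm
  have h2 : gen ^ k ≤ LinearMap.ker ((B.flip 1).comp (LinearMap.mulLeft ℂ V)) := by
    refine gen_pow_le_of_real_pow_mem k _ (fun j hj P hP => ?_) (fun u hu hur => ?_)
    · exact hk (j + 1) 0 (by omega) _ (lie_mul_mem hVl hP) 1 (one_mem_gen_pow 0)
    · exact h1 u hu hur
  have h3 : ∀ b a, a + b ≤ k → ∀ P ∈ gen ^ a, ∀ Q ∈ gen ^ b, B (V * P) Q = 0 := by
    intro b
    induction b with
    | zero =>
      intro a hab P hP Q hQ
      rw [pow_zero] at hQ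
      obtain ⟨c, rfl⟩ := Submodule.mem_one.1 hQ
      have : B (V * P) 1 = 0 := h2 (gen_pow_mono (by omega : a ≤ k) hP)
      rw [Algebra.algebraMap_eq_smul_one, map_smul, this, smul_zero]
    | succ b ih =>
      intro a hab P hP Q hQ
      refine (gen_pow_succ_le (N := LinearMap.ker (B (V * P))) (fun Q hQ => ?_)
        fun u hu Q hQ => ?_) hQ
      · exact ih a (by omega) P hP Q hQ
      · rw [LinearMap.mem_ker, hB.swap hu (ih a (by omega) P hP Q hQ)]
        have e : u * (V * P) = V * (u * P) + (u * V - V * u) * P := by noncomm_ring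
        rw [e, map_add, LinearMap.add_apply, ih (a + 1) (by omega) _ (lie_mul_mem hu hP) Q hQ,
          hk (a + 1) b (by omega) _ (lie_mul_mem (lieF_lie hu hVl) hP) Q hQ, add_zero, neg_zero]
  exact ⟨hVl, fun a b hab P hP Q hQ => h3 b a hab P hP Q hQ⟩

lemma lieF_le_nullS (hpar : k = 0 ∨ Odd k) : lieF ≤ nullS B k := by
  have hX := fun W hW => hB.bracket_mem hk (W := W) hW hpar
  have hX' : ∀ W ∈ nullS B k, lett false * W - W * lett false ∈ nullS B k := by
    intro W hW
    have := hB.conj_mem hk (hX _ (hB.conj_mem hk hW))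
    rwa [map_sub, map_mul, map_mul, conjF_conjF, conjF_lett, Bool.not_true] at this
  have had : ∀ V ∈ lieF, ∀ W ∈ nullS B k, V * W - W * V ∈ nullS B k := by
    intro V hV
    refine lieF_induction (p := fun V => ∀ W ∈ nullS B k, V * W - W * V ∈ nullS B k)
      ?_ ?_ ?_ ?_ hV
    · rintro (_ | _)
      · exact hX'
      · exact hX
    · intro x y hx hy W hW
      have e : (x + y) * W - W * (x + y) = (x * W - W * x) + (y * W - W * y) := by noncomm_ring
      rw [e]; exact Submodule.add_mem _ (hx W hW) (hy W hW)
    · intro c x hx W hW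
      rw [smul_mul_assoc, mul_smul_comm, ← smul_sub]
      exact Submodule.smul_mem _ _ (hx W hW)
    · intro x y hx hy W hW
      have e : (x * y - y * x) * W - W * (x * y - y * x) =
          (x * (y * W - W * y) - (y * W - W * y) * x) -
            (y * (x * W - W * x) - (x * W - W * x) * y) := by noncomm_ring
      rw [e]; exact Submodule.sub_mem _ (hx _ (hy W hW)) (hy _ (hx W hW))
  intro V hV
  refine (lieF_induction (p := fun V => V ∈ lieF ∧ V ∈ nullS B k) ?_ ?_ ?_ ?_ hV).2
  · rintro (_ | _)
    · exact ⟨lett_mem _, hB.false_mem hk⟩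
    · exact ⟨lett_mem _, hB.true_mem hk⟩
  · exact fun x y hx hy => ⟨lieF.add_mem hx.1 hy.1, Submodule.add_mem _ hx.2 hy.2⟩
  · exact fun c x hx => ⟨lieF.smul_mem c hx.1, Submodule.smul_mem _ c hx.2⟩
  · exact fun x y hx hy => ⟨lieF_lie hx.1 hy.1, had x hx.1 y hy.2⟩

omit hk in
lemma succ_of_left (h : ∀ P ∈ gen ^ (k + 1), B P 1 = 0) : VanTo B (k + 1) := by
  have h3 : ∀ b a, a + b ≤ k + 1 → ∀ P ∈ gen ^ a, ∀ Q ∈ gen ^ b, B P Q = 0 := by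
    intro b
    induction b with
    | zero =>
      intro a hab P hP Q hQ
      rw [pow_zero] at hQ
      obtain ⟨c, rfl⟩ := Submodule.mem_one.1 hQ
      rw [Algebra.algebraMap_eq_smul_one, map_smul, h P (gen_pow_mono (by omega) hP), smul_zero]
    | succ b ih =>
      intro a hab P hP Q hQ
      refine (gen_pow_succ_le (N := LinearMap.ker (B P)) (fun Q hQ => ?_) fun u hu Q hQ => ?_) hQ
      · exact ih a (by omega) P hP Q hQ
      · rw [LinearMap.mem_ker, hB.swap hu (ih a (by omega) P hP Q hQ),
          ih (a + 1) (by omega) _ (lie_mul_mem hu hP) Q hQ, neg_zero]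
  exact fun a b hab P hP Q hQ => h3 b a hab P hP Q hQ

lemma succ_of_odd (hpar : k = 0 ∨ Odd k) : VanTo B (k + 1) := by
  refine hB.succ_of_left fun P hP => ?_
  refine (gen_pow_succ_le (N := LinearMap.ker (B.flip 1)) (fun P hP => ?_) fun u hu P hP => ?_) hP
  · exact hk k 0 le_rfl P hP 1 (one_mem_gen_pow 0)
  · exact (hB.lieF_le_nullS hk hpar hu).2 k 0 le_rfl P hP 1 (one_mem_gen_pow 0)

lemma succ_of_even {j : ℕ} (hj : k = j + 1) (hpar : Odd j) : VanTo B (k + 1) := by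
  have hre : ∀ Y ∈ lieF, conjF Y = Y → ∀ t, 0 ≤ (-(I ^ j * B (Y ^ (k + 1)) 1 t)).re := by
    intro Y hY hYr t
    have h := hB.disp Y hY hYr Y hY j (fun i hi => ?_) (fun i hi => ?_) (fun i hi => ?_) t
    · rw [hYr, cE_of_sign (v := -B (Y ^ (k + 1)) 1)] at h
      · obtain ⟨r, hr, hr'⟩ := fsum_eq j
        rw [hr'] at h
        have e : ((I ^ j * (r : ℂ)) • -B (Y ^ (k + 1)) 1) t =
            (r : ℂ) * (-(I ^ j * B (Y ^ (k + 1)) 1 t)) := by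
          simp only [Pi.smul_apply, Pi.neg_apply, smul_eq_mul]; ring
        rw [e, re_ofReal_mul] at h
        exact nonneg_of_mul_nonneg_right h hr
      · intro a b hab
        have := hB.move hk (a := a + 1) (b := b + 1) (c := 0) (d := 0) (P := 1) (Q := 1) hY
          (one_mem_gen_pow 0) (one_mem_gen_pow 0) (by omega)
        rw [mul_one, mul_one, mul_one, show a + 1 + (b + 1) = k + 1 by omega] at this
        rw [← pow_succ, ← pow_succ, this, pow_succ, mul_neg_one, neg_smul, smul_neg]
    · refine cE_eq_zero fun a b h => ?_
      rw [mul_one, mul_one]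
      exact hk a b (by omega) _ (pow_mem_gen hY) _ (pow_mem_gen hY)
    · refine cE_eq_zero fun a b h => ?_
      rw [mul_one, ← pow_succ]
      exact hk (a + 1) b (by omega) _ (pow_mem_gen hY) _ (pow_mem_gen hY)
    · refine cE_eq_zero fun a b h => ?_
      rw [hYr, ← pow_succ, ← pow_succ]
      exact hk (a + 1) (b + 1) (by omega) _ (pow_mem_gen hY) _ (pow_mem_gen hY)
  have hev : Odd (k + 1) := by rw [hj]; exact (hpar.add_one).add_one
  have hz : ∀ Y ∈ lieF, conjF Y = Y → B (Y ^ (k + 1)) 1 = 0 := by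
    intro Y hY hYr
    funext t
    have h1 := hre Y hY hYr t
    have h2 := hre (-Y) (lieF.neg_mem hY) (by rw [map_neg, hYr]) t
    rw [hev.neg_pow, map_neg, LinearMap.neg_apply, Pi.neg_apply, mul_neg, neg_neg] at h2
    rw [neg_re] at h1
    have h3 := congrFun (hB.conj (Y ^ (k + 1)) 1) t
    have h4 := hB.move hk (a := 0) (b := k + 1) (c := 0) (d := 0) (P := 1) (Q := 1) hY
      (one_mem_gen_pow 0) (one_mem_gen_pow 0) (by omega)
    rw [pow_zero, mul_one, mul_one, hev.neg_one_pow, zero_add, mul_one, neg_smul, one_smul] at h4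
    rw [map_one conjF, map_pow conjF, hYr, h4, Pi.neg_apply, Pi.star_apply] at h3
    set β := B (Y ^ (k + 1)) 1 t
    have hβ : β.re = 0 := by
      have := congrArg re h3
      simp only [RCLike.star_def, conj_re, neg_re] at this
      linarith
    obtain ⟨i, rfl⟩ := hpar
    have hI : I ^ (2 * i + 1) * β = ((-1 : ℝ) ^ i : ℝ) * (I * β) := by
      rw [pow_succ, pow_mul, I_sq]; push_cast; ring
    rw [hI, re_ofReal_mul] at h1 h2
    have h5 : ((-1 : ℝ) ^ i) ≠ 0 := pow_ne_zero _ (by norm_num)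
    have h6 : (I * β).re = 0 := by
      refine (mul_eq_zero.1 (le_antisymm ?_ h2)).resolve_left h5
      linarith
    have h7 : β.im = 0 := by simpa using h6
    exact Complex.ext hβ h7
  refine hB.succ_of_left fun P hP => ?_
  refine gen_pow_le_of_real_pow_mem (k + 1) (LinearMap.ker (B.flip 1)) (fun i hi P hP => ?_)
    (fun u hu hur => hz u hu hur) hP
  exact hk i 0 (by omega) P hP 1 (one_mem_gen_pow 0)

omit hk in
lemma vanTo (k : ℕ) : VanTo B k := by
  induction k with
  | zero =>
    intro a b hab P hP Q hQ
    obtain rfl : a = 0 := by omega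
    obtain rfl : b = 0 := by omega
    rw [pow_zero] at hP hQ
    obtain ⟨c, rfl⟩ := Submodule.mem_one.1 hP
    obtain ⟨d, rfl⟩ := Submodule.mem_one.1 hQ
    rw [Algebra.algebraMap_eq_smul_one, Algebra.algebraMap_eq_smul_one, map_smul, map_smul,
      LinearMap.smul_apply, hB.one_one, smul_zero, smul_zero]
  | succ k ih =>
    rcases Nat.even_or_odd k with he | ho
    · rcases Nat.eq_zero_or_pos k with h0 | h0
      · exact hB.succ_of_odd ih (Or.inl h0)
      · obtain ⟨j, rfl⟩ := Nat.exists_eq_succ_of_ne_zero h0.ne'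
        refine hB.succ_of_even ih rfl ?_
        rcases Nat.even_or_odd j with h | h
        · exact absurd he (by simpa using h.add_one)
        · exact h
    · exact hB.succ_of_odd ih (Or.inr ho)

end IsPol

end Isotropy

section

variable {n : ℕ}

section NullField

/-- The polarized action on `ρ`, evaluated on a set `T`. -/
def polT (X : Fin n → Sm n) (ρ : Sm n) (T : Set (Fin n → ℂ)) : Fr →ₗ[ℂ] Fr →ₗ[ℂ] (T → ℂ) :=
  LinearMap.mk₂ ℂ (fun P Q q => ev q.1 (polB X P Q ρ))
    (fun P P' Q => by ext q; simp [polB_add_left])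
    (fun c P Q => by ext q; simp [polB_smul_left])
    (fun P Q Q' => by ext q; simp [polB_add_right])
    (fun c P Q => by ext q; simp [polB_smul_right])

variable {X : Fin n → Sm n} {ρ : Sm n} {T : Set (Fin n → ℂ)}

lemma polT_apply (P Q : Fr) (q : T) : polT X ρ T P Q q = ev q.1 (polB X P Q ρ) := rfl

lemma cE_polT (Y P Q : Fr) (k : ℕ) (q : T) : cE (polT X ρ T) Y P Q k q = coE X ρ q Y P Q k := by
  simp only [cE, coE, Finset.sum_apply, Pi.smul_apply, polT_apply, smul_eq_mul, mul_assoc]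

lemma polB_lett_lett (X : Fin n → Sm n) (f : Sm n) :
    polB X (lett true) (lett false) f = ∑ j, X j * fld X false (dl j f) := by
  have h := polB_lett_mul X true 1 (lett false) f
  have h1 : ∀ Q : Fr, polB X 1 Q f = opG X Q LinearMap.id f := fun Q => by
    rw [polB, map_one (opB X)]; rfl
  rw [mul_one, h1, h1, map_mul (opG X), Module.End.mul_apply, opG_true, opG_false] at h
  rw [h]
  simp [opG_false]

lemma ev_polB_lett_lett (X : Fin n → Sm n) (f : Sm n) (q : Fin n → ℂ) :
    ev q (polB X (lett true) (lett false) f) = ∑ j, ∑ k,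
      ev q (dl j (db k f)) * ev q (X j) * (starRingEnd ℂ) (ev q (X k)) := by
  rw [polB_lett_lett, map_sum]
  refine Finset.sum_congr rfl fun j _ => ?_
  rw [map_mul, fld, sum_derivation_apply, map_sum, Finset.mul_sum]
  refine Finset.sum_congr rfl fun k _ => ?_
  rw [Derivation.smul_apply, smul_eq_mul, map_mul, ev_star, dl_db]
  simp only [starRingEnd_apply]
  ring

lemma ev_act_eq_zero (htan : ∀ f : Sm n, (∀ q ∈ T, ev q f = 0) → ∀ q ∈ T, ev q (fld X true f) = 0)
    {u : Fr} (hu : u ∈ lieF) :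
    ∀ f : Sm n, (∀ q ∈ T, ev q f = 0) → ∀ q ∈ T, ev q (act X u f) = 0 := by
  refine lieF_induction (p := fun u => ∀ f : Sm n, (∀ q ∈ T, ev q f = 0) →
    ∀ q ∈ T, ev q (act X u f) = 0) ?_ ?_ ?_ ?_ hu
  · intro b f hf q hq
    rw [act_lett]
    cases b
    · have h1 : fld X false f = star (fld X true (star f)) := by
        rw [fld_star, star_star]; rfl
      rw [h1, ev_star, htan (star f) (fun p hp => by rw [ev_star, hf p hp, map_zero]) q hq,
        map_zero]
    · exact htan f hf q hq
  · intro x y hx hy f hf q hq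
    rw [map_add, LinearMap.add_apply, map_add, hx f hf q hq, hy f hf q hq, add_zero]
  · intro c x hx f hf q hq
    rw [map_smul, LinearMap.smul_apply, map_smul, hx f hf q hq, smul_zero]
  · intro x y hx hy f hf q hq
    rw [map_sub, map_mul, map_mul, LinearMap.sub_apply, map_sub, Module.End.mul_apply,
      Module.End.mul_apply, hx _ (hy f hf) q hq, hy _ (hx f hf) q hq, sub_zero]

lemma isPol_polT (hρ : star ρ = ρ) (h0 : ∀ q ∈ T, ev q ρ = 0)
    (htan : ∀ f : Sm n, (∀ q ∈ T, ev q f = 0) → ∀ q ∈ T, ev q (fld X true f) = 0)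
    (hnull : ∀ q ∈ T, ∑ j, ∑ k,
      ev q (dl j (db k ρ)) * ev q (X j) * (starRingEnd ℂ) (ev q (X k)) = 0)
    (hpsc : ∀ q ∈ T, PscAt ρ q) : IsPol (polT X ρ T) where
  leib u hu P Q h := by
    ext q
    have := ev_act_eq_zero htan hu (polB X P Q ρ) (fun p hp => congrFun h ⟨p, hp⟩) q.1 q.2
    rw [polB_leibniz X hu, map_add] at this
    exact this
  mul_false P Q := by ext q; rw [polT_apply, polB_mul_false]; simp
  mul_true P Q := by ext q; rw [polT_apply, polB_mul_true]; simp
  one_one := by ext q; rw [polT_apply, polB_one_one]; exact h0 q.1 q.2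
  conj P Q := by
    ext q
    have h := polB_star X (conjF Q) (conjF P) ρ
    rw [hρ, conjF_conjF, conjF_conjF] at h
    rw [Pi.star_apply, polT_apply, polT_apply, ← starRingEnd_apply, ← ev_star, h]
  null := by
    ext q
    rw [polT_apply, ev_polB_lett_lett]
    exact hnull q.1 q.2
  disp Y hY hYr Z hZ N h1 h2 h3 q := by
    rw [cE_polT]
    exact displacement X ρ q.1 hY hYr hZ N (hpsc q.1 q.2)
      (fun k hk => by rw [← cE_polT, h1 k hk]; rfl)
      (fun k hk => by rw [← cE_polT, h2 k hk]; rfl)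
      (fun k hk => by rw [← cE_polT, h3 k hk]; rfl)

theorem polB_pow_eq_zero (hρ : star ρ = ρ) (h0 : ∀ q ∈ T, ev q ρ = 0)
    (htan : ∀ f : Sm n, (∀ q ∈ T, ev q f = 0) → ∀ q ∈ T, ev q (fld X true f) = 0)
    (hnull : ∀ q ∈ T, ∑ j, ∑ k,
      ev q (dl j (db k ρ)) * ev q (X j) * (starRingEnd ℂ) (ev q (X k)) = 0)
    (hpsc : ∀ q ∈ T, PscAt ρ q) {q : Fin n → ℂ} (hq : q ∈ T) (a b : ℕ) :
    ev q (polB X (lett true ^ a) (lett false ^ b) ρ) = 0 := by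
  have h := (isPol_polT hρ h0 htan hnull hpsc).vanTo (a + b) a b le_rfl
    (lett true ^ a) ?_ (lett false ^ b) ?_
  · exact congrFun h ⟨q, hq⟩
  · exact Submodule.pow_mem_pow _ (lieF_le_gen (lett_mem _)) _
  · exact Submodule.pow_mem_pow _ (lieF_le_gen (lett_mem _)) _

end NullField

section Isotropic

/-- Taylor coefficients of `ρ` at `q` in the variables `z - q` and `conj (z - q)`. -/
def tc (ρ : Sm n) (q : Fin n → ℂ) (α β : Fin n →₀ ℕ) : ℂ :=
  ((α.degree + β.degree).factorial : ℂ)⁻¹ *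
    ev q (MvPolynomial.coeff (Finsupp.sumElim α β) (tk (α.degree + β.degree) ρ))

lemma degree_sumElim (α β : Fin n →₀ ℕ) : (Finsupp.sumElim α β).degree = α.degree + β.degree := by
  simp [Finsupp.degree_eq_sum]

lemma coeff_jet (q : Fin n → ℂ) {K : ℕ} (ρ : Sm n) (α β : Fin n →₀ ℕ)
    (h : α.degree + β.degree < K) :
    MvPolynomial.coeff (Finsupp.sumElim α β) (jet q K ρ) = tc ρ q α β := by
  rw [jet, MvPolynomial.coeff_sum, Finset.sum_eq_single (α.degree + β.degree)]
  · rw [MvPolynomial.coeff_smul, MvPolynomial.coeff_map, tc]; rfl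
  · intro k _ hk
    rw [MvPolynomial.coeff_smul, MvPolynomial.coeff_map,
      (tk_homogeneous k ρ).coeff_eq_zero, map_zero, smul_zero]
    rw [degree_sumElim]; exact hk.symm
  · intro h'
    exact absurd (Finset.mem_range.2 h) h'

/-- Monomials in a tuple of power series. -/
def pw (γ : Fin n → PowerSeries ℂ) (α : Fin n →₀ ℕ) : PowerSeries ℂ := ∏ j, γ j ^ α j

lemma coeff_pw_of_lt {γ : Fin n → PowerSeries ℂ} (hγ : ∀ j, PowerSeries.constantCoeff (γ j) = 0)
    {α : Fin n →₀ ℕ} {a : ℕ} (h : a < α.degree) : PowerSeries.coeff a (pw γ α) = 0 := by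
  refine PowerSeries.X_pow_dvd_iff.1 ?_ a h
  rw [Finsupp.degree_eq_sum, ← Finset.prod_pow_eq_pow_sum]
  exact Finset.prod_dvd_prod_of_dvd _ _ fun j _ =>
    pow_dvd_pow_of_dvd (PowerSeries.X_dvd_iff.2 (hγ j)) _

/-- Multi-indices of bounded degree. -/
def degLE (n a : ℕ) : Finset (Fin n →₀ ℕ) := (Finsupp.finite_of_degree_le a).toFinset

lemma mem_degLE {a : ℕ} {α : Fin n →₀ ℕ} : α ∈ degLE n a ↔ α.degree ≤ a := by simp [degLE]

/-- The coefficients of order `a` of all monomials along a formal curve. -/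
def cc (γ : Fin n → PowerSeries ℂ) (a : ℕ) : (Fin n →₀ ℕ) →₀ ℂ :=
  Finsupp.onFinset (degLE n a)
    (fun α => if α.degree ≤ a then PowerSeries.coeff a (pw γ α) else 0)
    fun α h => mem_degLE.2 (by by_contra h'; exact h (if_neg h'))

lemma cc_apply {γ : Fin n → PowerSeries ℂ} (hγ : ∀ j, PowerSeries.constantCoeff (γ j) = 0)
    (a : ℕ) (α : Fin n →₀ ℕ) : cc γ a α = PowerSeries.coeff a (pw γ α) := by
  rw [cc, Finsupp.onFinset_apply]
  split_ifs with h
  · rfl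
  · exact (coeff_pw_of_lt hγ (not_le.1 h)).symm

/-- The sesquilinear form of Taylor coefficients. -/
def hf (ρ : Sm n) (q : Fin n → ℂ) (φ ψ : (Fin n →₀ ℕ) →₀ ℂ) : ℂ :=
  φ.sum fun α c => ψ.sum fun β d => tc ρ q α β * (c * (starRingEnd ℂ) d)

lemma hf_eq_sum (ρ : Sm n) (q : Fin n → ℂ) {φ ψ : (Fin n →₀ ℕ) →₀ ℂ} {S S' : Finset (Fin n →₀ ℕ)}
    (hφ : φ.support ⊆ S) (hψ : ψ.support ⊆ S') :
    hf ρ q φ ψ = ∑ α ∈ S, ∑ β ∈ S', tc ρ q α β * (φ α * (starRingEnd ℂ) (ψ β)) := by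
  rw [hf, Finsupp.sum_of_support_subset _ hφ _ (by simp)]
  refine Finset.sum_congr rfl fun α _ => ?_
  rw [Finsupp.sum_of_support_subset _ hψ _ (by simp)]

lemma cc_support (γ : Fin n → PowerSeries ℂ) (a : ℕ) : (cc γ a).support ⊆ degLE n a :=
  Finsupp.support_onFinset_subset

/-- The left part of a multi-index. -/
def lft (μ : Fin n ⊕ Fin n →₀ ℕ) : Fin n →₀ ℕ := (Finsupp.sumFinsuppEquivProdFinsupp μ).1

/-- The right part of a multi-index. -/
def rgt (μ : Fin n ⊕ Fin n →₀ ℕ) : Fin n →₀ ℕ := (Finsupp.sumFinsuppEquivProdFinsupp μ).2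

lemma lft_apply (μ : Fin n ⊕ Fin n →₀ ℕ) (j : Fin n) : lft μ j = μ (Sum.inl j) := rfl

lemma rgt_apply (μ : Fin n ⊕ Fin n →₀ ℕ) (j : Fin n) : rgt μ j = μ (Sum.inr j) := rfl

lemma sum_jet {γ : Fin n → PowerSeries ℂ} (hγ : ∀ j, PowerSeries.constantCoeff (γ j) = 0)
    (ρ : Sm n) (q : Fin n → ℂ) {K a b : ℕ} (h : a + b < K) :
    ∑ μ ∈ (jet q K ρ).support, MvPolynomial.coeff μ (jet q K ρ) *
      (PowerSeries.coeff a (pw γ (lft μ)) *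
        (starRingEnd ℂ) (PowerSeries.coeff b (pw γ (rgt μ)))) = hf ρ q (cc γ a) (cc γ b) := by
  classical
  set F : (Fin n ⊕ Fin n →₀ ℕ) → ℂ := fun μ => MvPolynomial.coeff μ (jet q K ρ) *
      (PowerSeries.coeff a (pw γ (lft μ)) *
        (starRingEnd ℂ) (PowerSeries.coeff b (pw γ (rgt μ)))) with hF
  have e1 : hf ρ q (cc γ a) (cc γ b) = ∑ μ ∈ (degLE n a ×ˢ degLE n b).map
      Finsupp.sumFinsuppEquivProdFinsupp.symm.toEmbedding, F μ := by
    rw [hf_eq_sum ρ q (cc_support γ a) (cc_support γ b), Finset.sum_map, Finset.sum_product]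
    refine Finset.sum_congr rfl fun α hα => Finset.sum_congr rfl fun β hβ => ?_
    have hl : ∀ μ, μ = Finsupp.sumFinsuppEquivProdFinsupp.symm (α, β) → lft μ = α ∧ rgt μ = β ∧
        μ = Finsupp.sumElim α β := by
      rintro μ rfl
      refine ⟨by simp [lft], by simp [rgt], rfl⟩
    obtain ⟨h1, h2, h3⟩ := hl _ rfl
    rw [cc_apply hγ, cc_apply hγ, hF]
    simp only [Equiv.coe_toEmbedding]
    rw [h1, h2, h3, coeff_jet q ρ α β]
    rw [mem_degLE] at hα hβ
    omega
  rw [e1]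
  set D := (degLE n a ×ˢ degLE n b).map
      Finsupp.sumFinsuppEquivProdFinsupp.symm.toEmbedding with hD
  have hz : ∀ μ ∉ D, F μ = 0 := by
    intro μ hμ
    by_cases h1 : lft μ ∈ degLE n a
    · by_cases h2 : rgt μ ∈ degLE n b
      · refine absurd (Finset.mem_map.2 ⟨(lft μ, rgt μ), Finset.mem_product.2 ⟨h1, h2⟩, ?_⟩) hμ
        exact Finsupp.sumFinsuppEquivProdFinsupp.symm_apply_apply μ
      · rw [mem_degLE, not_le] at h2
        simp only [hF]
        rw [coeff_pw_of_lt hγ h2, map_zero, mul_zero, mul_zero]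
    · rw [mem_degLE, not_le] at h1
      simp only [hF]
      rw [coeff_pw_of_lt hγ h1, zero_mul, mul_zero]
  rw [Finset.sum_subset (Finset.subset_union_left (s₂ := D)),
    Finset.sum_subset (Finset.subset_union_right (s₁ := (jet q K ρ).support) (s₂ := D))]
  · exact fun μ _ hμ => hz μ hμ
  · intro μ _ hμ
    rw [MvPolynomial.notMem_support_iff.1 hμ, zero_mul]

/-- A formal curve through `q` along which all mixed Taylor coefficients of `ρ` vanish. -/
structure Isotropic (ρ : Sm n) (q : Fin n → ℂ) (γ : Fin n → PowerSeries ℂ) : Prop where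
  const : ∀ j, PowerSeries.constantCoeff (γ j) = 0
  form : ∀ a b, hf ρ q (cc γ a) (cc γ b) = 0

lemma Ex_prod (X : Fin n → Sm n) (q : Fin n → ℂ) {Y : Fr} (hY : Y ∈ lieF) (f : Fin n → Sm n)
    (α : Fin n →₀ ℕ) : Ex X q Y (∏ j, f j ^ α j) = ∏ j, Ex X q Y (f j) ^ α j := by
  let φ : Sm n →* PowerSeries ℂ :=
    { toFun := Ex X q Y, map_one' := Ex_one X q hY, map_mul' := Ex_mul X q hY }
  change φ _ = ∏ j, φ (f j) ^ α j
  simp only [map_prod, map_pow]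

lemma ev_polB_jet (X : Fin n → Sm n) (ρ : Sm n) (q : Fin n → ℂ) (K a b : ℕ) :
    ev q (polB X (lett true ^ a) (lett false ^ b) (MvPolynomial.aeval (zz q) (jet q K ρ))) =
      (a.factorial : ℂ) * (b.factorial : ℂ) *
    ∑ μ ∈ (jet q K ρ).support, MvPolynomial.coeff μ (jet q K ρ) *
      (PowerSeries.coeff a (pw (fun j => Ex X q (lett true) (zz q (Sum.inl j))) (lft μ)) *
        (starRingEnd ℂ) (PowerSeries.coeff b
          (pw (fun j => Ex X q (lett true) (zz q (Sum.inl j))) (rgt μ)))) := by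
  conv_lhs => rw [MvPolynomial.as_sum (jet q K ρ)]
  rw [map_sum, map_sum, map_sum, Finset.mul_sum]
  refine Finset.sum_congr rfl fun μ _ => ?_
  have hP : ∀ α : Fin n →₀ ℕ, ∏ j, zz q (Sum.inl j) ^ α j ∈ HP n := fun α =>
    Subalgebra.prod_mem _ fun j _ => Subalgebra.pow_mem _ (zz_inl_mem q j) _
  have hm := polB_mul X (lett true ^ a) (lett false ^ b) (db_HP (hP (lft μ)))
    (dl_star_HP (hP (rgt μ)))
  simp only [lft_apply, rgt_apply] at hm
  rw [aeval_zz_monomial, map_smul, map_smul, hm, map_mul, act_star, ev_star,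
    map_pow conjF, conjF_lett]
  simp only [pw, ← Ex_prod X q (lett_mem true), coeff_Ex]
  have ha : (a.factorial : ℂ) ≠ 0 := by exact_mod_cast a.factorial_ne_zero
  have hb : (b.factorial : ℂ) ≠ 0 := by exact_mod_cast b.factorial_ne_zero
  simp only [map_mul, map_inv₀, map_natCast, smul_eq_mul, lft_apply, rgt_apply, Bool.not_false]
  field_simp

theorem exists_isotropic {X : Fin n → Sm n} {ρ : Sm n} {q : Fin n → ℂ}
    (h : ∀ a b, ev q (polB X (lett true ^ a) (lett false ^ b) ρ) = 0) (hX : ∃ j, ev q (X j) ≠ 0) :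
    ∃ γ, Isotropic ρ q γ ∧ ∃ j, PowerSeries.coeff 1 (γ j) ≠ 0 := by
  set γ : Fin n → PowerSeries ℂ := fun j => Ex X q (lett true) (zz q (Sum.inl j)) with hγd
  have hγ : ∀ j, PowerSeries.constantCoeff (γ j) = 0 := by
    intro j
    rw [← PowerSeries.coeff_zero_eq_constantCoeff_apply, hγd, coeff_Ex]
    simp [ev_zz]
  refine ⟨γ, ⟨hγ, fun a b => ?_⟩, ?_⟩
  · obtain ⟨K, hK⟩ := finOrd_polB X (lett true ^ a) (lett false ^ b)
    have h1 := ev_eq_zero_of_flat (hK q 1 _ ((flat_sub_jet q (K + 1 + (a + b)) ρ).mono (by omega)))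
    rw [map_sub, map_sub, h, zero_sub, neg_eq_zero, ev_polB_jet,
      sum_jet hγ ρ q (by omega : a + b < K + 1 + (a + b))] at h1
    have ha : (a.factorial : ℂ) ≠ 0 := by exact_mod_cast a.factorial_ne_zero
    have hb : (b.factorial : ℂ) ≠ 0 := by exact_mod_cast b.factorial_ne_zero
    exact (mul_eq_zero.1 h1).resolve_left (mul_ne_zero ha hb)
  · obtain ⟨j, hj⟩ := hX
    refine ⟨j, ?_⟩
    rw [hγd]
    simp only [coeff_Ex, pow_one, act_lett]
    have : fld X true (zz q (Sum.inl j)) = X j := by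
      rw [fld, sum_derivation_apply, Finset.sum_eq_single j]
      · rw [Derivation.smul_apply]
        simp [zz, dl_co]
      · intro b _ hb
        rw [Derivation.smul_apply]
        simp [zz, dl_co, hb]
      · simp
    rw [this]
    simpa using hj

end Isotropic

end

section Digits

variable {O : Type*} [CommRing O] [IsDomain O] [IsNoetherianRing O]

/-- A Noetherian domain with a principal ideal of residue ring `ℂ` embeds into `ℂ⟦t⟧`. -/
theorem exists_ringHom_of_residue (κ : ℂ →+* O) {t : O} (ht0 : t ≠ 0) (ht : ¬ IsUnit t)
    (hres : ∀ a, ∃ c, t ∣ a - κ c) :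
    ∃ φ : O →+* PowerSeries ℂ, Function.Injective φ ∧ (∀ c, φ (κ c) = PowerSeries.C c) ∧
      ∀ a, t ∣ a → PowerSeries.constantCoeff (φ a) = 0 := by
  choose c δ hδ using hres
  have hdec : ∀ a, a = κ (c a) + t * δ a := fun a => by rw [← hδ]; ring
  have huniq : ∀ a x y, a = κ x + t * y → c a = x ∧ δ a = y := by
    intro a x y h
    have h1 : t * (δ a - y) = κ (x - c a) := by
      rw [map_sub]; linear_combination (hdec a).symm.trans h
    have h2 : x - c a = 0 := by
      by_contra hne
      refine ht (isUnit_of_dvd_unit ⟨_, h1.symm⟩ ?_)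
      exact (isUnit_iff_ne_zero.2 hne).map κ
    rw [h2, map_zero] at h1
    exact ⟨(sub_eq_zero.1 h2).symm, sub_eq_zero.1 ((mul_eq_zero.1 h1).resolve_left ht0)⟩
  have hadd : ∀ a b, c (a + b) = c a + c b ∧ δ (a + b) = δ a + δ b := fun a b => by
    refine huniq _ _ _ ?_
    rw [map_add]; linear_combination hdec a + hdec b
  have hmul : ∀ a b, c (a * b) = c a * c b ∧ δ (a * b) = δ a * b + κ (c a) * δ b := fun a b => by
    refine huniq _ _ _ ?_
    rw [map_mul]
    linear_combination b * hdec a + κ (c a) * hdec b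
  have hκ : ∀ x, c (κ x) = x ∧ δ (κ x) = 0 := fun x => huniq _ _ _ (by simp)
  let F : O → PowerSeries ℂ := fun a => PowerSeries.mk fun k => c (δ^[k] a)
  have hF0 : ∀ a, PowerSeries.coeff 0 (F a) = c a := fun a => by simp [F]
  have hFs : ∀ a k, PowerSeries.coeff (k + 1) (F a) = PowerSeries.coeff k (F (δ a)) := fun a k => by
    simp [F]
  have hFκ : ∀ x, F (κ x) = PowerSeries.C x := by
    have h0 : ∀ k, PowerSeries.coeff k (F 0) = 0 := by
      have := hκ 0
      rw [map_zero] at this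
      intro k
      induction k with
      | zero => rw [hF0, this.1]
      | succ k ih => rw [hFs, this.2, ih]
    intro x
    ext k
    cases k with
    | zero => rw [hF0, (hκ x).1]; simp
    | succ k => rw [hFs, (hκ x).2, h0, PowerSeries.coeff_C, if_neg k.succ_ne_zero]
  have hFadd : ∀ a b, F (a + b) = F a + F b := by
    intro a b
    ext k
    induction k generalizing a b with
    | zero => rw [map_add, hF0, hF0, hF0, (hadd a b).1]
    | succ k ih => rw [map_add, hFs, hFs, hFs, (hadd a b).2, ih, map_add]
  have hFdec : ∀ a, F a = PowerSeries.C (c a) + PowerSeries.X * F (δ a) := by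
    intro a
    ext k
    cases k with
    | zero => rw [hF0]; simp
    | succ k => rw [hFs, map_add, PowerSeries.coeff_succ_X_mul, PowerSeries.coeff_C,
        if_neg k.succ_ne_zero, zero_add]
  have hFmul : ∀ a b, F (a * b) = F a * F b := by
    intro a b
    ext k
    induction k generalizing a b with
    | zero =>
      rw [hF0, (hmul a b).1, PowerSeries.coeff_zero_eq_constantCoeff_apply, map_mul,
        ← PowerSeries.coeff_zero_eq_constantCoeff_apply,
        ← PowerSeries.coeff_zero_eq_constantCoeff_apply, hF0, hF0]
    | succ k ih =>
      rw [hFs, (hmul a b).2, hFadd, map_add, ih, ih, hFκ, hFdec a, add_mul, map_add, mul_assoc,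
        PowerSeries.coeff_succ_X_mul, PowerSeries.coeff_C_mul, PowerSeries.coeff_C_mul, hFs]
      ring
  let φ : O →+* PowerSeries ℂ :=
    { toFun := F
      map_one' := by rw [← map_one κ, hFκ, map_one]
      map_mul' := hFmul
      map_zero' := by rw [← map_zero κ, hFκ, map_zero]
      map_add' := hFadd }
  refine ⟨φ, (injective_iff_map_eq_zero φ).2 fun a ha => ?_, hFκ, fun a ha => ?_⟩
  · have hdvd : ∀ k, ∀ a, F a = 0 → t ^ k ∣ a := by
      intro k
      induction k with
      | zero => intro a _; exact ⟨a, by simp⟩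
      | succ k ih =>
        intro a ha
        have h0 : c a = 0 := by rw [← hF0, ha, map_zero]
        have h1 : F (δ a) = 0 := by
          ext j
          rw [← hFs, ha, map_zero, map_zero]
        obtain ⟨b, hb⟩ := ih _ h1
        refine ⟨b, ?_⟩
        rw [hdec a, h0, hb, map_zero]; ring
    have hmem : a ∈ ⨅ k : ℕ, Ideal.span {t} ^ k := by
      rw [Ideal.mem_iInf]
      intro k
      rw [Ideal.span_singleton_pow, Ideal.mem_span_singleton]
      exact hdvd k a ha
    rwa [Ideal.iInf_pow_eq_bot_of_isDomain _
      (by rwa [Ne, Ideal.span_singleton_eq_top])] at hmem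
  · obtain ⟨b, rfl⟩ := ha
    have := huniq (t * b) 0 b (by simp)
    change PowerSeries.constantCoeff (F _) = 0
    rw [← PowerSeries.coeff_zero_eq_constantCoeff_apply, hF0, this.1]

end Digits

section Residue

variable {S : Type*} [CommRing S] [Algebra (PowerSeries ℂ) S] [Algebra.IsIntegral (PowerSeries ℂ) S]

theorem exists_sub_mem_of_integral (𝔫 : Ideal S) [h𝔫 : 𝔫.IsPrime]
    (hx : algebraMap (PowerSeries ℂ) S PowerSeries.X ∈ 𝔫) (s : S) :
    ∃ c : ℂ, s - algebraMap (PowerSeries ℂ) S (PowerSeries.C c) ∈ 𝔫 := by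
  obtain ⟨p, hp, hps⟩ := Algebra.IsIntegral.isIntegral (R := PowerSeries ℂ) s
  let π : S →+* S ⧸ 𝔫 := Ideal.Quotient.mk 𝔫
  have hcomp : π.comp (algebraMap (PowerSeries ℂ) S) =
      (π.comp ((algebraMap (PowerSeries ℂ) S).comp PowerSeries.C)).comp
        PowerSeries.constantCoeff := by
    refine RingHom.ext fun a => ?_
    obtain ⟨b, hb⟩ : PowerSeries.X ∣ a - PowerSeries.C (PowerSeries.constantCoeff a) := by
      rw [PowerSeries.X_dvd_iff]; simp
    change π (algebraMap _ S a) = π (algebraMap _ S (PowerSeries.C (PowerSeries.constantCoeff a)))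
    rw [← sub_eq_zero, ← map_sub π, ← map_sub (algebraMap _ S), hb, map_mul (algebraMap _ S)]
    exact Ideal.Quotient.eq_zero_iff_mem.2 (𝔫.mul_mem_right _ hx)
  have h1 : (p.map (PowerSeries.constantCoeff (R := ℂ))).eval₂
      (π.comp ((algebraMap _ S).comp PowerSeries.C)) (π s) = 0 := by
    rw [Polynomial.eval₂_map, ← hcomp, ← Polynomial.hom_eval₂, hps, map_zero]
  rw [((IsAlgClosed.splits _).eq_prod_roots_of_monic (hp.map _)), ← Polynomial.coe_eval₂RingHom,
    map_multiset_prod, Multiset.map_map] at h1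
  obtain ⟨c, -, hc⟩ := Multiset.mem_map.1 (Multiset.prod_eq_zero_iff.1 h1)
  refine ⟨c, Ideal.Quotient.eq_zero_iff_mem.1 ?_⟩
  simpa [Polynomial.eval₂_sub, π] using hc

theorem dvd_sub_of_localization (𝔫 : Ideal S) [h𝔫 : 𝔫.IsPrime]
    (hx : algebraMap (PowerSeries ℂ) S PowerSeries.X ∈ 𝔫) {O : Type*} [CommRing O] [Algebra S O]
    [IsLocalization.AtPrime O 𝔫] {t : O} (hdvd : ∀ s ∈ 𝔫, t ∣ algebraMap S O s)
    (a : O) : ∃ c, t ∣ a - algebraMap S O (algebraMap (PowerSeries ℂ) S (PowerSeries.C c)) := by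
  let κ : ℂ →+* O := (algebraMap S O).comp ((algebraMap (PowerSeries ℂ) S).comp PowerSeries.C)
  obtain ⟨s, u, rfl⟩ := IsLocalization.exists_mk'_eq 𝔫.primeCompl a
  obtain ⟨c, hc⟩ := exists_sub_mem_of_integral 𝔫 hx s
  obtain ⟨d, hd⟩ := exists_sub_mem_of_integral 𝔫 hx (u : S)
  have hd0 : d ≠ 0 := by
    rintro rfl
    rw [map_zero, map_zero, sub_zero] at hd
    exact u.2 hd
  refine ⟨c / d, ?_⟩
  have hu : IsUnit (algebraMap S O u) := IsLocalization.map_units O u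
  rw [← hu.dvd_mul_left, mul_sub, IsLocalization.mk'_spec'_mk]
  have e : algebraMap S O s - algebraMap S O u * κ (c / d) =
      algebraMap S O (s - algebraMap _ S (PowerSeries.C c)) -
        κ (c / d) * algebraMap S O (u - algebraMap _ S (PowerSeries.C d)) := by
    have h2 : κ (c / d) * κ d = κ c := by rw [← map_mul κ, div_mul_cancel₀ _ hd0]
    rw [map_sub (algebraMap S O), map_sub (algebraMap S O)]
    change _ = _ - κ c - _ * (_ - κ d)
    linear_combination -h2
  change t ∣ _ - _ * κ (c / d)
  rw [e]
  exact dvd_sub (hdvd _ hc) ((hdvd _ hd).mul_left _)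

end Residue

section Normalization

attribute [local instance] FractionRing.liftAlgebra

/-- A domain finite over `ℂ⟦x⟧` embeds into a power series ring. -/
theorem exists_ringHom_of_finite {D : Type} [CommRing D] [IsDomain D] [Algebra (PowerSeries ℂ) D]
    [Module.Finite (PowerSeries ℂ) D]
    (hinj : Function.Injective (algebraMap (PowerSeries ℂ) D)) :
    ∃ φ : D →+* PowerSeries ℂ, Function.Injective φ ∧
      (∀ c, φ (algebraMap (PowerSeries ℂ) D (PowerSeries.C c)) = PowerSeries.C c) ∧
      PowerSeries.constantCoeff (φ (algebraMap (PowerSeries ℂ) D PowerSeries.X)) = 0 := by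
  have : FaithfulSMul (PowerSeries ℂ) D := (faithfulSMul_iff_algebraMap_injective _ _).2 hinj
  have : Module.IsTorsionFree (PowerSeries ℂ) D := inferInstance
  set A := PowerSeries ℂ
  set K := FractionRing A
  set L := FractionRing D
  have : FiniteDimensional K L := inferInstance
  have : CharZero A := charZero_of_injective_algebraMap (R := ℂ) (algebraMap ℂ A).injective
  have : CharZero K := charZero_of_injective_algebraMap (R := A) (IsFractionRing.injective A K)
  have : Algebra.IsSeparable K L := inferInstance
  have : IsDedekindDomain A := inferInstance
  set S := integralClosure A L
  have : IsDedekindDomain S := integralClosure.isDedekindDomain A K L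
  have hASi : Function.Injective (algebraMap A S) := by
    have h1 : Function.Injective (algebraMap A L) := by
      rw [IsScalarTower.algebraMap_eq A D L]
      exact (IsFractionRing.injective D L).comp hinj
    rw [IsScalarTower.algebraMap_eq A S L, RingHom.coe_comp] at h1
    exact Function.Injective.of_comp h1
  have : FaithfulSMul A S := (faithfulSMul_iff_algebraMap_injective _ _).2 hASi
  have hx : algebraMap A S PowerSeries.X ∈ nonunits S := by
    intro h
    exact PowerSeries.X_prime.not_isUnit ((isUnit_map_iff (algebraMap A S) _).1 h)
  obtain ⟨𝔫, h𝔫, hx𝔫⟩ := exists_max_ideal_of_mem_nonunits hx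
  have : 𝔫.IsPrime := h𝔫.isPrime
  have hbot : 𝔫 ≠ ⊥ := by
    rintro rfl
    rw [Ideal.mem_bot, map_eq_zero_iff _ hASi] at hx𝔫
    exact PowerSeries.X_ne_zero hx𝔫
  set O := Localization.AtPrime 𝔫
  have : IsDiscreteValuationRing O :=
    IsLocalization.AtPrime.isDiscreteValuationRing_of_dedekind_domain S hbot O
  obtain ⟨t, ht⟩ := IsDiscreteValuationRing.exists_irreducible O
  have hmax := ht.maximalIdeal_eq
  have hdvd : ∀ s ∈ 𝔫, t ∣ algebraMap S O s := fun s hs => by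
    rw [← Ideal.mem_span_singleton, ← hmax]
    exact (IsLocalization.AtPrime.to_map_mem_maximal_iff O 𝔫 s).2 hs
  let κ : ℂ →+* O := (algebraMap S O).comp ((algebraMap A S).comp PowerSeries.C)
  have hres : ∀ a : O, ∃ c, t ∣ a - κ c := fun a =>
    dvd_sub_of_localization (S := S) (O := O) 𝔫 hx𝔫 (t := t) hdvd a
  obtain ⟨φ, hφ, hφκ, hφt⟩ := exists_ringHom_of_residue κ ht.ne_zero ht.not_isUnit hres
  let ι : D →ₐ[A] S := IsIntegralClosure.lift A S L
  have hι : Function.Injective ι := by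
    intro x y hxy
    have := congrArg (algebraMap S L) hxy
    rw [IsIntegralClosure.algebraMap_lift, IsIntegralClosure.algebraMap_lift] at this
    exact IsFractionRing.injective D L this
  have hSO : Function.Injective (algebraMap S O) :=
    IsLocalization.injective O 𝔫.primeCompl_le_nonZeroDivisors
  refine ⟨φ.comp ((algebraMap S O).comp ι.toRingHom), hφ.comp (hSO.comp hι), fun c => ?_, ?_⟩
  · change φ (algebraMap S O (ι _)) = _
    rw [ι.commutes]
    exact hφκ c
  · change PowerSeries.constantCoeff (φ (algebraMap S O (ι _))) = _
    rw [ι.commutes]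
    exact hφt _ (hdvd _ hx𝔫)

end Normalization

section FormalCurve

variable {n : ℕ}

/-- The maximal ideal of the ring of formal power series. -/
def mIdeal (n : ℕ) : Ideal (MvPowerSeries (Fin n) ℂ) := Ideal.span (Set.range MvPowerSeries.X)

theorem mem_mIdeal_pow (k : ℕ) (f : MvPowerSeries (Fin n) ℂ)
    (hf : ∀ α : Fin n →₀ ℕ, α.degree < k → MvPowerSeries.coeff α f = 0) : f ∈ mIdeal n ^ k := by
  classical
  induction k generalizing f with
  | zero => simp
  | succ k ih =>
    let P : (Fin n →₀ ℕ) → Fin n → Prop := fun α i => α i ≠ 0 ∧ ∀ i' < i, α i' = 0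
    let g : Fin n → MvPowerSeries (Fin n) ℂ := fun i β =>
      if P (β + Finsupp.single i 1) i then MvPowerSeries.coeff (β + Finsupp.single i 1) f else 0
    have hg : ∀ i, g i ∈ mIdeal n ^ k := fun i => ih _ fun α hα => by
      change (if _ then _ else _) = _
      split_ifs
      · exact hf _ (by rw [map_add, Finsupp.degree_single]; omega)
      · rfl
    have hsum : f = ∑ i, MvPowerSeries.X i * g i := by
      refine MvPowerSeries.ext fun α => ?_
      have hterm : ∀ i, MvPowerSeries.coeff α (MvPowerSeries.X i * g i) =
          if P α i then MvPowerSeries.coeff α f else 0 := by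
        intro i
        rw [MvPowerSeries.X, MvPowerSeries.coeff_monomial_mul, one_mul]
        by_cases hi : α i = 0
        · rw [if_neg, if_neg (fun h => h.1 hi)]
          intro h
          have := h i
          rw [Finsupp.single_eq_same, hi] at this
          omega
        · have hle : Finsupp.single i 1 ≤ α := by
            rw [Finsupp.single_le_iff]; omega
          rw [if_pos hle]
          change (if P (α - Finsupp.single i 1 + Finsupp.single i 1) i then
            MvPowerSeries.coeff (α - Finsupp.single i 1 + Finsupp.single i 1) f else 0) = _
          rw [tsub_add_cancel_of_le hle]
      rw [map_sum, Finset.sum_congr rfl fun i _ => hterm i]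
      by_cases h0 : α = 0
      · subst h0
        rw [hf 0 (by simp)]
        simp
      · obtain ⟨i, hi⟩ : ∃ i, P α i := by
          obtain ⟨j, hj⟩ : ∃ j, α j ≠ 0 := by
            by_contra! h
            exact h0 (Finsupp.ext h)
          obtain ⟨i, hi, hmin⟩ := exists_minimal_of_wellFoundedLT (fun j => α j ≠ 0) ⟨j, hj⟩
          exact ⟨i, hi, fun i' hi' => by
            by_contra h
            exact absurd (hmin h hi'.le) (not_le.2 hi')⟩
        rw [Finset.sum_eq_single i, if_pos hi]
        · intro j _ hji
          refine if_neg fun hj => ?_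
          rcases lt_or_gt_of_ne hji with h | h
          · exact hj.1 (hi.2 _ h)
          · exact hi.1 (hj.2 _ h)
        · simp
    rw [hsum, pow_succ']
    exact Ideal.sum_mem _ fun i _ => Ideal.mul_mem_mul
      (Ideal.subset_span ⟨i, rfl⟩) (hg i)

theorem isPrecomplete_pi (ι : Type*) [Fintype ι] :
    IsPrecomplete (Ideal.span {PowerSeries.X} : Ideal (PowerSeries ℂ)) (ι → PowerSeries ℂ) := by
  have hmem : ∀ (m : ℕ) (v : ι → PowerSeries ℂ),
      v ∈ ((Ideal.span {PowerSeries.X} : Ideal (PowerSeries ℂ)) ^ m • ⊤ :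
        Submodule (PowerSeries ℂ) (ι → PowerSeries ℂ)) ↔ ∀ i, PowerSeries.X ^ m ∣ v i := by
    intro m v
    rw [Ideal.span_singleton_pow, Submodule.ideal_span_singleton_smul,
      Submodule.mem_smul_pointwise_iff_exists]
    constructor
    · rintro ⟨w, -, rfl⟩ i
      exact ⟨w i, rfl⟩
    · intro h
      choose w hw using h
      exact ⟨w, trivial, funext fun i => (hw i).symm⟩
  refine ⟨fun f hf => ?_⟩
  have hco : ∀ m k, m ≤ k → ∀ i, ∀ a < m,
      PowerSeries.coeff a (f m i) = PowerSeries.coeff a (f k i) := by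
    intro m k hmk i a ha
    have := (hmem m _).1 (SModEq.sub_mem.1 (hf hmk)) i
    rw [Pi.sub_apply] at this
    have h2 := PowerSeries.X_pow_dvd_iff.1 this a ha
    rwa [map_sub, sub_eq_zero] at h2
  refine ⟨fun i => PowerSeries.mk fun a => PowerSeries.coeff a (f (a + 1) i), fun m => ?_⟩
  rw [SModEq.sub_mem, hmem]
  intro i
  rw [PowerSeries.X_pow_dvd_iff]
  intro a ha
  rw [Pi.sub_apply, map_sub, PowerSeries.coeff_mk, hco (a + 1) m ha i a (Nat.lt_succ_self a),
    sub_self]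

/-- Curve selection in a ring of formal power series. -/
theorem exists_formal_curve (J : Ideal (MvPowerSeries (Fin n) ℂ)) (hJ : ∀ k, ¬ mIdeal n ^ k ≤ J) :
    ∃ φ : MvPowerSeries (Fin n) ℂ →+* PowerSeries ℂ, (∀ f ∈ J, φ f = 0) ∧
      (∀ c, φ (MvPowerSeries.C c) = PowerSeries.C c) ∧
      (∀ j, PowerSeries.constantCoeff (φ (MvPowerSeries.X j)) = 0) ∧
      ∃ i, φ (MvPowerSeries.X i) ≠ 0 := by
  classical
  obtain ⟨P, ⟨hJP, hP⟩, hmax⟩ := set_has_maximal_iff_noetherian.2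
    (inferInstance : IsNoetherian (MvPowerSeries (Fin n) ℂ) (MvPowerSeries (Fin n) ℂ))
    {I : Ideal (MvPowerSeries (Fin n) ℂ) | J ≤ I ∧ ∀ k, ¬ mIdeal n ^ k ≤ I} ⟨J, le_rfl, hJ⟩
  have hsup : ∀ a ∉ P, ∃ k, mIdeal n ^ k ≤ P ⊔ Ideal.span {a} := by
    intro a ha
    by_contra! h
    refine hmax (P ⊔ Ideal.span {a}) ⟨hJP.trans le_sup_left, h⟩
      (lt_of_le_of_ne le_sup_left fun he => ha ?_)
    rw [he]
    exact Ideal.mem_sup_right (Ideal.mem_span_singleton_self a)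
  have hPtop : P ≠ ⊤ := fun h => hP 0 (h ▸ le_top)
  have hPprime : Ideal.IsPrime P := by
    refine ⟨hPtop, fun {a b} hab => ?_⟩
    by_contra! h
    obtain ⟨k, hk⟩ := hsup a h.1
    obtain ⟨l, hl⟩ := hsup b h.2
    refine hP (k + l) ?_
    rw [pow_add]
    refine (Ideal.mul_mono hk hl).trans (Ideal.mul_le.2 fun x hx y hy => ?_)
    obtain ⟨p, hp, x', hx', rfl⟩ := Submodule.mem_sup.1 hx
    obtain ⟨q, hq, y', hy', rfl⟩ := Submodule.mem_sup.1 hy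
    obtain ⟨u, rfl⟩ := Ideal.mem_span_singleton.1 hx'
    obtain ⟨v, rfl⟩ := Ideal.mem_span_singleton.1 hy'
    have e : (p + a * u) * (q + b * v) = p * (q + b * v) + q * (a * u) + a * b * (u * v) := by ring
    rw [e]
    exact P.add_mem (P.add_mem (Ideal.mul_mem_right _ P hp) (Ideal.mul_mem_right _ P hq))
      (Ideal.mul_mem_right _ P hab)
  obtain ⟨i, hi⟩ : ∃ i, MvPowerSeries.X i ∉ P := by
    by_contra! h
    refine hP 1 ?_
    rw [pow_one, mIdeal, Ideal.span_le]
    rintro _ ⟨i, rfl⟩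
    exact h i
  obtain ⟨k, hk⟩ := hsup _ hi
  have hconst : ∀ f ∈ P, MvPowerSeries.constantCoeff f = 0 := by
    intro f hf
    by_contra h
    exact hPtop (Ideal.eq_top_of_isUnit_mem P hf
      (MvPowerSeries.isUnit_iff_constantCoeff.2 (isUnit_iff_ne_zero.2 h)))
  let D := MvPowerSeries (Fin n) ℂ ⧸ P
  let π : MvPowerSeries (Fin n) ℂ →+* D := Ideal.Quotient.mk P
  have hD : IsDomain D := Ideal.Quotient.isDomain P
  let A := PowerSeries ℂ
  have hX : PowerSeries.HasSubst (MvPowerSeries.X i : MvPowerSeries (Fin n) ℂ) :=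
    PowerSeries.HasSubst.X i
  let algD : Algebra A D := (π.comp (PowerSeries.substAlgHom (R := ℂ) hX).toRingHom).toAlgebra
  have hmapX : algebraMap A D PowerSeries.X = π (MvPowerSeries.X i) := by
    change π (PowerSeries.substAlgHom (R := ℂ) hX PowerSeries.X) = _
    rw [PowerSeries.substAlgHom_X]
  have hmapC : ∀ c, algebraMap A D (PowerSeries.C c) = π (MvPowerSeries.C c) := by
    intro c
    change π (PowerSeries.substAlgHom (R := ℂ) hX (PowerSeries.C c)) = _
    rw [PowerSeries.coe_substAlgHom, PowerSeries.subst_C]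
  have hsub : ∀ g ∈ mIdeal n ^ k, ∃ d, π g = π (MvPowerSeries.X i) * d := by
    intro g hg
    obtain ⟨p, hp, x', hx', rfl⟩ := Submodule.mem_sup.1 (hk hg)
    obtain ⟨u, rfl⟩ := Ideal.mem_span_singleton.1 hx'
    refine ⟨π u, ?_⟩
    rw [map_add π, map_mul π, Ideal.Quotient.eq_zero_iff_mem.2 hp, zero_add]
  have hHaus : IsHausdorff (Ideal.span {PowerSeries.X} : Ideal A) D := by
    rw [← IsHausdorff.map_algebraMap_iff (S := D)]
    have hnoeth : IsNoetherianRing D := inferInstance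
    refine IsHausdorff.of_isDomain (R := D)
      (I := Ideal.map (algebraMap A D) (Ideal.span {PowerSeries.X})) ?_
    rw [Ideal.map_span, Set.image_singleton, hmapX, Ne, Ideal.span_singleton_eq_top]
    rintro ⟨u, hu⟩
    obtain ⟨v, hv⟩ := Ideal.Quotient.mk_surjective (I := P) (↑u⁻¹ : D)
    have h1 : π (MvPowerSeries.X i * v - 1) = 0 := by
      rw [map_sub π, map_mul π, map_one π, ← hu]
      change _ * Ideal.Quotient.mk P v - 1 = 0
      rw [hv, Units.mul_inv, sub_self]
    have h2 := hconst _ (Ideal.Quotient.eq_zero_iff_mem.1 h1)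
    simp at h2
  have hPre := isPrecomplete_pi {b // b ∈ degLE n k}
  let f : ({b // b ∈ degLE n k} → A) →ₗ[A] D :=
    Fintype.linearCombination A fun b => π (MvPowerSeries.monomial b.1 1)
  have hf : Function.Surjective f := by
    refine surjective_of_mkQ_comp_surjective (I := (Ideal.span {PowerSeries.X} : Ideal A)) ?_
    intro y
    obtain ⟨d, rfl⟩ := Submodule.mkQ_surjective _ y
    obtain ⟨g, rfl⟩ := Ideal.Quotient.mk_surjective d
    refine ⟨fun b => PowerSeries.C (MvPowerSeries.coeff b.1 g), ?_⟩
    rw [LinearMap.comp_apply, ← sub_eq_zero, ← map_sub, Submodule.mkQ_apply,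
      Submodule.Quotient.mk_eq_zero]
    let g' : MvPowerSeries (Fin n) ℂ := ∑ b : {b // b ∈ degLE n k},
      MvPowerSeries.C (MvPowerSeries.coeff b.1 g) * MvPowerSeries.monomial b.1 1
    have hfg : f (fun b => PowerSeries.C (MvPowerSeries.coeff b.1 g)) = π g' := by
      rw [Fintype.linearCombination_apply, map_sum π]
      refine Finset.sum_congr rfl fun b _ => ?_
      rw [map_mul π, Algebra.smul_def, hmapC]
    have hg' : ∀ α : Fin n →₀ ℕ, α.degree < k →
        MvPowerSeries.coeff α g' = MvPowerSeries.coeff α g := by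
      intro α hα
      rw [map_sum, Finset.sum_eq_single ⟨α, mem_degLE.2 hα.le⟩]
      · rw [MvPowerSeries.coeff_C_mul, MvPowerSeries.coeff_monomial_same, mul_one]
      · intro b _ hb
        rw [MvPowerSeries.coeff_C_mul, MvPowerSeries.coeff_monomial_ne, mul_zero]
        exact fun h => hb (Subtype.ext h.symm)
      · simp
    obtain ⟨d, hd⟩ := hsub (g' - g) (mem_mIdeal_pow k _ fun α hα => by
      rw [map_sub, hg' α hα, sub_self])
    rw [hfg]
    change π g' - π g ∈ _
    rw [← map_sub π, hd, ← hmapX, ← Algebra.smul_def]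
    exact Submodule.smul_mem_smul (Ideal.mem_span_singleton_self _) trivial
  have hfin : Module.Finite A D := Module.Finite.of_surjective f hf
  have hinj : Function.Injective (algebraMap A D) := by
    refine (injective_iff_map_eq_zero _).2 fun a ha => ?_
    by_contra h0
    obtain ⟨m, u, rfl⟩ := IsDiscreteValuationRing.eq_unit_mul_pow_irreducible h0
      PowerSeries.X_prime.irreducible
    rw [map_mul (algebraMap A D), map_pow (algebraMap A D)] at ha
    rcases mul_eq_zero.1 ha with h | h
    · exact ((u.isUnit.map (algebraMap A D)).ne_zero) h
    · have := eq_zero_of_pow_eq_zero h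
      rw [hmapX] at this
      exact hi (Ideal.Quotient.eq_zero_iff_mem.1 this)
  obtain ⟨φ, hφ, hφC, hφX⟩ := exists_ringHom_of_finite hinj
  rw [hmapX] at hφX
  refine ⟨φ.comp π, fun f hf => ?_, fun c => ?_, fun j => ?_, i, fun h => ?_⟩
  · rw [RingHom.comp_apply, Ideal.Quotient.eq_zero_iff_mem.2 (hJP hf), map_zero]
  · rw [RingHom.comp_apply, ← hmapC, hφC]
  · obtain ⟨d, hd⟩ := hsub (MvPowerSeries.X j ^ k)
      (Ideal.pow_mem_pow (Ideal.subset_span (Set.mem_range_self j)) k)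
    have h2 := congrArg (fun x => PowerSeries.constantCoeff (φ x)) hd
    simp only [map_pow, map_mul, hφX, zero_mul] at h2
    exact eq_zero_of_pow_eq_zero h2
  · exact hi (Ideal.Quotient.eq_zero_iff_mem.1 ((map_eq_zero_iff φ hφ).1 h))

end FormalCurve

section Inverse

variable {n : ℕ}

/-- The pairing of power series with finitely supported families. -/
def pairing (f : MvPowerSeries (Fin n) ℂ) : ((Fin n →₀ ℕ) →₀ ℂ) →ₗ[ℂ] ℂ :=
  Finsupp.linearCombination ℂ fun α => MvPowerSeries.coeff α f

lemma pairing_eq_sum (f : MvPowerSeries (Fin n) ℂ) {ψ : (Fin n →₀ ℕ) →₀ ℂ}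
    {S : Finset (Fin n →₀ ℕ)} (h : ψ.support ⊆ S) :
    pairing f ψ = ∑ α ∈ S, MvPowerSeries.coeff α f * ψ α := by
  rw [pairing, Finsupp.linearCombination_apply, Finsupp.sum_of_support_subset _ h _ (by simp)]
  exact Finset.sum_congr rfl fun α _ => mul_comm _ _

/-- Translation of a finitely supported family. -/
def shft (β : Fin n →₀ ℕ) (ψ : (Fin n →₀ ℕ) →₀ ℂ) : (Fin n →₀ ℕ) →₀ ℂ :=
  ψ.comapDomain (fun α => β + α) (add_right_injective β).injOn

lemma shft_apply (β α : Fin n →₀ ℕ) (ψ : (Fin n →₀ ℕ) →₀ ℂ) : shft β ψ α = ψ (β + α) := rfl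

lemma shft_support {β : Fin n →₀ ℕ} {ψ : (Fin n →₀ ℕ) →₀ ℂ} {N : ℕ} (h : ψ.support ⊆ degLE n N) :
    (shft β ψ).support ⊆ degLE n N := by
  intro α hα
  rw [Finsupp.mem_support_iff, shft_apply, ← Finsupp.mem_support_iff] at hα
  have := mem_degLE.1 (h hα)
  rw [map_add] at this
  exact mem_degLE.2 (by omega)

lemma exists_support_subset (ψ : (Fin n →₀ ℕ) →₀ ℂ) : ∃ N, ψ.support ⊆ degLE n N :=
  ⟨ψ.support.sup fun α => α.degree, fun _ hα =>
    mem_degLE.2 (Finset.le_sup (f := fun α : Fin n →₀ ℕ => α.degree) hα)⟩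

lemma pairing_mul (g f : MvPowerSeries (Fin n) ℂ) {ψ : (Fin n →₀ ℕ) →₀ ℂ} {N : ℕ}
    (h : ψ.support ⊆ degLE n N) :
    pairing (g * f) ψ = ∑ β ∈ degLE n N, MvPowerSeries.coeff β g * pairing f (shft β ψ) := by
  classical
  rw [pairing_eq_sum _ h]
  simp_rw [pairing_eq_sum f (shft_support h), Finset.mul_sum]
  rw [← Finset.sum_product']
  have hfib := Finset.sum_fiberwise_eq_sum_filter (degLE n N ×ˢ degLE n N) (degLE n N)
    (fun x : (Fin n →₀ ℕ) × (Fin n →₀ ℕ) => x.1 + x.2)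
    (fun x => MvPowerSeries.coeff x.1 g * (MvPowerSeries.coeff x.2 f * shft x.1 ψ x.2))
  rw [← Finset.sum_filter_add_sum_filter_not (degLE n N ×ˢ degLE n N)
    (fun x => x.1 + x.2 ∈ degLE n N), ← hfib, Finset.sum_eq_zero (s := Finset.filter _ _) ,
    add_zero]
  · refine Finset.sum_congr rfl fun α hα => ?_
    rw [MvPowerSeries.coeff_mul, Finset.sum_mul]
    refine Finset.sum_congr ?_ fun x hx => ?_
    · ext x
      rw [Finset.HasAntidiagonal.mem_antidiagonal, Finset.mem_filter, Finset.mem_product]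
      refine ⟨fun hx => ⟨⟨?_, ?_⟩, hx⟩, fun hx => hx.2⟩ <;>
      · rw [mem_degLE] at hα ⊢
        rw [← hx, map_add] at hα
        omega
    · rw [shft_apply, (Finset.mem_filter.1 hx).2]; ring
  · intro x hx
    rw [shft_apply, Finsupp.notMem_support_iff.1 fun h' => (Finset.mem_filter.1 hx).2 (h h')]
    ring

/-- Curve selection for a translation invariant space of finitely supported families. -/
theorem exists_curve_of_invariant (A : Submodule ℂ ((Fin n →₀ ℕ) →₀ ℂ))
    (hA : ∀ β, ∀ ψ ∈ A, shft β ψ ∈ A)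
    (hne : ∀ k : ℕ, ∃ ψ ∈ A, ψ ≠ 0 ∧ ∀ α : Fin n →₀ ℕ, α.degree < k → ψ α = 0) :
    ∃ γ : Fin n → PowerSeries ℂ, (∀ j, PowerSeries.constantCoeff (γ j) = 0) ∧ (∃ i, γ i ≠ 0) ∧
      ∀ a, cc γ a ∈ A := by
  classical
  let J : Ideal (MvPowerSeries (Fin n) ℂ) :=
    { carrier := {f | ∀ ψ ∈ A, pairing f ψ = 0}
      add_mem' := fun {f g} hf hg ψ hψ => by
        obtain ⟨N, hN⟩ := exists_support_subset ψ
        have h1 := hf ψ hψ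
        have h2 := hg ψ hψ
        rw [pairing_eq_sum _ hN] at h1 h2 ⊢
        simp_rw [map_add, add_mul]
        rw [Finset.sum_add_distrib, h1, h2, add_zero]
      zero_mem' := fun ψ hψ => by
        obtain ⟨N, hN⟩ := exists_support_subset ψ
        rw [pairing_eq_sum _ hN]
        simp
      smul_mem' := fun g f hf ψ hψ => by
        obtain ⟨N, hN⟩ := exists_support_subset ψ
        rw [smul_eq_mul, pairing_mul g f hN]
        exact Finset.sum_eq_zero fun β _ => by rw [hf _ (hA β ψ hψ), mul_zero] }
  have hJ : ∀ k, ¬ mIdeal n ^ k ≤ J := by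
    intro k hk
    obtain ⟨ψ, hψ, h0, hlow⟩ := hne k
    obtain ⟨α, hα⟩ : ∃ α, ψ α ≠ 0 := by
      by_contra! h
      exact h0 (Finsupp.ext h)
    have hm : MvPowerSeries.monomial α (1 : ℂ) ∈ mIdeal n ^ k := by
      refine mem_mIdeal_pow k _ fun β hβ => MvPowerSeries.coeff_monomial_ne (fun h => hα ?_) _
      rw [← h]; exact hlow _ hβ
    have h1 := hk hm ψ hψ
    rw [pairing_eq_sum _ (Finset.Subset.refl _), Finset.sum_eq_single α,
      MvPowerSeries.coeff_monomial_same, one_mul] at h1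
    · exact hα h1
    · intro β _ hβ
      rw [MvPowerSeries.coeff_monomial_ne hβ, zero_mul]
    · intro h
      rw [Finsupp.notMem_support_iff.1 h, mul_zero]
  obtain ⟨φ, hφJ, hφC, hφX, hφi⟩ := exists_formal_curve J hJ
  refine ⟨fun j => φ (MvPowerSeries.X j), hφX, hφi, fun a => ?_⟩
  set γ : Fin n → PowerSeries ℂ := fun j => φ (MvPowerSeries.X j) with hγ
  have hmon : ∀ α : Fin n →₀ ℕ, φ (MvPowerSeries.monomial α 1) = pw γ α := by
    intro α
    rw [MvPowerSeries.monomial_one_eq, Finsupp.prod_fintype _ _ (by simp), map_prod]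
    exact Finset.prod_congr rfl fun j _ => map_pow φ _ _
  have hcoeff : ∀ f, PowerSeries.coeff a (φ f) = pairing f (cc γ a) := by
    intro f
    let g : MvPowerSeries (Fin n) ℂ := ∑ α ∈ degLE n a,
      MvPowerSeries.C (MvPowerSeries.coeff α f) * MvPowerSeries.monomial α 1
    have hg : ∀ α : Fin n →₀ ℕ, α.degree < a + 1 →
        MvPowerSeries.coeff α (f - g) = 0 := by
      intro α hα
      rw [map_sub, map_sum, Finset.sum_eq_single α, MvPowerSeries.coeff_C_mul,
        MvPowerSeries.coeff_monomial_same, mul_one, sub_self]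
      · intro b _ hb
        rw [MvPowerSeries.coeff_C_mul, MvPowerSeries.coeff_monomial_ne hb.symm, mul_zero]
      · intro h
        exact absurd (mem_degLE.2 (Nat.lt_succ_iff.1 hα)) h
    have h1 : φ (f - g) ∈ Ideal.span {PowerSeries.X} ^ (a + 1) := by
      have hle : (mIdeal n).map φ ≤ Ideal.span {PowerSeries.X} := by
        rw [mIdeal, Ideal.map_span, Ideal.span_le]
        rintro _ ⟨_, ⟨j, rfl⟩, rfl⟩
        exact Ideal.mem_span_singleton.2 (PowerSeries.X_dvd_iff.2 (hφX j))
      refine Ideal.pow_right_mono hle _ ?_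
      rw [← Ideal.map_pow]
      exact Ideal.mem_map_of_mem φ (mem_mIdeal_pow _ _ hg)
    rw [Ideal.span_singleton_pow, Ideal.mem_span_singleton, PowerSeries.X_pow_dvd_iff] at h1
    have h2 := h1 a (Nat.lt_succ_self a)
    rw [map_sub, map_sub, sub_eq_zero] at h2
    rw [h2, map_sum, map_sum, pairing_eq_sum f (cc_support γ a)]
    refine Finset.sum_congr rfl fun α _ => ?_
    rw [map_mul, hφC, PowerSeries.coeff_C_mul, hmon, cc_apply hφX]
  by_contra hnot
  obtain ⟨l, hl, hlA⟩ := Submodule.exists_le_ker_of_notMem hnot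
  let f : MvPowerSeries (Fin n) ℂ := fun α => l (Finsupp.single α 1)
  have hfl : pairing f = l := by
    refine Finsupp.lhom_ext' fun α => LinearMap.ext_ring ?_
    simp only [pairing, LinearMap.comp_apply, Finsupp.lsingle_apply,
      Finsupp.linearCombination_single, one_smul]
    rfl
  refine hl ?_
  rw [← hfl, ← hcoeff, hφJ f (fun ψ hψ => by rw [hfl]; exact hlA hψ), map_zero]

end Inverse

section Ultralimit

variable {n : ℕ}

lemma coeff_pw_add (γ : Fin n → PowerSeries ℂ) (a : ℕ) (α β : Fin n →₀ ℕ) :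
    PowerSeries.coeff a (pw γ (β + α)) = ∑ k ∈ Finset.range (a + 1),
      PowerSeries.coeff k (pw γ α) * PowerSeries.coeff (a - k) (pw γ β) := by
  have h : pw γ (β + α) = pw γ α * pw γ β := by
    simp only [pw, Finsupp.add_apply, pow_add, ← Finset.prod_mul_distrib, mul_comm]
  rw [h, PowerSeries.coeff_mul, Finset.Nat.sum_antidiagonal_eq_sum_range_succ_mk]

lemma coeff_pw_single (γ : Fin n → PowerSeries ℂ) (j : Fin n)
    (hj : PowerSeries.constantCoeff (γ j) = 0) (a : ℕ) :
    PowerSeries.coeff a (pw γ (Finsupp.single j a)) = PowerSeries.coeff 1 (γ j) ^ a := by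
  classical
  have h : pw γ (Finsupp.single j a) = γ j ^ a := by
    rw [pw, Finset.prod_eq_single j]
    · rw [Finsupp.single_eq_same]
    · intro b _ hb
      rw [Finsupp.single_eq_of_ne hb, pow_zero]
    · simp
  obtain ⟨δ, hδ⟩ := PowerSeries.X_dvd_iff.2 hj
  rw [h, hδ, mul_pow, PowerSeries.coeff_X_pow_mul', if_pos le_rfl, Nat.sub_self,
    PowerSeries.coeff_zero_eq_constantCoeff_apply, map_pow,
    ← PowerSeries.coeff_zero_eq_constantCoeff_apply, ← PowerSeries.coeff_succ_X_mul]

/-- Combinations of the coefficients of order at most `N` along a formal curve. -/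
def comb (γ : Fin n → PowerSeries ℂ) (N : ℕ) (c : ℕ → ℂ) (α : Fin n →₀ ℕ) : ℂ :=
  ∑ a ∈ Finset.range (N + 1), c a * PowerSeries.coeff a (pw γ α)

lemma comb_add_index (γ : Fin n → PowerSeries ℂ) (N : ℕ) (c : ℕ → ℂ) (α β : Fin n →₀ ℕ) :
    comb γ N c (β + α) = comb γ N (fun k => ∑ i ∈ Finset.range (N + 1 - k),
      c (k + i) * PowerSeries.coeff i (pw γ β)) α := by
  rw [comb, comb]
  simp_rw [coeff_pw_add, Finset.mul_sum, Finset.sum_mul]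
  have := Finset.sum_range_diag_flip (N + 1) fun k i =>
    c (k + i) * PowerSeries.coeff i (pw γ β) * PowerSeries.coeff k (pw γ α)
  rw [← this]
  refine Finset.sum_congr rfl fun a _ => Finset.sum_congr rfl fun k hk => ?_
  rw [Nat.add_sub_cancel' (Nat.lt_succ_iff.1 (Finset.mem_range.1 hk))]
  ring

lemma comb_mono (γ : Fin n → PowerSeries ℂ) {N N' : ℕ} (h : N ≤ N') (c : ℕ → ℂ)
    (α : Fin n →₀ ℕ) : comb γ N c α = comb γ N' (fun a => if a ≤ N then c a else 0) α := by
  rw [comb, comb, ← Finset.sum_subset (Finset.range_mono (Nat.succ_le_succ h))]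
  · refine Finset.sum_congr rfl fun a ha => ?_
    rw [if_pos (Nat.lt_succ_iff.1 (Finset.mem_range.1 ha))]
  · intro a _ ha
    rw [if_neg fun h' => ha (Finset.mem_range.2 (Nat.lt_succ_iff.2 h')), zero_mul]

lemma comb_eq_zero_of_degree {γ : Fin n → PowerSeries ℂ}
    (hγ : ∀ j, PowerSeries.constantCoeff (γ j) = 0) (N : ℕ) (c : ℕ → ℂ) {α : Fin n →₀ ℕ}
    (h : N < α.degree) : comb γ N c α = 0 :=
  Finset.sum_eq_zero fun a ha => by
    rw [coeff_pw_of_lt hγ (lt_of_lt_of_le (Finset.mem_range.1 ha) h), mul_zero]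

lemma exists_comb_ne_zero {γ : Fin n → PowerSeries ℂ}
    (hγ : ∀ j, PowerSeries.constantCoeff (γ j) = 0) {j : Fin n}
    (hj : PowerSeries.coeff 1 (γ j) ≠ 0) {N : ℕ} {c : ℕ → ℂ} (hc : ∃ a ≤ N, c a ≠ 0) :
    ∃ α, comb γ N c α ≠ 0 := by
  classical
  let S := (Finset.range (N + 1)).filter fun a => c a ≠ 0
  have hS : S.Nonempty := by
    obtain ⟨a, ha, hca⟩ := hc
    exact ⟨a, Finset.mem_filter.2 ⟨Finset.mem_range.2 (Nat.lt_succ_iff.2 ha), hca⟩⟩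
  obtain ⟨hb1, hb2⟩ := Finset.mem_filter.1 (S.max'_mem hS)
  refine ⟨Finsupp.single j (S.max' hS), ?_⟩
  rw [comb, Finset.sum_eq_single (S.max' hS), coeff_pw_single γ j (hγ j)]
  · exact mul_ne_zero hb2 (pow_ne_zero _ hj)
  · intro a ha hab
    rcases lt_or_gt_of_ne hab with h | h
    · rw [coeff_pw_of_lt hγ (by rwa [Finsupp.degree_single]), mul_zero]
    · by_contra h0
      refine absurd (S.le_max' a (Finset.mem_filter.2 ⟨ha, fun hca => h0 ?_⟩)) (not_le.2 h)
      rw [hca, zero_mul]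
  · exact fun h => absurd hb1 h

lemma hf_comb (ρ : Sm n) (q : Fin n → ℂ) (γ : Fin n → PowerSeries ℂ) (h : Isotropic ρ q γ)
    (N N' : ℕ) (c c' : ℕ → ℂ) (M : ℕ) (hN : N ≤ M) (hN' : N' ≤ M) :
    ∑ α ∈ degLE n M, ∑ β ∈ degLE n M,
      tc ρ q α β * (comb γ N c α * (starRingEnd ℂ) (comb γ N' c' β)) = 0 := by
  have hsub : ∀ a ≤ M, degLE n a ⊆ degLE n M := fun a ha α hα =>
    mem_degLE.2 ((mem_degLE.1 hα).trans ha)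
  have e : ∀ α β, tc ρ q α β * (comb γ N c α * (starRingEnd ℂ) (comb γ N' c' β)) =
      ∑ a ∈ Finset.range (N + 1), ∑ b ∈ Finset.range (N' + 1), c a * (starRingEnd ℂ) (c' b) *
        (tc ρ q α β * (cc γ a α * (starRingEnd ℂ) (cc γ b β))) := by
    intro α β
    rw [comb, comb, map_sum, Finset.sum_mul_sum, Finset.mul_sum]
    refine Finset.sum_congr rfl fun a _ => ?_
    rw [Finset.mul_sum]
    refine Finset.sum_congr rfl fun b _ => ?_
    rw [cc_apply h.const, cc_apply h.const, map_mul]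
    ring
  simp_rw [e]
  simp_rw [Finset.sum_comm (s := degLE n M) (t := Finset.range (N + 1))]
  simp_rw [Finset.sum_comm (s := degLE n M) (t := Finset.range (N' + 1))]
  refine Finset.sum_eq_zero fun a ha => Finset.sum_eq_zero fun b hb => ?_
  simp_rw [← Finset.mul_sum]
  have ha' : a ≤ M := (Nat.lt_succ_iff.1 (Finset.mem_range.1 ha)).trans hN
  have hb' : b ≤ M := (Nat.lt_succ_iff.1 (Finset.mem_range.1 hb)).trans hN'
  rw [← hf_eq_sum ρ q ((cc_support γ a).trans (hsub a ha')) ((cc_support γ b).trans (hsub b hb')),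
    h.form, mul_zero]

lemma continuous_tc (ρ : Sm n) (α β : Fin n →₀ ℕ) : Continuous fun q => tc ρ q α β :=
  continuous_const.mul (Sm_continuous _)

/-- Some combination of coefficients along a regular curve vanishes to high order. -/
lemma exists_normalized_comb {γ : Fin n → PowerSeries ℂ}
    (hγ : ∀ j, PowerSeries.constantCoeff (γ j) = 0) (hj : ∃ j, PowerSeries.coeff 1 (γ j) ≠ 0)
    (k : ℕ) : ∃ c : ℕ → ℂ, (∀ α : Fin n →₀ ℕ, α.degree < k → comb γ (degLE n k).card c α = 0) ∧
      (∀ α, ‖comb γ (degLE n k).card c α‖ ≤ 1) ∧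
      ∃ α ∈ degLE n (degLE n k).card, ‖comb γ (degLE n k).card c α‖ = 1 := by
  classical
  obtain ⟨j, hj⟩ := hj
  set N := (degLE n k).card with hN
  let L : (Fin (N + 1) → ℂ) →ₗ[ℂ] ({α // α ∈ degLE n k} → ℂ) :=
    Matrix.mulVecLin (Matrix.of fun α a => PowerSeries.coeff (a : ℕ) (pw γ α.1))
  have hker : LinearMap.ker L ≠ ⊥ := by
    refine LinearMap.ker_ne_bot_of_finrank_lt ?_
    rw [Module.finrank_fintype_fun_eq_card, Module.finrank_fintype_fun_eq_card, Fintype.card_coe,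
      Fintype.card_fin]
    exact Nat.lt_succ_self _
  obtain ⟨v, hv, hv0⟩ := Submodule.exists_mem_ne_zero_of_ne_bot hker
  let d : ℕ → ℂ := fun a => if h : a < N + 1 then v ⟨a, h⟩ else 0
  have hd : ∀ α, comb γ N d α = ∑ a : Fin (N + 1), v a * PowerSeries.coeff (a : ℕ) (pw γ α) := by
    intro α
    rw [comb, Finset.sum_range]
    refine Finset.sum_congr rfl fun a _ => ?_
    simp only [d, dif_pos a.2]
  have hlow : ∀ α : Fin n →₀ ℕ, α.degree < k → comb γ N d α = 0 := by
    intro α hα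
    have := congrFun (LinearMap.mem_ker.1 hv) ⟨α, mem_degLE.2 hα.le⟩
    rw [hd]
    refine Eq.trans ?_ this
    simp only [L, Matrix.mulVecLin_apply, Matrix.mulVec, dotProduct, Matrix.of_apply]
    exact Finset.sum_congr rfl fun a _ => mul_comm _ _
  obtain ⟨α, hα⟩ := exists_comb_ne_zero (N := N) (c := d) hγ hj (by
    by_contra! h
    refine hv0 (funext fun a => ?_)
    have := h a (Nat.lt_succ_iff.1 a.2)
    simp only [d, dif_pos a.2] at this
    exact this)
  have hdeg : ∀ α, comb γ N d α ≠ 0 → α ∈ degLE n N := fun α h => mem_degLE.2 (by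
    by_contra h'
    exact h (comb_eq_zero_of_degree hγ N d (not_le.1 h')))
  obtain ⟨α₀, hα₀, hmax⟩ := Finset.exists_max_image (degLE n N) (fun α => ‖comb γ N d α‖)
    ⟨α, hdeg α hα⟩
  have hpos : comb γ N d α₀ ≠ 0 := by
    intro h0
    have := hmax α (hdeg α hα)
    rw [h0, norm_zero] at this
    exact hα (norm_le_zero_iff.1 this)
  have hscale : ∀ α, comb γ N (fun a => (comb γ N d α₀)⁻¹ * d a) α =
      (comb γ N d α₀)⁻¹ * comb γ N d α := by
    intro α
    generalize (comb γ N d α₀)⁻¹ = r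
    rw [comb, comb, Finset.mul_sum]
    exact Finset.sum_congr rfl fun a _ => mul_assoc _ _ _
  refine ⟨fun a => (comb γ N d α₀)⁻¹ * d a, fun α hα => ?_, fun α => ?_, α₀, hα₀, ?_⟩
  · rw [hscale, hlow α hα, mul_zero]
  · rw [hscale, norm_mul, norm_inv, inv_mul_le_one₀ (norm_pos_iff.2 hpos)]
    by_cases h : comb γ N d α = 0
    · rw [h, norm_zero]; exact norm_nonneg _
    · exact hmax α (hdeg α h)
  · rw [hscale, inv_mul_cancel₀ hpos, norm_one]

open Filter in
/-- Isotropic regular curves at nearby points produce a nontrivial isotropic formal curve. -/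
theorem exists_isotropic_of_mem_closure {ρ : Sm n} {p : Fin n → ℂ}
    (hp : p ∈ closure {q | ∃ γ, Isotropic ρ q γ ∧ ∃ j, PowerSeries.coeff 1 (γ j) ≠ 0}) :
    ∃ γ, Isotropic ρ p γ ∧ ∃ i, γ i ≠ 0 := by
  classical
  obtain ⟨U, hU, hUp⟩ := mem_closure_iff_ultrafilter.1 hp
  let G : (Fin n → ℂ) → Fin n → PowerSeries ℂ := fun q =>
    if h : ∃ γ, Isotropic ρ q γ ∧ ∃ j, PowerSeries.coeff 1 (γ j) ≠ 0 then h.choose else 0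
  have hG : ∀ᶠ q in (U : Filter (Fin n → ℂ)),
      Isotropic ρ q (G q) ∧ ∃ j, PowerSeries.coeff 1 (G q j) ≠ 0 := by
    filter_upwards [hU] with q hq
    have hq' : ∃ γ, Isotropic ρ q γ ∧ ∃ j, PowerSeries.coeff 1 (γ j) ≠ 0 := hq
    simp only [G, dif_pos hq']
    exact hq'.choose_spec
  let Q : ℕ → ((Fin n →₀ ℕ) →₀ ℂ) → Prop := fun N ψ => ∃ c : (Fin n → ℂ) → ℕ → ℂ,
    ∀ α, Tendsto (fun q => comb (G q) N (c q) α) U (𝓝 (ψ α))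
  have hmono : ∀ {N N' ψ}, N ≤ N' → Q N ψ → Q N' ψ := by
    rintro N N' ψ h ⟨c, hc⟩
    refine ⟨fun q a => if a ≤ N then c q a else 0, fun α => ?_⟩
    simp_rw [← comb_mono _ h]
    exact hc α
  have hsupp : ∀ {N ψ}, Q N ψ → ψ.support ⊆ degLE n N := by
    rintro N ψ ⟨c, hc⟩ α hα
    rw [mem_degLE]
    by_contra h
    refine Finsupp.mem_support_iff.1 hα (tendsto_nhds_unique (hc α) ?_)
    refine tendsto_const_nhds.congr' ?_
    filter_upwards [hG] with q hq
    exact (comb_eq_zero_of_degree hq.1.const N _ (not_le.1 h)).symm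
  let A : Submodule ℂ ((Fin n →₀ ℕ) →₀ ℂ) :=
    { carrier := {ψ | ∃ N, Q N ψ}
      add_mem' := by
        rintro ψ ψ' ⟨N, hN⟩ ⟨N', hN'⟩
        obtain ⟨c, hc⟩ := hmono (le_max_left N N') hN
        obtain ⟨c', hc'⟩ := hmono (le_max_right N N') hN'
        refine ⟨max N N', fun q a => c q a + c' q a, fun α => ?_⟩
        refine ((hc α).add (hc' α)).congr fun q => ?_
        rw [comb, comb, comb, ← Finset.sum_add_distrib]
        exact Finset.sum_congr rfl fun a _ => (add_mul _ _ _).symm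
      zero_mem' := ⟨0, fun _ _ => 0, fun α => by simp [comb]⟩
      smul_mem' := by
        rintro r ψ ⟨N, c, hc⟩
        refine ⟨N, fun q a => r * c q a, fun α => ((hc α).const_mul r).congr fun q => ?_⟩
        rw [comb, comb, Finset.mul_sum]
        exact Finset.sum_congr rfl fun a _ => (mul_assoc _ _ _).symm }
  have hshift : ∀ β, ∀ ψ ∈ A, shft β ψ ∈ A := by
    rintro β ψ ⟨N, c, hc⟩
    exact ⟨N, fun q k => ∑ i ∈ Finset.range (N + 1 - k),
        c q (k + i) * PowerSeries.coeff i (pw (G q) β),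
      fun α => (hc (β + α)).congr fun q => comb_add_index _ _ _ _ _⟩
  have hiso : ∀ ψ ∈ A, ∀ ψ' ∈ A, hf ρ p ψ ψ' = 0 := by
    rintro ψ ⟨N, hN⟩ ψ' ⟨N', hN'⟩
    obtain ⟨c, hc⟩ := hmono (le_max_left N N') hN
    obtain ⟨c', hc'⟩ := hmono (le_max_right N N') hN'
    rw [hf_eq_sum ρ p (hsupp (hmono (le_max_left N N') hN))
      (hsupp (hmono (le_max_right N N') hN'))]
    refine tendsto_nhds_unique (f := fun q => ∑ α ∈ degLE n (max N N'),
      ∑ β ∈ degLE n (max N N'), tc ρ q α β * (comb (G q) (max N N') (c q) α *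
        (starRingEnd ℂ) (comb (G q) (max N N') (c' q) β))) (l := U) ?_ ?_
    · refine tendsto_finsetSum _ fun α _ => tendsto_finsetSum _ fun β _ => ?_
      exact (((continuous_tc ρ α β).tendsto p).mono_left hUp).mul
        ((hc α).mul ((Complex.continuous_conj.tendsto _).comp (hc' β)))
    · refine tendsto_const_nhds.congr' ?_
      filter_upwards [hG] with q hq
      exact (hf_comb ρ q (G q) hq.1 _ _ _ _ _ le_rfl le_rfl).symm
  have hne : ∀ k : ℕ, ∃ ψ ∈ A, ψ ≠ 0 ∧ ∀ α : Fin n →₀ ℕ, α.degree < k → ψ α = 0 := by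
    intro k
    have hc : ∀ q, ∃ c : ℕ → ℂ, (Isotropic ρ q (G q) ∧ ∃ j, PowerSeries.coeff 1 (G q j) ≠ 0) →
      (∀ α : Fin n →₀ ℕ, α.degree < k → comb (G q) (degLE n k).card c α = 0) ∧
      (∀ α, ‖comb (G q) (degLE n k).card c α‖ ≤ 1) ∧
      ∃ α ∈ degLE n (degLE n k).card, ‖comb (G q) (degLE n k).card c α‖ = 1 := by
      intro q
      by_cases h : Isotropic ρ q (G q) ∧ ∃ j, PowerSeries.coeff 1 (G q j) ≠ 0
      · obtain ⟨c, hc⟩ := exists_normalized_comb h.1.const h.2 k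
        exact ⟨c, fun _ => hc⟩
      · exact ⟨0, fun h' => absurd h' h⟩
    choose c hc using hc
    set N := (degLE n k).card with hN
    have hlim : ∀ α, ∃ x, Tendsto (fun q => comb (G q) N (c q) α) U (𝓝 x) := by
      intro α
      obtain ⟨x, -, hx⟩ := (isCompact_closedBall (0 : ℂ) 1).ultrafilter_le_nhds
        (U.map fun q => comb (G q) N (c q) α) (by
          rw [le_principal_iff]
          change ∀ᶠ q in (U : Filter (Fin n → ℂ)), comb (G q) N (c q) α ∈ _
          filter_upwards [hG] with q hq
          rw [mem_closedBall_zero_iff]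
          exact (hc q hq).2.1 α)
      exact ⟨x, hx⟩
    choose x hx using hlim
    have hxs : ∀ α, x α ≠ 0 → α ∈ degLE n N := by
      intro α hα
      rw [mem_degLE]
      by_contra h
      refine hα (tendsto_nhds_unique (hx α) (tendsto_const_nhds.congr' ?_))
      filter_upwards [hG] with q hq
      exact (comb_eq_zero_of_degree hq.1.const N _ (not_le.1 h)).symm
    refine ⟨Finsupp.onFinset (degLE n N) x hxs, ⟨N, c, hx⟩, fun h0 => ?_, fun α hα => ?_⟩
    · have hx0 : ∀ α, x α = 0 := fun α => DFunLike.congr_fun h0 α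
      have hall : ∀ᶠ q in (U : Filter (Fin n → ℂ)), ∀ α ∈ degLE n N,
          ‖comb (G q) N (c q) α‖ < 1 := by
        rw [Finset.eventually_all]
        intro α _
        have := (hx α).norm
        rw [hx0, norm_zero] at this
        exact this.eventually (gt_mem_nhds one_pos)
      obtain ⟨q, hq1, hq2⟩ := (hall.and hG).exists
      obtain ⟨α, hα, h1⟩ := (hc q hq2).2.2
      exact (hq1 α hα).ne h1
    · rw [Finsupp.onFinset_apply]
      refine tendsto_nhds_unique (hx α) (tendsto_const_nhds.congr' ?_)
      filter_upwards [hG] with q hq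
      exact ((hc q hq).1 α hα).symm
  obtain ⟨γ, hγ, hi, hγA⟩ := exists_curve_of_invariant A hshift hne
  exact ⟨γ, ⟨hγ, fun a b => hiso _ (hγA a) _ (hγA b)⟩, hi⟩

end Ultralimit

section Truncation

variable {n : ℕ}

lemma cmp_aeval_flat {γ : Fin n → PowerSeries ℂ} {p : Fin n → ℂ} {K : ℕ} (hK : 0 < K)
    {w : Fin n → Sm 1} (hw : ∀ j, w j = algebraMap ℂ _ (p j) + trf K (γ j))
    {ρ : Sm n} (h : Isotropic ρ p γ) :
    Flat 0 K (cmp w (MvPolynomial.aeval (zz p) (jet p K ρ))) := by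
  classical
  have hz : ∀ j, cmp w (zz p (Sum.inl j)) = trf K (γ j) := by
    intro j
    change cmp w (co j - algebraMap ℂ _ (p j)) = _
    rw [map_sub, cmp_co, AlgHom.commutes, hw, add_sub_cancel_left]
  have hone : trf K (1 : PowerSeries ℂ) = 1 := by
    rw [trf_apply, Finset.sum_eq_single 0]
    · simp
    · intro b _ hb; simp [PowerSeries.coeff_one, hb]
    · intro h; simp at h; omega
  have hpow : ∀ j a, Flat 0 K (trf K (γ j) ^ a - trf K (γ j ^ a)) := by
    intro j a
    induction a with
    | zero => rw [pow_zero, pow_zero, hone, sub_self]; exact Flat.zero _ _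
    | succ a ih =>
      have h0 : Flat 0 K (trf K (γ j) - trf K (γ j)) := by rw [sub_self]; exact Flat.zero _ _
      rw [pow_succ, pow_succ]
      exact (ih.congr_mul h0).trans (trf_mul K _ _)
  have hprod : ∀ (α : Fin n →₀ ℕ) (s : Finset (Fin n)),
      Flat 0 K (∏ j ∈ s, trf K (γ j) ^ α j - trf K (∏ j ∈ s, γ j ^ α j)) := by
    intro α s
    induction s using Finset.induction_on with
    | empty => rw [Finset.prod_empty, Finset.prod_empty, hone, sub_self]; exact Flat.zero _ _
    | insert a s ha ih =>
      rw [Finset.prod_insert ha, Finset.prod_insert ha]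
      exact ((hpow _ _).congr_mul ih).trans (trf_mul K _ _)
  have hmain : Flat 0 K (cmp w (MvPolynomial.aeval (zz p) (jet p K ρ)) -
      ∑ μ ∈ (jet p K ρ).support, MvPolynomial.coeff μ (jet p K ρ) •
        (trf K (pw γ (lft μ)) * star (trf K (pw γ (rgt μ))))) := by
    conv => arg 3; arg 1; rw [MvPolynomial.as_sum (jet p K ρ)]
    rw [map_sum, map_sum, ← Finset.sum_sub_distrib]
    refine Flat.sum fun μ _ => ?_
    rw [aeval_zz_monomial, map_smul, ← smul_sub, map_mul, cmp_star, map_prod, map_prod]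
    simp only [map_pow, hz]
    refine Flat.smul _ (Flat.congr_mul (hprod (lft μ) _) ?_)
    have hs := (hprod (rgt μ) Finset.univ).star
    rw [star_sub (R := Sm 1)] at hs
    exact hs
  have hsum : Flat 0 K (∑ μ ∈ (jet p K ρ).support, MvPolynomial.coeff μ (jet p K ρ) •
        (trf K (pw γ (lft μ)) * star (trf K (pw γ (rgt μ))))) := by
    have e : ∑ μ ∈ (jet p K ρ).support, MvPolynomial.coeff μ (jet p K ρ) •
        (trf K (pw γ (lft μ)) * star (trf K (pw γ (rgt μ)))) =
        ∑ a ∈ Finset.range K, ∑ b ∈ Finset.range K,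
          (∑ μ ∈ (jet p K ρ).support, MvPolynomial.coeff μ (jet p K ρ) *
      (PowerSeries.coeff a (pw γ (lft μ)) *
        (starRingEnd ℂ) (PowerSeries.coeff b (pw γ (rgt μ))))) • (tt ^ a * star tt ^ b) := by
      simp only [Finset.sum_smul]
      simp_rw [Finset.sum_comm (s := Finset.range K) (t := (jet p K ρ).support)]
      refine Finset.sum_congr rfl fun μ _ => ?_
      rw [trf_apply, trf_apply, star_sum, Finset.sum_mul_sum, Finset.smul_sum]
      refine Finset.sum_congr rfl fun a _ => ?_
      rw [Finset.smul_sum]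
      refine Finset.sum_congr rfl fun b _ => ?_
      rw [star_smul, star_pow, smul_mul_smul_comm, smul_smul]
      rfl
    rw [e]
    refine Flat.sum fun a _ => Flat.sum fun b _ => ?_
    by_cases hab : a + b < K
    · rw [sum_jet h.const ρ p hab, h.form, zero_smul]; exact Flat.zero _ _
    · exact ((flat_tt_mul_star a b).mono (not_lt.1 hab)).smul _
  simpa using hmain.add hsum

lemma iteratedDeriv_polynomial (P : Polynomial ℂ) (k : ℕ) :
    iteratedDeriv k (fun t => P.eval t) 0 = k.factorial * P.coeff k := by
  have h : ∀ k, iteratedDeriv k (fun t => P.eval t) =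
      fun t => (Polynomial.derivative^[k] P).eval t := by
    intro k
    induction k with
    | zero => rw [iteratedDeriv_zero]; rfl
    | succ k ih =>
      rw [iteratedDeriv_succ, ih, Function.iterate_succ_apply']
      funext t
      exact Polynomial.deriv _
  rw [h]
  change (Polynomial.derivative^[k] P).eval 0 = _
  rw [← Polynomial.coeff_zero_eq_eval_zero, Polynomial.coeff_iterate_derivative, zero_add,
    Nat.descFactorial_self, nsmul_eq_mul]

lemma not_finiteTypePt_of_isotropic {r : (Fin n → ℂ) → ℝ} {ρ : Sm n} {p : Fin n → ℂ}
    (hr : ∀ᶠ z in 𝓝 p, ev z ρ = (r z : ℂ)) {γ : Fin n → PowerSeries ℂ} (h : Isotropic ρ p γ)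
    (hγ : ∃ i, γ i ≠ 0) : ¬ FiniteTypePt r p := by
  rintro ⟨M, hM⟩
  obtain ⟨i, hi⟩ := hγ
  obtain ⟨v, hv⟩ : ∃ v, PowerSeries.coeff v (γ i) ≠ 0 := by
    by_contra! h'
    exact hi (PowerSeries.ext h')
  set K := M * v + v + 1 with hK
  have hvK : v < K := by omega
  let P : Fin n → Polynomial ℂ := fun j => PowerSeries.trunc K (γ j)
  let w : Fin n → Sm 1 := fun j => algebraMap ℂ _ (p j) + trf K (γ j)
  have hev : ∀ (z : Fin 1 → ℂ) j, ev z (w j) = p j + (P j).eval (z 0) := by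
    intro z j
    have : ev z (trf K (γ j)) = (P j).eval (z 0) := by
      rw [← Polynomial.eval₂_id]
      simp only [P]
      rw [PowerSeries.eval₂_trunc_eq_sum_range, trf_apply, map_sum]
      refine Finset.sum_congr rfl fun a _ => ?_
      rw [map_smul, map_pow]
      rfl
    rw [map_add, AlgHom.commutes, this]; rfl
  have hP0 : ∀ j, (P j).eval 0 = 0 := by
    intro j
    rw [← Polynomial.coeff_zero_eq_eval_zero, PowerSeries.coeff_trunc, if_pos (by omega),
      PowerSeries.coeff_zero_eq_constantCoeff_apply]
    exact h.const j
  have hord : ∀ j (k : ℕ), iteratedDeriv k (fun t => (p j + (P j).eval t) - p j) 0 =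
      k.factorial * (P j).coeff k := by
    intro j k
    rw [← iteratedDeriv_polynomial]
    congr 1
    funext t
    ring
  have hne : iteratedDeriv v (fun t => (p i + (P i).eval t) - p i) 0 ≠ 0 := by
    rw [hord, PowerSeries.coeff_trunc, if_pos hvK]
    exact mul_ne_zero (by exact_mod_cast v.factorial_ne_zero) hv
  have hcurve : curveOrder (fun t j => p j + (P j).eval t) p ≤ v :=
    (iInf_le _ i).trans (sInf_le ⟨v, hne, rfl⟩)
  have hle := hM (fun t j => p j + (P j).eval t)
    (fun j => analyticAt_const.add (by
      have : Differentiable ℂ fun t => (P j).eval t := (P j).differentiable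
      exact this.analyticAt 0))
    (by funext j; simp only [hP0, add_zero])
    (by
      intro hconst
      refine hne ?_
      have : (fun t => (p i + (P i).eval t) - p i) =ᶠ[𝓝 0] fun _ => 0 := by
        filter_upwards [hconst] with t ht
        rw [show p i + (P i).eval t = p i from congrFun ht i, sub_self]
      rw [this.iteratedDeriv_eq]
      simp)
  have hflat : Flat 0 K (cmp w ρ) := by
    have h1 : Flat (0 : Fin 1 → ℂ) K (cmp w (ρ - MvPolynomial.aeval (zz p) (jet p K ρ))) := by
      refine Flat.cmp ?_
      have : (fun j => ev (0 : Fin 1 → ℂ) (w j)) = p := by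
        funext j; rw [hev, Pi.zero_apply, hP0, add_zero]
      rw [this]
      exact flat_sub_jet p K ρ
    have h2 := cmp_aeval_flat (by omega) (w := w) (fun j => rfl) h
    have := h1.add h2
    rwa [map_sub, sub_add_cancel] at this
  have hvan : ∀ k < K, iteratedFDeriv ℝ k (fun t : ℂ => r fun j => p j + (P j).eval t) 0 = 0 := by
    intro k hk
    let g : ℂ →L[ℝ] (Fin 1 → ℂ) := ContinuousLinearMap.pi fun _ => ContinuousLinearMap.id ℝ ℂ
    have e : (fun t : ℂ => r fun j => p j + (P j).eval t) =ᶠ[𝓝 0]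
        reCLM ∘ ((cmp w ρ : (Fin 1 → ℂ) → ℂ) ∘ g) := by
      have hc : Filter.Tendsto (fun t : ℂ => fun j => p j + (P j).eval t) (𝓝 0) (𝓝 p) := by
        have : Continuous fun t : ℂ => fun j => p j + (P j).eval t :=
          continuous_pi fun j => continuous_const.add (P j).continuous
        have h0 := this.tendsto 0
        simpa only [hP0, add_zero] using h0
      filter_upwards [hc.eventually hr] with t ht
      have : (cmp w ρ : (Fin 1 → ℂ) → ℂ) (g t) = ev (fun j => p j + (P j).eval t) ρ := by
        rw [← ev_apply, ev_cmp]
        congr 2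
        funext j
        exact hev _ _
      simp only [Function.comp_apply, this, ht, reCLM_apply, ofReal_re]
    have hk' : (k : WithTop ℕ∞) ≤ ((⊤ : ℕ∞) : WithTop ℕ∞) :=
      WithTop.coe_le_coe.2 (le_top : (k : ℕ∞) ≤ ⊤)
    rw [(e.iteratedFDeriv ℝ k).eq_of_nhds, ContinuousLinearMap.iteratedFDeriv_comp_left reCLM
      ((Sm_contDiff (cmp w ρ)).comp g.contDiff).contDiffAt hk',
      ContinuousLinearMap.iteratedFDeriv_comp_right g (Sm_contDiff (cmp w ρ)) 0 hk', map_zero,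
      (hflat.mono (Nat.succ_le_of_lt hk)).iteratedFDeriv]
    ext m
    simp
  have hge : (K : ℕ∞) ≤ orderR (fun t => r fun j => p j + (P j).eval t) := by
    refine le_sInf ?_
    rintro _ ⟨k, hk, rfl⟩
    by_contra hlt
    exact hk (hvan k (Nat.cast_lt.1 (not_le.1 hlt)))
  have : (K : ℕ∞) ≤ ((M * v : ℕ) : ℕ∞) := by
    push_cast
    exact hge.trans (hle.trans (by gcongr))
  have := Nat.cast_le.1 this
  omega

end Truncation

section LeviCalculus

variable {n : ℕ}

lemma continuous_ev (f : Sm n) : Continuous fun z => ev z f := Sm_continuous f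

/-- Constant vector fields. -/
def cst (X : Fin n → ℂ) (j : Fin n) : Sm n := algebraMap ℂ _ (X j)

lemma ev_fld_true (X : Fin n → Sm n) (f : Sm n) (z : Fin n → ℂ) :
    ev z (fld X true f) = ∑ j, ev z (X j) * ev z (dl j f) := by
  simp [fld, sum_derivation_apply, map_sum]

lemma ev_D (X : Fin n → ℂ) (f : Sm n) (z : Fin n → ℂ) :
    ev z (fld (cst X) true f) = ∑ j, X j * ev z (dl j f) := by
  rw [ev_fld_true]
  refine Finset.sum_congr rfl fun j _ => ?_
  rw [cst, AlgHom.commutes]; rfl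

lemma ev_DDb (X : Fin n → ℂ) (f : Sm n) (z : Fin n → ℂ) :
    ev z (fld (cst X) true (fld (cst X) false f)) =
      ∑ j, ∑ k, ev z (dl j (db k f)) * X j * (starRingEnd ℂ) (X k) := by
  rw [ev_D]
  refine Finset.sum_congr rfl fun j _ => ?_
  have : fld (cst X) false f = ∑ k, (starRingEnd ℂ) (X k) • db k f := by
    rw [fld, sum_derivation_apply]
    refine Finset.sum_congr rfl fun k _ => ?_
    have : star (cst X k) = algebraMap ℂ (Sm n) ((starRingEnd ℂ) (X k)) := rfl
    rw [this, Derivation.smul_apply, smul_eq_mul, ← Algebra.smul_def]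
  rw [this, map_sum, map_sum, Finset.mul_sum]
  refine Finset.sum_congr rfl fun k _ => ?_
  rw [Derivation.map_smul, map_smul, smul_eq_mul]
  ring

/-- The Levi form of a smooth function, as a real number. -/
def lf (f : Sm n) (X z : Fin n → ℂ) : ℝ := (ev z (fld (cst X) true (fld (cst X) false f))).re

lemma lf_eq (f : Sm n) (X z : Fin n → ℂ) :
    lf f X z = (∑ j, ∑ k, ev z (dl j (db k f)) * X j * (starRingEnd ℂ) (X k)).re := by
  rw [lf, ev_DDb]

lemma lf_add (f g : Sm n) (X z : Fin n → ℂ) : lf (f + g) X z = lf f X z + lf g X z := by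
  simp [lf]

lemma lf_smul (c : ℝ) (f : Sm n) (X z : Fin n → ℂ) : lf ((c : ℂ) • f) X z = c * lf f X z := by
  simp only [lf, Derivation.map_smul, map_smul, smul_eq_mul, re_ofReal_mul]

lemma ev_Db {f : Sm n} (hf : star f = f) (X z : Fin n → ℂ) :
    ev z (fld (cst X) false f) = (starRingEnd ℂ) (ev z (fld (cst X) true f)) := by
  rw [← ev_star, ← Bool.not_false, ← fld_star, hf]

lemma ofReal_re_ev {f : Sm n} (hf : star f = f) (z : Fin n → ℂ) :
    (((ev z f).re : ℝ) : ℂ) = ev z f := by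
  apply Complex.conj_eq_iff_re.1
  rw [← ev_star, hf]

/-- The Levi form of `f * star f` at a zero of `f`. -/
lemma lf_mul_star {f : Sm n} {z : Fin n → ℂ} (h0 : ev z f = 0) (X : Fin n → ℂ) :
    lf (f * star f) X z = normSq (ev z (fld (cst X) true f)) +
      normSq (ev z (fld (cst X) true (star f))) := by
  have hs : ev z (star f) = 0 := by rw [ev_star, h0, map_zero]
  have h1 : ev z (fld (cst X) false (star f)) = (starRingEnd ℂ) (ev z (fld (cst X) true f)) := by
    rw [fld_star, ev_star]; rfl
  have h2 : ev z (fld (cst X) false f) = (starRingEnd ℂ) (ev z (fld (cst X) true (star f))) := by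
    rw [← ev_star, ← Bool.not_false, ← fld_star, star_star]
  rw [lf]
  simp only [Derivation.leibniz, map_add, smul_eq_mul, map_mul, h0, hs, h1, h2, zero_mul, zero_add,
    add_re]
  rw [mul_comm (starRingEnd ℂ _) (ev z (fld (cst X) true (star f))), mul_conj,
    mul_comm (starRingEnd ℂ _), mul_conj, ofReal_re, ofReal_re]

/-- The exponential of a smooth function. -/
def expS (f : Sm n) : Sm n := ⟨fun z => Complex.exp (f.1 z), (Sm_contDiff f).cexp⟩

lemma ev_expS (f : Sm n) (z : Fin n → ℂ) : ev z (expS f) = Complex.exp (ev z f) := rfl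

lemma pd_expS (v : Fin n → ℂ) (f : Sm n) : pd v (expS f) = expS f * pd v f := by
  ext z
  have h := (Sm_differentiable f z).hasFDerivAt.cexp
  rw [pd_apply]
  change fderiv ℝ (fun z => Complex.exp (f.1 z)) z v = _
  rw [h.fderiv]
  rfl

lemma dl_expS (j : Fin n) (f : Sm n) : dl j (expS f) = expS f * dl j f := by
  simp only [dl, Derivation.smul_apply, Derivation.sub_apply, pd_expS, mul_smul_comm, mul_sub]

lemma db_expS (j : Fin n) (f : Sm n) : db j (expS f) = expS f * db j f := by
  simp only [db, Derivation.smul_apply, Derivation.add_apply, pd_expS, mul_smul_comm, mul_add]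

lemma fld_expS (X : Fin n → Sm n) (b : Bool) (f : Sm n) :
    fld X b (expS f) = expS f * fld X b f := by
  cases b
  · simp only [fld, sum_derivation_apply, Derivation.smul_apply, db_expS, Finset.mul_sum,
      smul_eq_mul]
    exact Finset.sum_congr rfl fun j _ => by ring
  · simp only [fld, sum_derivation_apply, Derivation.smul_apply, dl_expS, Finset.mul_sum,
      smul_eq_mul]
    exact Finset.sum_congr rfl fun j _ => by ring

lemma ev_expS_real {f : Sm n} (hf : star f = f) (z : Fin n → ℂ) :
    ev z (expS f) = (Real.exp (ev z f).re : ℝ) := by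
  rw [ev_expS, ← ofReal_re_ev hf z]; simp

lemma lf_expS {f : Sm n} (hf : star f = f) (X z : Fin n → ℂ) :
    lf (expS f) X z = Real.exp (ev z f).re * (lf f X z + normSq (ev z (fld (cst X) true f))) := by
  rw [lf, fld_expS, Derivation.leibniz, map_add, smul_eq_mul, smul_eq_mul, fld_expS, map_mul,
    map_mul, map_mul, ev_Db hf, ev_expS_real hf, mul_left_comm, ← mul_add, re_ofReal_mul,
    mul_comm (starRingEnd ℂ _), mul_conj, add_re, ofReal_re, lf]

/-- Functions equal near a point have the same derivatives there. -/
lemma eventually_pd {f g : Sm n} {z : Fin n → ℂ} (h : ∀ᶠ w in 𝓝 z, ev w f = ev w g)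
    (v : Fin n → ℂ) : ∀ᶠ w in 𝓝 z, ev w (pd v f) = ev w (pd v g) := by
  filter_upwards [h.eventually_nhds] with w hw
  rw [ev_apply, ev_apply, pd_apply, pd_apply]
  have : (f : (Fin n → ℂ) → ℂ) =ᶠ[𝓝 w] g := hw
  rw [this.fderiv_eq]

lemma flat_of_eventually {f : Sm n} {z : Fin n → ℂ} (h : ∀ᶠ w in 𝓝 z, ev w f = 0) (k : ℕ) :
    Flat z k f := by
  induction k generalizing f with
  | zero => trivial
  | succ k ih =>
    refine ⟨h.self_of_nhds, fun v => ih ?_⟩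
    have := eventually_pd (g := 0) (by simpa using h) v
    simpa using this

lemma flat_sub_of_eventually {f g : Sm n} {z : Fin n → ℂ} (h : ∀ᶠ w in 𝓝 z, ev w f = ev w g)
    (k : ℕ) : Flat z k (f - g) :=
  flat_of_eventually (by simpa [sub_eq_zero] using h) k

lemma ev_D_congr {f g : Sm n} {z : Fin n → ℂ} (h : ∀ᶠ w in 𝓝 z, ev w f = ev w g)
    (X : Fin n → ℂ) : ev z (fld (cst X) true f) = ev z (fld (cst X) true g) := by
  rw [ev_D, ev_D]
  refine Finset.sum_congr rfl fun j _ => ?_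
  have := ((flat_sub_of_eventually h 2).dl j).1
  rw [map_sub, map_sub, sub_eq_zero] at this
  rw [this]

lemma lf_congr {f g : Sm n} {z : Fin n → ℂ} (h : ∀ᶠ w in 𝓝 z, ev w f = ev w g)
    (X : Fin n → ℂ) : lf f X z = lf g X z := by
  rw [lf_eq, lf_eq]
  congr 1
  refine Finset.sum_congr rfl fun j _ => Finset.sum_congr rfl fun k _ => ?_
  have := (((flat_sub_of_eventually h 3).db k).dl j).1
  rw [map_sub, map_sub, map_sub, sub_eq_zero] at this
  rw [this]

/-- The coefficient matrix of the Levi form controls it. -/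
def lsz (f : Sm n) (z : Fin n → ℂ) : ℝ := ∑ j, ∑ k, ‖ev z (dl j (db k f))‖

lemma continuous_lsz (f : Sm n) : Continuous (lsz f) :=
  continuous_finsetSum _ fun _ _ => continuous_finsetSum _ fun _ _ => (continuous_ev _).norm

lemma enormSq_nonneg (X : Fin n → ℂ) : 0 ≤ enormSq X := Finset.sum_nonneg fun _ _ => normSq_nonneg _

lemma norm_mul_norm_le_enormSq (X : Fin n → ℂ) (j k : Fin n) : ‖X j‖ * ‖X k‖ ≤ enormSq X := by
  have h : ∀ j, ‖X j‖ ^ 2 ≤ enormSq X := fun j => by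
    rw [← normSq_eq_norm_sq]
    exact Finset.single_le_sum (f := fun j => normSq (X j)) (fun _ _ => normSq_nonneg _)
      (Finset.mem_univ j)
  nlinarith [sq_nonneg (‖X j‖ - ‖X k‖), h j, h k]

lemma abs_form_le (a : Fin n → Fin n → ℂ) (X : Fin n → ℂ) :
    |(∑ j, ∑ k, a j k * X j * (starRingEnd ℂ) (X k)).re| ≤ (∑ j, ∑ k, ‖a j k‖) * enormSq X := by
  refine (abs_re_le_norm _).trans ((norm_sum_le _ _).trans ?_)
  rw [Finset.sum_mul]
  refine Finset.sum_le_sum fun j _ => (norm_sum_le _ _).trans ?_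
  rw [Finset.sum_mul]
  refine Finset.sum_le_sum fun k _ => ?_
  rw [norm_mul, norm_mul, RCLike.norm_conj, mul_assoc]
  exact mul_le_mul_of_nonneg_left (norm_mul_norm_le_enormSq X j k) (norm_nonneg _)

lemma abs_lf_le (f : Sm n) (X z : Fin n → ℂ) : |lf f X z| ≤ lsz f z * enormSq X := by
  rw [lf_eq]; exact abs_form_le _ X

/-- Lower bounds on the Levi form persist nearby. -/
lemma eventually_lf_ge {f : Sm n} {z : Fin n → ℂ} {c c' : ℝ} (hc : c' < c)
    (h : ∀ X, c * enormSq X ≤ lf f X z) : ∀ᶠ w in 𝓝 z, ∀ X, c' * enormSq X ≤ lf f X w := by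
  let d : (Fin n → ℂ) → ℝ := fun w => ∑ j, ∑ k, ‖ev z (dl j (db k f)) - ev w (dl j (db k f))‖
  have hd : Continuous d := continuous_finsetSum _ fun _ _ => continuous_finsetSum _ fun _ _ =>
    (continuous_const.sub (continuous_ev _)).norm
  have h0 : d z = 0 := by simp [d]
  have := hd.tendsto z
  rw [h0] at this
  filter_upwards [this.eventually (gt_mem_nhds (sub_pos.2 hc))] with w hw X
  have h1 := abs_form_le (fun j k => ev z (dl j (db k f)) - ev w (dl j (db k f))) X
  have h2 : (∑ j, ∑ k, (ev z (dl j (db k f)) - ev w (dl j (db k f))) * X j *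
      (starRingEnd ℂ) (X k)).re = lf f X z - lf f X w := by
    rw [lf_eq, lf_eq, ← sub_re, ← Finset.sum_sub_distrib]
    congr 1
    refine Finset.sum_congr rfl fun j _ => ?_
    rw [← Finset.sum_sub_distrib]
    exact Finset.sum_congr rfl fun k _ => by ring
  rw [h2] at h1
  have h3 := (abs_le.1 h1).2
  have h4 : d w * enormSq X ≤ (c - c') * enormSq X :=
    mul_le_mul_of_nonneg_right hw.le (enormSq_nonneg X)
  have h5 := h X
  simp only [d] at h4
  nlinarith

/-- The logarithm of the sum of exponentials. -/
def lse (x y : Sm n) : Sm n :=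
  ⟨fun z => (Real.log (Real.exp (ev z x).re + Real.exp (ev z y).re) : ℝ), by
    have hx : ContDiff ℝ (⊤ : ℕ∞) fun z => (ev z x).re := reCLM.contDiff.comp (Sm_contDiff x)
    have hy : ContDiff ℝ (⊤ : ℕ∞) fun z => (ev z y).re := reCLM.contDiff.comp (Sm_contDiff y)
    exact ofRealCLM.contDiff.comp ((hx.exp.add hy.exp).log fun z => by positivity)⟩

lemma ev_lse (x y : Sm n) (z : Fin n → ℂ) :
    ev z (lse x y) = (Real.log (Real.exp (ev z x).re + Real.exp (ev z y).re) : ℝ) := rfl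

lemma lse_star (x y : Sm n) : star (lse x y) = lse x y := by
  ext z
  exact conj_ofReal _

lemma expS_lse {x y : Sm n} (hx : star x = x) (hy : star y = y) :
    expS (lse x y) = expS x + expS y := by
  ext z
  rw [← ev_apply, ← ev_apply, map_add, ev_expS_real (lse_star x y), ev_expS_real hx,
    ev_expS_real hy, ev_lse, ofReal_re, Real.exp_log (by positivity)]
  push_cast; rfl

lemma lf_lse {x y : Sm n} (hx : star x = x) (hy : star y = y) (X z : Fin n → ℂ) :
    Real.exp (ev z x).re * lf x X z + Real.exp (ev z y).re * lf y X z ≤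
      (Real.exp (ev z x).re + Real.exp (ev z y).re) * lf (lse x y) X z := by
  have h1 := lf_expS (lse_star x y) X z
  have h2 : expS (lse x y) * fld (cst X) true (lse x y) =
      expS x * fld (cst X) true x + expS y * fld (cst X) true y := by
    rw [← fld_expS, ← fld_expS, ← fld_expS, expS_lse hx hy, map_add]
  have h3 := congrArg (ev z) h2
  rw [map_mul, map_add, map_mul, map_mul, ev_expS_real (lse_star x y), ev_expS_real hx,
    ev_expS_real hy] at h3
  rw [expS_lse hx hy, lf_add, lf_expS hx, lf_expS hy] at h1
  have hE : Real.exp (ev z (lse x y)).re = Real.exp (ev z x).re + Real.exp (ev z y).re := by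
    rw [ev_lse, ofReal_re, Real.exp_log (by positivity)]
  rw [hE] at h1 h3
  generalize hA : Real.exp (ev z x).re = a at *
  generalize hB : Real.exp (ev z y).re = b at *
  have ha : 0 < a := by rw [← hA]; positivity
  have hb : 0 < b := by rw [← hB]; positivity
  generalize ev z (fld (cst X) true (lse x y)) = s at *
  generalize ev z (fld (cst X) true x) = u at *
  generalize ev z (fld (cst X) true y) = v at *
  have hs : (a + b) * normSq s ≤ a * normSq u + b * normSq v := by
    have e1 := congrArg Complex.re h3
    have e2 := congrArg Complex.im h3
    simp only [re_ofReal_mul, im_ofReal_mul, add_re, add_im] at e1 e2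
    rw [normSq_apply, normSq_apply, normSq_apply]
    have k1 : (a + b) * ((a + b) * (s.re * s.re + s.im * s.im)) ≤
        (a + b) * (a * (u.re * u.re + u.im * u.im) + b * (v.re * v.re + v.im * v.im)) := by
      have : (a + b) * ((a + b) * (s.re * s.re + s.im * s.im)) =
          (a * u.re + b * v.re) ^ 2 + (a * u.im + b * v.im) ^ 2 := by
        rw [← e1, ← e2]; ring
      rw [this]
      nlinarith [mul_nonneg (mul_nonneg ha.le hb.le) (sq_nonneg (u.re - v.re)),
        mul_nonneg (mul_nonneg ha.le hb.le) (sq_nonneg (u.im - v.im))]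
    exact le_of_mul_le_mul_left k1 (by positivity)
  nlinarith

end LeviCalculus

section PropertyP

open Metric

variable {n : ℕ}

/-- There is a smooth function with values in `(-1, 1)` and Levi form larger than `M` on `T`. -/
def PM (T : Set (Fin n → ℂ)) (M : ℝ) : Prop :=
  ∃ l : Sm n, star l = l ∧ (∀ z ∈ T, |(ev z l).re| < 1) ∧
    ∃ M' > M, ∀ z ∈ T, ∀ X, M' * enormSq X ≤ lf l X z

lemma exists_lf_bound (f : Sm n) {T : Set (Fin n → ℂ)} (hT : IsCompact T) :
    ∃ C, 0 ≤ C ∧ ∀ z ∈ T, ∀ X, |lf f X z| ≤ C * enormSq X := by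
  obtain ⟨C, hC⟩ := hT.exists_bound_of_continuousOn (continuous_lsz f).continuousOn
  refine ⟨max C 0, le_max_right _ _, fun z hz X => (abs_lf_le f X z).trans ?_⟩
  exact mul_le_mul_of_nonneg_right ((Real.le_norm_self _).trans ((hC z hz).trans (le_max_left _ _)))
    (enormSq_nonneg X)

lemma ev_smul_re (c : ℝ) (f : Sm n) (z : Fin n → ℂ) :
    (ev z ((c : ℂ) • f)).re = c * (ev z f).re := by
  rw [map_smul, smul_eq_mul, re_ofReal_mul]

lemma star_smul_real (c : ℝ) {f : Sm n} (hf : star f = f) :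
    star ((c : ℂ) • f) = (c : ℂ) • f := by
  rw [star_smul, hf]
  congr 1
  exact conj_ofReal c

lemma weighted_bound {a b Lx Ly L C M M' E : ℝ} (hE : 0 ≤ E)
    (hab : 0 < a + b) (h : a * Lx + b * Ly ≤ (a + b) * L) (hy : M' * E ≤ Ly)
    (ha : 0 ≤ a) (hb : 0 ≤ b) (hx : |Lx| ≤ C * E)
    (hsmall : a * (C + |(M + M') / 2|) ≤ b * ((M' - M) / 2)) : (M + M') / 2 * E ≤ L := by
  have h1 := (abs_le.1 hx).1
  have h2 := le_abs_self ((M + M') / 2)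
  refine le_of_mul_le_mul_left (le_trans ?_ h) hab
  have k1 : a * (-(C * E)) ≤ a * Lx := mul_le_mul_of_nonneg_left h1 ha
  have k2 : b * (M' * E) ≤ b * Ly := mul_le_mul_of_nonneg_left hy hb
  have k3 := mul_le_mul_of_nonneg_right hsmall hE
  have k4 : a * ((M + M') / 2) * E ≤ a * |(M + M') / 2| * E :=
    mul_le_mul_of_nonneg_right (mul_le_mul_of_nonneg_left h2 ha) hE
  nlinarith

lemma PM_of_lse {T : Set (Fin n → ℂ)} (hT : IsCompact T) {x y : Sm n} (hx : star x = x)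
    (hy : star y = y) {M M' s δ : ℝ} (hM : M < M') (hs : s < 1) (hδ : 0 < δ)
    (hxs : ∀ z ∈ T, |(ev z x).re| ≤ s) (hys : ∀ z ∈ T, (ev z y).re ≤ s)
    (h1 : ∀ z ∈ T, (∀ X, M' * enormSq X ≤ lf x X z) ∨ (ev z x).re + δ ≤ (ev z y).re)
    (h2 : ∀ z ∈ T, (∀ X, M' * enormSq X ≤ lf y X z) ∨ (ev z y).re + δ ≤ (ev z x).re) :
    PM T M := by
  obtain ⟨C, hC0, hC⟩ := exists_lf_bound x hT
  obtain ⟨C', hC0', hC'⟩ := exists_lf_bound y hT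
  obtain ⟨β, hβ0, hβ1, hβ2⟩ : ∃ β : ℝ, 0 < β ∧ Real.log 2 < β * (1 - s) ∧
      Real.exp (-(β * δ)) * (max C C' + |(M + M') / 2|) < (M' - M) / 2 := by
    have e1 : ∀ᶠ β : ℝ in Filter.atTop, 0 < β := Filter.eventually_gt_atTop 0
    have e2 : ∀ᶠ β : ℝ in Filter.atTop, Real.log 2 < β * (1 - s) :=
      (Filter.tendsto_id.atTop_mul_const (sub_pos.2 hs)).eventually_gt_atTop _
    have e3 : Filter.Tendsto (fun β : ℝ => Real.exp (-(β * δ)) * (max C C' + |(M + M') / 2|))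
        Filter.atTop (𝓝 (0 * (max C C' + |(M + M') / 2|))) :=
      (Real.tendsto_exp_neg_atTop_nhds_zero.comp
        (Filter.tendsto_id.atTop_mul_const hδ)).mul_const _
    rw [zero_mul] at e3
    have e4 := e3.eventually (gt_mem_nhds (show 0 < (M' - M) / 2 by linarith))
    obtain ⟨β, h⟩ := (e1.and (e2.and e4)).exists
    exact ⟨β, h⟩
  have hbx := star_smul_real β hx
  have hby := star_smul_real β hy
  refine ⟨((β⁻¹ : ℝ) : ℂ) • lse ((β : ℂ) • x) ((β : ℂ) • y), star_smul_real _ (lse_star _ _),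
    fun z hz => ?_, (M + M') / 2, by linarith, fun z hz X => ?_⟩
  · rw [ev_smul_re, ev_lse, ofReal_re, ev_smul_re, ev_smul_re]
    have hxz := abs_le.1 (hxs z hz)
    have hyz := hys z hz
    set a := (ev z x).re
    set b := (ev z y).re
    have l1 : β * a ≤ Real.log (Real.exp (β * a) + Real.exp (β * b)) := by
      rw [Real.le_log_iff_exp_le (by positivity)]
      exact le_add_of_nonneg_right (Real.exp_pos _).le
    have l2 : Real.log (Real.exp (β * a) + Real.exp (β * b)) ≤ Real.log 2 + β * s := by
      rw [Real.log_le_iff_le_exp (by positivity), Real.exp_add, Real.exp_log two_pos, two_mul]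
      exact add_le_add (Real.exp_le_exp.2 (mul_le_mul_of_nonneg_left hxz.2 hβ0.le))
        (Real.exp_le_exp.2 (mul_le_mul_of_nonneg_left hyz hβ0.le))
    rw [inv_mul_eq_div, abs_lt, lt_div_iff₀ hβ0, div_lt_iff₀ hβ0]
    constructor <;> nlinarith
  · have h := lf_lse hbx hby X z
    rw [ev_smul_re, ev_smul_re, lf_smul, lf_smul] at h
    rw [lf_smul]
    have hE := enormSq_nonneg X
    have hCz := hC z hz X
    have hCz' := hC' z hz X
    generalize hA : Real.exp (β * (ev z x).re) = a at *
    generalize hB : Real.exp (β * (ev z y).re) = b at *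
    have ha : 0 < a := by rw [← hA]; positivity
    have hb : 0 < b := by rw [← hB]; positivity
    have h' : a * lf x X z + b * lf y X z ≤
        (a + b) * (β⁻¹ * lf (lse ((β : ℂ) • x) ((β : ℂ) • y)) X z) := by
      have : 0 < β⁻¹ := by positivity
      have := mul_le_mul_of_nonneg_left h this.le
      have e : ∀ u v : ℝ, β⁻¹ * (u * (β * v)) = u * v := fun u v => by field_simp
      rw [mul_add, e, e] at this
      linarith
    have small : ∀ {u v D : ℝ}, 0 ≤ D → D ≤ max C C' → u + δ ≤ v →
        Real.exp (β * u) * (D + |(M + M') / 2|) ≤ Real.exp (β * v) * ((M' - M) / 2) := by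
      intro u v D hD0 hD huv
      have : Real.exp (β * u) ≤ Real.exp (β * v) * Real.exp (-(β * δ)) := by
        rw [← Real.exp_add]; exact Real.exp_le_exp.2 (by nlinarith)
      calc _ ≤ Real.exp (β * v) * Real.exp (-(β * δ)) * (max C C' + |(M + M') / 2|) := by
            gcongr
        _ ≤ _ := by rw [mul_assoc]; exact mul_le_mul_of_nonneg_left hβ2.le (Real.exp_pos _).le
    rcases h1 z hz with g1 | g1
    · rcases h2 z hz with g2 | g2
      · have k1 := mul_le_mul_of_nonneg_left (g1 X) ha.le
        have k2 := mul_le_mul_of_nonneg_left (g2 X) hb.le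
        refine le_of_mul_le_mul_left (le_trans ?_ h') (add_pos ha hb)
        nlinarith [mul_nonneg (add_pos ha hb).le hE]
      · have := small hC0' (le_max_right _ _) g2
        rw [hA, hB] at this
        rw [add_comm (a * _), add_comm a] at h'
        exact weighted_bound hE (add_pos hb ha) h' (g1 X) hb.le ha.le hCz' this
    · rcases h2 z hz with g2 | g2
      · have := small hC0 (le_max_left _ _) g1
        rw [hA, hB] at this
        exact weighted_bound hE (add_pos ha hb) h' (g2 X) ha.le hb.le hCz this
      · linarith

/-- A bump function as a smooth function. -/
def bmp {q : Fin n → ℂ} (f : ContDiffBump q) : Sm n :=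
  ⟨fun z => (f z : ℝ), ofRealCLM.contDiff.comp f.contDiff⟩

lemma ev_bmp {q : Fin n → ℂ} (f : ContDiffBump q) (z : Fin n → ℂ) : ev z (bmp f) = (f z : ℝ) := rfl

lemma bmp_star {q : Fin n → ℂ} (f : ContDiffBump q) : star (bmp f) = bmp f := by
  ext z; exact conj_ofReal _

lemma ev_mul_re {f g : Sm n} (hf : star f = f) (hg : star g = g) (z : Fin n → ℂ) :
    (ev z (f * g)).re = (ev z f).re * (ev z g).re := by
  rw [map_mul, ← ofReal_re_ev hf, ← ofReal_re_ev hg, ← ofReal_mul, ofReal_re, ofReal_re, ofReal_re]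

lemma PM_glue {T : Set (Fin n → ℂ)} (hT : IsCompact T) {q : Fin n → ℂ} {r R M : ℝ} (hr : 0 < r)
    (hR : r < R) (h1 : PM (T \ ball q r) M) (h2 : ∀ M', PM (T ∩ closedBall q R) M') : PM T M := by
  rcases T.eq_empty_or_nonempty with rfl | hne
  · simpa using h1
  obtain ⟨l, hl, hl1, M₁, hM₁, hlM⟩ := h1
  set M₂ := (M + M₁) / 2 with hM₂
  let O : Set (Fin n → ℂ) := interior {z | |(ev z l).re| < 1 ∧ ∀ X, M₂ * enormSq X ≤ lf l X z}
  have hO : T \ ball q r ⊆ O := by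
    intro z hz
    rw [mem_interior_iff_mem_nhds]
    have e1 : ∀ᶠ w in 𝓝 z, |(ev w l).re| < 1 :=
      (continuous_abs.comp (continuous_re.comp (continuous_ev l))).tendsto z
        |>.eventually (gt_mem_nhds (hl1 z hz))
    exact e1.and (eventually_lf_ge (by linarith) (hlM z hz))
  obtain ⟨r', hr', hTr'⟩ : ∃ r' < r, T \ O ⊆ ball q r' := by
    refine exists_lt_subset_ball (hT.diff isOpen_interior).isClosed fun z hz => ?_
    by_contra h
    exact hz.2 (hO ⟨hz.1, h⟩)
  set r₀ := max r' (r / 2) with hr₀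
  have hr₀0 : 0 < r₀ := lt_of_lt_of_le (by linarith) (le_max_right _ _)
  have hr₀r : r₀ < r := max_lt hr' (by linarith)
  set r₁ := (2 * r₀ + r) / 3 with hr₁
  set r₂ := (r₀ + 2 * r) / 3 with hr₂
  set r₃ := (r + R) / 2 with hr₃
  let f₁ : ContDiffBump q := ⟨r₀, r₁, hr₀0, by linarith⟩
  let f₂ : ContDiffBump q := ⟨r₂, r, by linarith, by linarith⟩
  let f₃ : ContDiffBump q := ⟨r₃, R, by linarith, by linarith⟩
  let x : Sm n := (1 - bmp f₁) * l
  have hf1 : star (1 - bmp f₁) = 1 - bmp f₁ := by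
    rw [star_sub (R := Sm n), star_one, bmp_star]
  have hx : star x = x := by
    simp only [x]; rw [star_mul' (R := Sm n), hf1, hl]
  have hxval : ∀ z, (ev z x).re = (1 - f₁ z) * (ev z l).re := by
    intro z
    simp only [x]
    rw [ev_mul_re hf1 hl, map_sub, map_one, ev_bmp, sub_re, one_re, ofReal_re]
  have hx1 : ∀ z ∈ T, |(ev z x).re| < 1 := by
    intro z hz
    rw [hxval]
    by_cases hzO : z ∈ O
    · have h := (interior_subset hzO).1
      rw [abs_mul, abs_of_nonneg (sub_nonneg.2 f₁.le_one)]
      have h0 := f₁.nonneg (x := z)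
      have h0' := f₁.le_one (x := z)
      nlinarith [abs_nonneg (ev z l).re]
    · have : z ∈ closedBall q f₁.rIn :=
        closedBall_subset_closedBall (le_max_left _ _) (ball_subset_closedBall (hTr' ⟨hz, hzO⟩))
      rw [f₁.one_of_mem_closedBall this, sub_self, zero_mul, abs_zero]
      exact one_pos
  obtain ⟨z₀, hz₀, hmax⟩ := hT.exists_isMaxOn hne
    (continuous_abs.comp (continuous_re.comp (continuous_ev x))).continuousOn
  set s₀ := |(ev z₀ x).re| with hs₀
  have hs₀1 : s₀ < 1 := hx1 z₀ hz₀
  have hs₀0 : 0 ≤ s₀ := abs_nonneg _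
  have hxs : ∀ z ∈ T, |(ev z x).re| ≤ s₀ := fun z hz => hmax hz
  set b := (1 + s₀) / 2 with hb
  set ε := (1 - s₀) / 8 with hε
  have hε0 : 0 < ε := by linarith
  let χ : Sm n := algebraMap ℂ _ ((-3 : ℝ) : ℂ) + ((b + 3 : ℝ) : ℂ) • bmp f₂
  have hχ : star χ = χ := by
    simp only [χ]
    rw [star_add (R := Sm n), star_smul_real _ (bmp_star _)]
    congr 1
    ext z; exact conj_ofReal _
  obtain ⟨Cχ, hCχ0, hCχ⟩ := exists_lf_bound χ hT
  obtain ⟨g, hg, hg1, M₃, hM₃, hgM⟩ := h2 ((M₂ + Cχ) / ε)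
  let k : Sm n := bmp f₃ * g
  have hk : star k = k := by
    simp only [k]; rw [star_mul' (R := Sm n), bmp_star, hg]
  let y : Sm n := χ + (ε : ℂ) • k
  have hy : star y = y := by
    simp only [y]; rw [star_add (R := Sm n), hχ, star_smul_real _ hk]
  have hk1 : ∀ z ∈ T, |(ev z k).re| ≤ 1 := by
    intro z hz
    simp only [k]
    rw [ev_mul_re (bmp_star _) hg, ev_bmp, ofReal_re, abs_mul, abs_of_nonneg f₃.nonneg]
    by_cases h : z ∈ closedBall q R
    · have := hg1 z ⟨hz, h⟩
      have h0 := f₃.nonneg (x := z)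
      have h0' := f₃.le_one (x := z)
      nlinarith [abs_nonneg (ev z g).re]
    · have : f₃ z = 0 := f₃.zero_of_le_dist (le_of_lt (by simpa using h))
      rw [this, zero_mul]; exact zero_le_one
  have hyval : ∀ z, (ev z y).re = -3 + (b + 3) * f₂ z + ε * (ev z k).re := by
    intro z
    simp only [y, χ]
    rw [map_add, map_add, add_re, add_re, ev_smul_re, ev_smul_re, ev_bmp, ofReal_re,
      AlgHom.commutes]
    rfl
  refine PM_of_lse hT hx hy (M := M) (M' := M₂) (s := b + ε) (δ := 3 * ε) (by linarith)
    (by linarith) (by linarith) (fun z hz => (hxs z hz).trans (by linarith)) (fun z hz => ?_)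
    (fun z hz => ?_) (fun z hz => ?_)
  · rw [hyval]
    have h0' := f₂.le_one (x := z)
    have := (abs_le.1 (hk1 z hz)).2
    nlinarith
  · by_cases hd : dist z q ≤ r₁
    · right
      rw [hyval, f₂.one_of_mem_closedBall (show z ∈ closedBall q r₂ from
        mem_closedBall.2 (hd.trans (by linarith)))]
      have := (abs_le.1 (hk1 z hz)).1
      have := (abs_le.1 (hxs z hz)).2
      nlinarith
    · left
      intro X
      have hzO : z ∈ O := by
        by_contra h
        have := mem_ball.1 (hTr' ⟨hz, h⟩)
        have := le_max_left r' (r / 2)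
        exact hd (by linarith)
      have : lf x X z = lf l X z := by
        refine lf_congr ?_ X
        have : ∀ᶠ w in 𝓝 z, r₁ < dist w q :=
          (continuous_id.dist continuous_const).tendsto z |>.eventually (lt_mem_nhds (not_le.1 hd))
        filter_upwards [this] with w hw
        simp only [x]
        rw [map_mul, map_sub, map_one, ev_bmp, f₁.zero_of_le_dist (le_of_lt hw)]
        simp
      rw [this]
      exact (interior_subset hzO).2 X
  · by_cases hd : dist z q < r₃
    · left
      intro X
      have : lf k X z = lf g X z := by
        refine lf_congr ?_ X
        have : ∀ᶠ w in 𝓝 z, dist w q < r₃ :=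
          (continuous_id.dist continuous_const).tendsto z |>.eventually (gt_mem_nhds hd)
        filter_upwards [this] with w hw
        simp only [k]
        rw [map_mul, ev_bmp, f₃.one_of_mem_closedBall (mem_closedBall.2 (le_of_lt hw))]
        simp
      simp only [y]
      rw [lf_add, lf_smul, this]
      have e1 := (abs_le.1 (hCχ z hz X)).1
      have e2 := hgM z ⟨hz, mem_closedBall.2 (by linarith)⟩ X
      have e3 : M₂ + Cχ ≤ ε * M₃ := by
        have := (div_lt_iff₀ hε0).1 hM₃
        linarith
      have e4 := mul_le_mul_of_nonneg_right e3 (enormSq_nonneg X)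
      have e5 := mul_le_mul_of_nonneg_left e2 hε0.le
      nlinarith
    · right
      rw [hyval, f₂.zero_of_le_dist (show r ≤ dist z q by linarith)]
      have := (abs_le.1 (hk1 z hz)).2
      have := (abs_le.1 (hxs z hz)).1
      nlinarith

end PropertyP

section Minimal

open Metric

variable {n : ℕ}

lemma PM_open {T : Set (Fin n → ℂ)} {M : ℝ} (h : PM T M) :
    ∃ O, IsOpen O ∧ T ⊆ O ∧ ∀ T' ⊆ O, PM T' M := by
  obtain ⟨l, hl, hl1, M₁, hM₁, hlM⟩ := h
  refine ⟨interior {z | |(ev z l).re| < 1 ∧ ∀ X, (M + M₁) / 2 * enormSq X ≤ lf l X z},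
    isOpen_interior, fun z hz => ?_, fun T' hT' => ⟨l, hl, fun z hz => ?_, (M + M₁) / 2,
      by linarith, fun z hz => ?_⟩⟩
  · rw [mem_interior_iff_mem_nhds]
    have e1 : ∀ᶠ w in 𝓝 z, |(ev w l).re| < 1 :=
      (continuous_abs.comp (continuous_re.comp (continuous_ev l))).tendsto z
        |>.eventually (gt_mem_nhds (hl1 z hz))
    exact e1.and (eventually_lf_ge (by linarith) (hlM z hz))
  · exact (interior_subset (hT' hz)).1
  · exact (interior_subset (hT' hz)).2

lemma exists_minimal_not_PM {K : Set (Fin n → ℂ)} {M : ℝ} (hK : IsCompact K) (h : ¬ PM K M) :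
    ∃ T ⊆ K, IsCompact T ∧ ¬ PM T M ∧ ∀ T' ⊆ T, IsCompact T' → ¬ PM T' M → T ⊆ T' := by
  obtain ⟨T, hTK, hT⟩ := zorn_superset_nonempty {T | IsCompact T ∧ ¬ PM T M} (by
    intro c hc hch hne
    refine ⟨⋂₀ c, ⟨?_, fun hPM => ?_⟩, fun s hs => Set.sInter_subset_of_mem hs⟩
    · obtain ⟨s, hs⟩ := hne
      exact (hc hs).1.of_isClosed_subset (isClosed_sInter fun t ht => (hc ht).1.isClosed)
        (Set.sInter_subset_of_mem hs)
    · obtain ⟨O, hO, hsub, hP⟩ := PM_open hPM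
      have hne' : Nonempty c := hne.to_subtype
      have hdir : Directed (· ⊇ ·) (fun s : c => (s : Set (Fin n → ℂ))) := by
        intro a b
        rcases hch.total a.2 b.2 with h | h
        · exact ⟨a, subset_rfl, h⟩
        · exact ⟨b, h, subset_rfl⟩
      obtain ⟨s, hs⟩ := exists_subset_nhds_of_isCompact (V := fun s : c => (s : Set (Fin n → ℂ)))
        hdir (fun s => (hc s.2).1) (U := O) (fun x hx => hO.mem_nhds (hsub (by
          rwa [Set.sInter_eq_iInter])))
      exact (hc s.2).2 (hP _ hs)) K ⟨hK, h⟩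
  exact ⟨T, hTK, hT.1.1, hT.1.2, fun T' hT' h1 h2 => hT.2 ⟨h1, h2⟩ hT'⟩

lemma continuous_lf (f : Sm n) (z : Fin n → ℂ) : Continuous fun X => lf f X z := by
  simp only [lf_eq]
  refine continuous_re.comp (continuous_finsetSum _ fun j _ => continuous_finsetSum _ fun k _ => ?_)
  exact (continuous_const.mul (continuous_apply j)).mul (continuous_conj.comp (continuous_apply k))

lemma lf_homog (f : Sm n) (t : ℝ) (X z : Fin n → ℂ) :
    lf f ((t : ℂ) • X) z = t ^ 2 * lf f X z := by
  rw [lf_eq, lf_eq, ← re_ofReal_mul, Finset.mul_sum]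
  congr 1
  refine Finset.sum_congr rfl fun j _ => ?_
  rw [Finset.mul_sum]
  refine Finset.sum_congr rfl fun k _ => ?_
  simp only [Pi.smul_apply, smul_eq_mul, map_mul, conj_ofReal]
  push_cast; ring

lemma enormSq_le (X : Fin n → ℂ) : enormSq X ≤ n * ‖X‖ ^ 2 := by
  unfold enormSq
  calc _ ≤ ∑ _j : Fin n, ‖X‖ ^ 2 := Finset.sum_le_sum fun j _ => by
        rw [normSq_eq_norm_sq]
        exact pow_le_pow_left₀ (norm_nonneg _) (norm_le_pi_norm X j) 2
    _ = _ := by simp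

lemma lf_ge_of_sphere {f : Sm n} {z : Fin n → ℂ} (h : ∀ X, ‖X‖ = 1 → 0 < lf f X z) :
    ∃ c > 0, ∀ X, c * enormSq X ≤ lf f X z := by
  obtain ⟨m, hm, hmin⟩ := (isCompact_sphere (0 : Fin n → ℂ) 1).exists_forall_le'
    (f := fun X => lf f X z) (continuous_lf f z).continuousOn (a := 0)
    (fun X hX => h X (by simpa using hX))
  refine ⟨m / (n + 1), by positivity, fun X => ?_⟩
  by_cases hX : X = 0
  · subst hX
    simp [lf_eq, enormSq]
  have hX' : 0 < ‖X‖ := norm_pos_iff.2 hX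
  have e := lf_homog f ‖X‖ (((‖X‖⁻¹ : ℝ) : ℂ) • X) z
  rw [smul_smul, ← ofReal_mul, mul_inv_cancel₀ hX'.ne', ofReal_one, one_smul] at e
  have k := hmin (((‖X‖⁻¹ : ℝ) : ℂ) • X) (by
    rw [mem_sphere_zero_iff_norm, norm_smul, norm_real, Real.norm_eq_abs,
      abs_of_pos (inv_pos.2 hX'), inv_mul_cancel₀ hX'.ne'])
  rw [e, div_mul_eq_mul_div, div_le_iff₀ (by positivity)]
  have := enormSq_le X
  have k2 := mul_le_mul_of_nonneg_left k (sq_nonneg ‖X‖)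
  have hn : (0 : ℝ) ≤ n := Nat.cast_nonneg n
  nlinarith [sq_nonneg ‖X‖]

lemma PM_local {T : Set (Fin n → ℂ)} {f : Sm n} (hf : star f = f) (h0 : ∀ z ∈ T, ev z f = 0)
    {q : Fin n → ℂ} (h : ∀ X, ‖X‖ = 1 → 0 < lf f X q) :
    ∃ R > 0, ∀ M, PM (T ∩ closedBall q R) M := by
  obtain ⟨c, hc, hlf⟩ := lf_ge_of_sphere h
  obtain ⟨R, hR, hb⟩ := nhds_basis_closedBall.eventually_iff.1
    (eventually_lf_ge (show c / 2 < c by linarith) hlf)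
  refine ⟨R, hR, fun M => ?_⟩
  obtain ⟨A, hA, hAM⟩ : ∃ A : ℝ, 0 < A ∧ M < A * (c / 2) := by
    refine ⟨(|M| + 1) / (c / 2), by positivity, ?_⟩
    rw [div_mul_cancel₀ _ (by positivity)]
    linarith [le_abs_self M]
  refine ⟨(A : ℂ) • f, star_smul_real A hf, fun z hz => ?_, A * (c / 2), hAM, fun z hz X => ?_⟩
  · rw [ev_smul_re, h0 z hz.1]; simp
  · rw [lf_smul, mul_assoc]
    exact mul_le_mul_of_nonneg_left (hb hz.2 X) hA.le

lemma exists_null_vector {T : Set (Fin n → ℂ)} {ρ : Sm n} (hρ : star ρ = ρ)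
    (h0 : ∀ z ∈ T, ev z ρ = 0) {q : Fin n → ℂ} (hq : q ∈ T)
    (h : ∀ R > 0, ∃ M, ¬ PM (T ∩ closedBall q R) M) :
    ∃ X ≠ 0, (∀ f : Sm n, (∀ z ∈ T, ev z f = 0) → ev q (fld (cst X) true f) = 0) ∧
      lf ρ X q ≤ 0 := by
  by_contra! hcon
  let G : Set (Sm n) := {g | star g = g ∧ (∀ z ∈ T, ev z g = 0) ∧ ∀ X, 0 ≤ lf g X q}
  have key : ∃ g ∈ G, ∀ X ∈ sphere (0 : Fin n → ℂ) 1, 0 < lf (ρ + g) X q := by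
    refine (isCompact_sphere (0 : Fin n → ℂ) 1).induction_on
      (p := fun S => ∃ g ∈ G, ∀ X ∈ S, 0 < lf (ρ + g) X q) ?_ ?_ ?_ ?_
    · refine ⟨0, ⟨star_zero _, fun z _ => map_zero _, fun X => ?_⟩, fun X hX => hX.elim⟩
      simp [lf]
    · rintro s t hst ⟨g, hg, hgt⟩
      exact ⟨g, hg, fun X hX => hgt X (hst hX)⟩
    · rintro s t ⟨g, hg, hgs⟩ ⟨g', hg', hgt⟩
      refine ⟨g + g', ⟨?_, fun z hz => ?_, fun X => ?_⟩, fun X hX => ?_⟩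
      · rw [star_add (R := Sm n), hg.1, hg'.1]
      · rw [map_add, hg.2.1 z hz, hg'.2.1 z hz, add_zero]
      · rw [lf_add]; exact add_nonneg (hg.2.2 X) (hg'.2.2 X)
      · rw [lf_add, lf_add]
        rcases hX with hX | hX
        · have := hgs X hX
          rw [lf_add] at this
          linarith [hg'.2.2 X]
        · have := hgt X hX
          rw [lf_add] at this
          linarith [hg.2.2 X]
    · intro X hX
      have hX0 : X ≠ 0 := by
        rintro rfl
        simp at hX
      obtain ⟨g, hg, hgX⟩ : ∃ g ∈ G, 0 < lf (ρ + g) X q := by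
        by_cases hf : ∀ f : Sm n, (∀ z ∈ T, ev z f = 0) → ev q (fld (cst X) true f) = 0
        · refine ⟨0, ⟨star_zero _, fun z _ => map_zero _, fun X => ?_⟩, ?_⟩
          · simp [lf]
          · rw [add_zero]; exact hcon X hX0 hf
        · push Not at hf
          obtain ⟨f, hf0, hfX⟩ := hf
          have hpos : 0 < lf (f * star f) X q := by
            rw [lf_mul_star (hf0 q hq)]
            exact add_pos_of_pos_of_nonneg (normSq_pos.2 hfX) (normSq_nonneg _)
          obtain ⟨A, hA, hAM⟩ : ∃ A : ℝ, 0 < A ∧ |lf ρ X q| < A * lf (f * star f) X q := by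
            refine ⟨(|lf ρ X q| + 1) / lf (f * star f) X q, by positivity, ?_⟩
            rw [div_mul_cancel₀ _ hpos.ne']
            linarith
          refine ⟨(A : ℂ) • (f * star f), ⟨?_, fun z hz => ?_, fun Y => ?_⟩, ?_⟩
          · apply star_smul_real
            rw [star_mul' (R := Sm n), star_star, mul_comm]
          · rw [map_smul, map_mul, hf0 z hz, zero_mul, smul_zero]
          · rw [lf_smul, lf_mul_star (hf0 q hq)]
            exact mul_nonneg hA.le (add_nonneg (normSq_nonneg _) (normSq_nonneg _))
          · rw [lf_add, lf_smul]
            linarith [neg_abs_le (lf ρ X q)]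
      refine ⟨{Y | 0 < lf (ρ + g) Y q}, mem_nhdsWithin_of_mem_nhds
        ((isOpen_lt continuous_const (continuous_lf (ρ + g) q)).mem_nhds hgX), g, hg,
        fun Y hY => hY⟩
  obtain ⟨g, hg, hgX⟩ := key
  obtain ⟨R, hR, hP⟩ := PM_local (T := T) (f := ρ + g) (by rw [star_add (R := Sm n), hρ, hg.1])
    (fun z hz => by rw [map_add, h0 z hz, hg.2.1 z hz, add_zero]) (q := q)
    (fun X hX => hgX X (by simpa using hX))
  obtain ⟨M, hM⟩ := h R hR
  exact hM (hP M)

/-- A compact set violating Property (P) contains a compact set all of whose points carry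
nonzero tangential null vectors. -/
lemma exists_null_set {K : Set (Fin n → ℂ)} {M : ℝ} (hK : IsCompact K) (h : ¬ PM K M)
    {ρ : Sm n} (hρ : star ρ = ρ) (h0 : ∀ z ∈ K, ev z ρ = 0) :
    ∃ T ⊆ K, T.Nonempty ∧ ∀ q ∈ T, ∃ X ≠ 0,
      (∀ f : Sm n, (∀ z ∈ T, ev z f = 0) → ev q (fld (cst X) true f) = 0) ∧ lf ρ X q ≤ 0 := by
  obtain ⟨T, hTK, hT, hTM, hmin⟩ := exists_minimal_not_PM hK h
  refine ⟨T, hTK, ?_, fun q hq => ?_⟩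
  · by_contra hne
    rw [Set.not_nonempty_iff_eq_empty] at hne
    subst hne
    exact hTM ⟨0, star_zero _, fun z hz => hz.elim, M + 1, by linarith, fun z hz => hz.elim⟩
  · refine exists_null_vector hρ (fun z hz => h0 z (hTK hz)) hq fun R hR => ?_
    by_contra! hP
    refine hTM (PM_glue hT (half_pos hR) (half_lt_self hR) ?_ hP)
    by_contra hN
    have := hmin _ Set.sdiff_subset (hT.diff isOpen_ball) hN hq
    exact this.2 (mem_ball_self (half_pos hR))

end Minimal

section KernelSection

open Matrix ComplexOrder

variable {n : ℕ}

lemma det_mul_conjTranspose_ne_zero_iff {r : ℕ} (A : Matrix (Fin r) (Fin n) ℂ) :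
    (A * Aᴴ).det ≠ 0 ↔ LinearIndependent ℂ A.row := by
  rw [← Matrix.vecMul_injective_iff, ne_eq, ← Matrix.exists_vecMul_eq_zero_iff, not_iff_comm]
  constructor
  · intro h
    by_contra! hv
    refine h fun x y hxy => sub_eq_zero.1 ?_
    by_contra hne
    refine hv _ hne ((Matrix.vecMul_self_mul_conjTranspose_eq_zero A _).2 ?_)
    rw [Matrix.sub_vecMul]
    exact sub_eq_zero.2 hxy
  · rintro ⟨v, hv, h0⟩ hinj
    refine hv (hinj ?_)
    have := (Matrix.vecMul_self_mul_conjTranspose_eq_zero A v).1 h0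
    simpa using this

/-- A smooth section of the kernel of a family of rows that is nonzero at some point. -/
lemma exists_kernel_section {T : Set (Fin n → ℂ)} (hT : T.Nonempty) (𝓡 : Set (Fin n → Sm n))
    (h : ∀ q ∈ T, ∃ X : Fin n → ℂ, X ≠ 0 ∧ ∀ R ∈ 𝓡, ∑ j, ev q (R j) * X j = 0) :
    ∃ X : Fin n → Sm n, (∀ q ∈ T, ∀ R ∈ 𝓡, ∑ j, ev q (R j) * ev q (X j) = 0) ∧
      ∃ q ∈ T, ∃ j, ev q (X j) ≠ 0 := by
  let val (q : Fin n → ℂ) : (Fin n → Sm n) → (Fin n → ℂ) := fun R j => ev q (R j)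
  let S (q : Fin n → ℂ) : Submodule ℂ (Fin n → ℂ) := Submodule.span ℂ (val q '' 𝓡)
  obtain ⟨q₀, hq₀, hmax⟩ : ∃ q₀ ∈ T, ∀ q ∈ T, Module.finrank ℂ (S q) ≤ Module.finrank ℂ (S q₀) := by
    have hfin : ((fun q => Module.finrank ℂ (S q)) '' T).Finite := by
      refine (Set.finite_Iic n).subset ?_
      rintro _ ⟨q, -, rfl⟩
      simpa using Submodule.finrank_le (S q)
    obtain ⟨m, ⟨q₀, hq₀, rfl⟩, hm⟩ := Set.exists_max_image _ id hfin (hT.image _)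
    exact ⟨q₀, hq₀, fun q hq => hm _ ⟨q, hq, rfl⟩⟩
  obtain ⟨f, hf, hspan, hind⟩ := Submodule.exists_fun_fin_finrank_span_eq ℂ (val q₀ '' 𝓡)
  choose E hE hEf using hf
  obtain ⟨v, hv, hv0⟩ := h q₀ hq₀
  let A (q : Fin n → ℂ) : Matrix (Fin (Module.finrank ℂ (S q₀))) (Fin n) ℂ := fun i => val q (E i)
  let D : Sm n := ((Matrix.of E) * (Matrix.of E)ᴴ).det
  let w : Fin n → Sm n := fun j => algebraMap ℂ _ (v j)
  let Y : Fin n → Sm n :=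
    ((Matrix.of E)ᴴ * ((Matrix.of E) * (Matrix.of E)ᴴ).adjugate) *ᵥ ((Matrix.of E) *ᵥ w)
  have hA (q) : (Matrix.of E).map ((ev q : Sm n →ₐ[ℂ] ℂ) : Sm n →+* ℂ) = A q := rfl
  have hAc (q) : (Matrix.of E)ᴴ.map ((ev q : Sm n →ₐ[ℂ] ℂ) : Sm n →+* ℂ) = (A q)ᴴ := rfl
  have hAA (q) : ((Matrix.of E) * (Matrix.of E)ᴴ).map ((ev q : Sm n →ₐ[ℂ] ℂ) : Sm n →+* ℂ) =
      A q * (A q)ᴴ := by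
    rw [Matrix.map_mul, hA, hAc]
  have hD (q) : ev q D = (A q * (A q)ᴴ).det := by
    rw [← hAA]
    exact RingHom.map_det ((ev q : Sm n →ₐ[ℂ] ℂ) : Sm n →+* ℂ) _
  have hw (q) : ((ev q : Sm n →ₐ[ℂ] ℂ) : Sm n →+* ℂ) ∘ w = v := by
    ext j
    exact AlgHom.commutes (ev q : Sm n →ₐ[ℂ] ℂ) (v j)
  have hY (q) (j) : ev q (Y j) = (((A q)ᴴ * (A q * (A q)ᴴ).adjugate) *ᵥ (A q *ᵥ v)) j := by
    have e1 := RingHom.map_mulVec ((ev q : Sm n →ₐ[ℂ] ℂ) : Sm n →+* ℂ)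
      ((Matrix.of E)ᴴ * ((Matrix.of E) * (Matrix.of E)ᴴ).adjugate) ((Matrix.of E) *ᵥ w) j
    have e2 : ((ev q : Sm n →ₐ[ℂ] ℂ) : Sm n →+* ℂ) ∘ ((Matrix.of E) *ᵥ w) = A q *ᵥ v := by
      ext i
      have := RingHom.map_mulVec ((ev q : Sm n →ₐ[ℂ] ℂ) : Sm n →+* ℂ) (Matrix.of E) w i
      rw [hA, hw] at this
      exact this
    have e3 : ((Matrix.of E) * (Matrix.of E)ᴴ).adjugate.map ((ev q : Sm n →ₐ[ℂ] ℂ) : Sm n →+* ℂ) =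
        (A q * (A q)ᴴ).adjugate := by
      rw [← hAA]
      exact RingHom.map_adjugate ((ev q : Sm n →ₐ[ℂ] ℂ) : Sm n →+* ℂ) _
    rw [e2, Matrix.map_mul, hAc, e3] at e1
    exact e1
  have hX (q) (j) : ev q (D * (D * w j - Y j)) = (A q * (A q)ᴴ).det *
      (((A q * (A q)ᴴ).det • v - ((A q)ᴴ * (A q * (A q)ᴴ).adjugate) *ᵥ (A q *ᵥ v)) j) := by
    rw [map_mul, map_sub, map_mul, hY, hD, Pi.sub_apply, Pi.smul_apply, smul_eq_mul]
    congr 3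
  have hmul (q) : A q *ᵥ ((A q * (A q)ᴴ).det • v -
      ((A q)ᴴ * (A q * (A q)ᴴ).adjugate) *ᵥ (A q *ᵥ v)) = 0 := by
    rw [Matrix.mulVec_sub, Matrix.mulVec_mulVec, ← Matrix.mul_assoc, Matrix.mul_adjugate,
      Matrix.mulVec_smul, Matrix.smul_mulVec, Matrix.one_mulVec, sub_self]
  refine ⟨fun j => D * (D * w j - Y j), fun q hq R hR => ?_, q₀, hq₀, ?_⟩
  · simp only [hX]
    by_cases hd : (A q * (A q)ᴴ).det = 0
    · simp [hd]
    have hli := (det_mul_conjTranspose_ne_zero_iff (A q)).1 hd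
    have hle : Submodule.span ℂ (Set.range (A q).row) ≤ S q := by
      rw [Submodule.span_le]
      rintro _ ⟨i, rfl⟩
      exact Submodule.subset_span ⟨E i, hE i, rfl⟩
    have heq := Submodule.eq_of_le_of_finrank_le hle (by
      rw [finrank_span_eq_card hli, Fintype.card_fin]
      exact hmax q hq)
    have hmem : val q R ∈ Submodule.span ℂ (Set.range (A q).row) := by
      rw [heq]
      exact Submodule.subset_span ⟨R, hR, rfl⟩
    set y := (A q * (A q)ᴴ).det • v -
      ((A q)ᴴ * (A q * (A q)ᴴ).adjugate) *ᵥ (A q *ᵥ v) with hy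
    have hdot : ∀ x ∈ Submodule.span ℂ (Set.range (A q).row), x ⬝ᵥ y = 0 := by
      intro x hx
      induction hx using Submodule.span_induction with
      | mem x hx =>
        obtain ⟨i, rfl⟩ := hx
        exact congrFun (hmul q) i
      | zero => exact zero_dotProduct _
      | add x z _ _ hx hz => rw [add_dotProduct, hx, hz, add_zero]
      | smul c x _ hx => rw [smul_dotProduct, hx, smul_zero]
    have e := hdot _ hmem
    have e' : ∑ j, ev q (R j) * y j = 0 := e
    simp_rw [mul_left_comm _ (A q * (A q)ᴴ).det]
    rw [← Finset.mul_sum, e', mul_zero]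
  · have hd : (A q₀ * (A q₀)ᴴ).det ≠ 0 := by
      rw [det_mul_conjTranspose_ne_zero_iff]
      have : (A q₀).row = f := funext hEf
      rw [this]
      exact hind
    have hAv : A q₀ *ᵥ v = 0 := funext fun i => hv0 _ (hE i)
    obtain ⟨j, hj⟩ := Function.ne_iff.1 hv
    refine ⟨j, ?_⟩
    simp only [hX]
    rw [hAv, Matrix.mulVec_zero, sub_zero]
    exact mul_ne_zero hd (mul_ne_zero hd hj)

end KernelSection

section BadPoint

variable {n : ℕ}

/-- The sesquilinear Levi form as a function of two vectors. -/
def bf (f : Sm n) (z X Y : Fin n → ℂ) : ℂ :=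
  ∑ j, ∑ k, ev z (dl j (db k f)) * X j * (starRingEnd ℂ) (Y k)

lemma lf_eq_bf (f : Sm n) (X z : Fin n → ℂ) : lf f X z = (bf f z X X).re := lf_eq f X z

lemma bf_swap {f : Sm n} (hf : star f = f) (z X Y : Fin n → ℂ) :
    bf f z Y X = (starRingEnd ℂ) (bf f z X Y) := by
  simp only [bf, map_sum, map_mul, conj_conj]
  rw [Finset.sum_comm]
  refine Finset.sum_congr rfl fun j _ => Finset.sum_congr rfl fun k _ => ?_
  have e : star (dl j (db k f)) = dl k (db j f) := by
    rw [dl_db, ← dl_star, ← db_star, hf]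
  rw [← ev_star, e]
  ring

lemma bf_add_smul (f : Sm n) (z X Z : Fin n → ℂ) (t : ℂ) :
    bf f z (X + t • Z) (X + t • Z) = bf f z X X + (starRingEnd ℂ) t * bf f z X Z +
      t * bf f z Z X + t * (starRingEnd ℂ) t * bf f z Z Z := by
  simp only [bf, Finset.mul_sum, ← Finset.sum_add_distrib]
  refine Finset.sum_congr rfl fun j _ => Finset.sum_congr rfl fun k _ => ?_
  simp only [Pi.add_apply, Pi.smul_apply, smul_eq_mul, map_add, map_mul]
  ring

lemma bf_eq_zero_of_null {f : Sm n} (hf : star f = f) {z X Z : Fin n → ℂ} (h0 : lf f X z ≤ 0)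
    (h : ∀ t : ℂ, 0 ≤ lf f (X + t • Z) z) : bf f z X Z = 0 := by
  by_contra hb
  set b := bf f z X Z with hbd
  have hb' : 0 < normSq b := normSq_pos.2 hb
  set m := lf f Z z with hm
  have key : ∀ s : ℝ, 0 ≤ -(2 * s) * normSq b + s ^ 2 * normSq b * m := by
    intro s
    have k := h (((-s : ℝ) : ℂ) * b)
    rw [lf_eq_bf, bf_add_smul, bf_swap hf z X Z, ← hbd] at k
    have e1 : (starRingEnd ℂ) (((-s : ℝ) : ℂ) * b) * b = ((-s * normSq b : ℝ) : ℂ) := by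
      rw [map_mul, conj_ofReal, mul_assoc, mul_comm _ b, mul_conj, ofReal_mul]
    have e2 : ((-s : ℝ) : ℂ) * b * (starRingEnd ℂ) b = ((-s * normSq b : ℝ) : ℂ) := by
      rw [mul_assoc, mul_conj, ofReal_mul]
    have e3 : ((-s : ℝ) : ℂ) * b * (starRingEnd ℂ) (((-s : ℝ) : ℂ) * b) =
        ((s ^ 2 * normSq b : ℝ) : ℂ) := by
      rw [mul_conj, normSq_mul, normSq_ofReal]
      congr 1; ring
    rw [e1, e2, e3, add_re, add_re, add_re, ofReal_re, re_ofReal_mul, ← lf_eq_bf, ← lf_eq_bf,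
      ← hm] at k
    linarith
  have k := key (1 / (|m| + 1))
  have hp : 0 < |m| + 1 := by positivity
  have hs : 0 < 1 / (|m| + 1) := by positivity
  have hs1 : 1 / (|m| + 1) * m ≤ 1 := by
    rw [div_mul_eq_mul_div, one_mul, div_le_one hp]
    linarith [le_abs_self m]
  have := mul_le_mul_of_nonneg_left hs1 (mul_pos hs hb').le
  nlinarith [mul_pos hs hb']

lemma PscAt.lf_nonneg {ρ : Sm n} {q : Fin n → ℂ} (h : PscAt ρ q) (h0 : ev q ρ = 0)
    {Z : Fin n → ℂ} (hZ : ∑ j, Z j * ev q (dl j ρ) = 0) : 0 ≤ lf ρ Z q := by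
  obtain ⟨C, -, hC⟩ := h
  have := hC.self_of_nhds Z
  rw [h0, hZ] at this
  simpa [lf_eq] using this

/-- If Property (P) fails for a compact subset `K` of a pseudoconvex hypersurface, some point
of `K` carries a smooth formal isotropic curve. -/
theorem exists_isotropic_of_not_PM {K : Set (Fin n → ℂ)} {M : ℝ} (hK : IsCompact K)
    (h : ¬ PM K M) {ρ : Sm n} (hρ : star ρ = ρ) (h0 : ∀ z ∈ K, ev z ρ = 0)
    (hd : ∀ z ∈ K, ∃ i, ev z (dl i ρ) ≠ 0) (hpsc : ∀ z ∈ K, PscAt ρ z) :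
    ∃ q ∈ K, ∃ γ, Isotropic ρ q γ ∧ ∃ j, PowerSeries.coeff 1 (γ j) ≠ 0 := by
  obtain ⟨T, hTK, hT, hnull⟩ := exists_null_set hK h hρ h0
  let 𝓡 : Set (Fin n → Sm n) :=
    {R | ∃ f : Sm n, (∀ z ∈ T, ev z f = 0) ∧ R = fun j => dl j f} ∪
      {R | ∃ i k, R = fun j => dl j (db k ρ) * star (dl i ρ) - dl j (db i ρ) * star (dl k ρ)}
  obtain ⟨X, hX, q, hq, hXq⟩ := exists_kernel_section hT 𝓡 (by
    intro q hq
    obtain ⟨X, hX0, htan, hX⟩ := hnull q hq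
    refine ⟨X, hX0, ?_⟩
    rintro _ (⟨f, hf, rfl⟩ | ⟨i, k, rfl⟩)
    · have := htan f hf
      rw [ev_D] at this
      simpa only [mul_comm] using this
    · have hXt : ∑ j, X j * ev q (dl j ρ) = 0 := by
        have := htan ρ fun z hz => h0 z (hTK hz)
        rwa [ev_D] at this
      let Z : Fin n → ℂ := fun j =>
        (if j = k then ev q (dl i ρ) else 0) - (if j = i then ev q (dl k ρ) else 0)
      have hZt : ∑ j, Z j * ev q (dl j ρ) = 0 := by
        simp only [Z, sub_mul, ite_mul, zero_mul, Finset.sum_sub_distrib, Finset.sum_ite_eq',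
          Finset.mem_univ, if_true]
        ring
      have hb := bf_eq_zero_of_null hρ (Z := Z) hX fun t =>
        (hpsc q (hTK hq)).lf_nonneg (h0 q (hTK hq)) (by
          simp only [Pi.add_apply, Pi.smul_apply, smul_eq_mul, add_mul, mul_assoc,
            Finset.sum_add_distrib, hXt, ← Finset.mul_sum, hZt, mul_zero, add_zero])
      rw [← hb, bf]
      refine Finset.sum_congr rfl fun j _ => ?_
      have e : ∀ a, (starRingEnd ℂ) (Z a) = (if a = k then ev q (star (dl i ρ)) else 0) -
          (if a = i then ev q (star (dl k ρ)) else 0) := by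
        intro a
        simp only [Z, map_sub, ev_star]
        split_ifs <;> simp
      simp only [e, mul_sub, mul_ite, mul_zero, Finset.sum_sub_distrib, Finset.sum_ite_eq',
        Finset.mem_univ, if_true, map_sub, map_mul]
      ring)
  have htan : ∀ f : Sm n, (∀ q ∈ T, ev q f = 0) → ∀ q ∈ T, ev q (fld X true f) = 0 := by
    intro f hf q hq
    rw [ev_fld_true]
    simpa only [mul_comm] using hX q hq _ (Or.inl ⟨f, hf, rfl⟩)
  have hnul : ∀ q ∈ T, ∑ j, ∑ k,
      ev q (dl j (db k ρ)) * ev q (X j) * (starRingEnd ℂ) (ev q (X k)) = 0 := by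
    intro q hq
    obtain ⟨i, hi⟩ := hd q (hTK hq)
    have hXt := htan ρ (fun z hz => h0 z (hTK hz)) q hq
    rw [ev_fld_true] at hXt
    let b : Fin n → ℂ := fun k => ∑ j, ev q (dl j (db k ρ)) * ev q (X j)
    have hb : ∀ k, b k * (starRingEnd ℂ) (ev q (dl i ρ)) =
        b i * (starRingEnd ℂ) (ev q (dl k ρ)) := by
      intro k
      have := hX q hq _ (Or.inr ⟨i, k, rfl⟩)
      simp only [map_sub, map_mul, ev_star, sub_mul, Finset.sum_sub_distrib] at this
      rw [sub_eq_zero] at this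
      simp only [b, Finset.sum_mul]
      convert this using 2 <;> ring
    have e : ∑ j, ∑ k, ev q (dl j (db k ρ)) * ev q (X j) * (starRingEnd ℂ) (ev q (X k)) =
        ∑ k, b k * (starRingEnd ℂ) (ev q (X k)) := by
      rw [Finset.sum_comm]
      simp only [b, Finset.sum_mul]
    have hi' : (starRingEnd ℂ) (ev q (dl i ρ)) ≠ 0 := by simpa using hi
    refine mul_right_cancel₀ hi' ?_
    rw [e, zero_mul, Finset.sum_mul]
    calc _ = b i * (starRingEnd ℂ) (∑ k, ev q (X k) * ev q (dl k ρ)) := by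
          rw [map_sum, Finset.mul_sum]
          refine Finset.sum_congr rfl fun k _ => ?_
          rw [mul_right_comm, hb, map_mul]
          ring
      _ = 0 := by rw [hXt, map_zero, mul_zero]
  exact ⟨q, hTK hq, exists_isotropic (fun a b => polB_pow_eq_zero hρ
    (fun z hz => h0 z (hTK hz)) htan hnul (fun z hz => hpsc z (hTK hz)) hq a b) hXq⟩

end BadPoint

section Projection

open Metric Filter

variable {n : ℕ}

/-- Points near a regular zero of `r` are at distance `O(|r|)` from the zero set. -/
lemma exists_zero_near {E : Type*} [NormedAddCommGroup E] [NormedSpace ℝ E] {r : E → ℝ}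
    {r' : E →L[ℝ] ℝ} {q v : E} (hr : HasStrictFDerivAt r r' q) (hc : Continuous r)
    (h0 : r q = 0) (hv : 0 < r' v) :
    ∃ C, 0 ≤ C ∧ ∀ U ∈ 𝓝 q, ∀ᶠ z in 𝓝 q, ∃ p ∈ U, r p = 0 ∧ ‖p - z‖ ≤ C * |r z| := by
  set c := r' v / 2 with hcd
  have hc0 : 0 < c := half_pos hv
  set ε := c / (‖v‖ + 1) with hε
  have hvn : 0 < ‖v‖ + 1 := by positivity
  have hε0 : 0 < ε := by positivity
  have hεv : ε * ‖v‖ ≤ c := by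
    rw [hε, div_mul_eq_mul_div, div_le_iff₀ hvn]
    nlinarith [norm_nonneg v]
  have hlo := hr.isLittleO.def hε0
  rw [nhds_prod_eq, (nhds_basis_ball.prod_self).eventually_iff] at hlo
  obtain ⟨δ, hδ, hlo⟩ := hlo
  refine ⟨‖v‖ / c, by positivity, fun U hU => ?_⟩
  obtain ⟨δ', hδ', hU'⟩ := Metric.mem_nhds_iff.1 hU
  set m := min δ δ' with hm
  have hm0 : 0 < m := lt_min hδ hδ'
  have e1 : ∀ᶠ z in 𝓝 q, ‖z - q‖ < m / 2 := by
    have : ContinuousAt (fun z => ‖z - q‖) q := by fun_prop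
    exact this.eventually (gt_mem_nhds (by simpa using hm0))
  have e2 : ∀ᶠ z in 𝓝 q, |r z| / c * ‖v‖ < m / 2 := by
    have : ContinuousAt (fun z => |r z| / c * ‖v‖) q :=
      ((hc.continuousAt.abs).div_const c).mul_const _
    exact this.eventually (gt_mem_nhds (by simpa [h0] using hm0))
  filter_upwards [e1, e2] with z h1 h2
  set t₀ := |r z| / c with ht₀
  have ht₀0 : 0 ≤ t₀ := by positivity
  have hmem : ∀ t ∈ Set.Icc (-t₀) t₀, z + t • v ∈ ball q m := by
    intro t ht
    rw [mem_ball_iff_norm]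
    calc ‖z + t • v - q‖ = ‖(z - q) + t • v‖ := by congr 1; abel
      _ ≤ ‖z - q‖ + |t| * ‖v‖ := by
          refine (norm_add_le _ _).trans ?_
          rw [norm_smul, Real.norm_eq_abs]
      _ < m := by
          have : |t| * ‖v‖ ≤ t₀ * ‖v‖ :=
            mul_le_mul_of_nonneg_right (abs_le.2 ht) (norm_nonneg v)
          linarith
  have hz : z ∈ ball q δ := by
    rw [mem_ball_iff_norm]
    linarith [min_le_left δ δ']
  have hest : ∀ t ∈ Set.Icc (-t₀) t₀, |r (z + t • v) - r z - t * (2 * c)| ≤ ε * (|t| * ‖v‖) := by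
    intro t ht
    have := hlo (show (z + t • v, z) ∈ ball q δ ×ˢ ball q δ from
      ⟨ball_subset_ball (min_le_left _ _) (hmem t ht), hz⟩)
    simp only [add_sub_cancel_left, map_smul, smul_eq_mul, norm_smul, Real.norm_eq_abs] at this
    rwa [hcd, mul_div_cancel₀ _ (two_ne_zero)]
  have htc : t₀ * c = |r z| := by rw [ht₀, div_mul_cancel₀ _ hc0.ne']
  have hprod : ε * (t₀ * ‖v‖) ≤ |r z| := by
    rw [← htc]
    nlinarith
  have hpos : 0 ≤ r (z + t₀ • v) := by
    have := (abs_le.1 (hest t₀ ⟨by linarith, le_rfl⟩)).1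
    rw [abs_of_nonneg ht₀0] at this
    linarith [neg_abs_le (r z)]
  have hneg : r (z + (-t₀) • v) ≤ 0 := by
    have := (abs_le.1 (hest (-t₀) ⟨le_rfl, by linarith⟩)).2
    rw [abs_neg, abs_of_nonneg ht₀0] at this
    linarith [le_abs_self (r z)]
  obtain ⟨t, ht, hrt⟩ := intermediate_value_Icc (show -t₀ ≤ t₀ by linarith)
    (f := fun t : ℝ => r (z + t • v)) (by fun_prop) ⟨hneg, hpos⟩
  refine ⟨z + t • v, hU' (ball_subset_ball (min_le_right _ _) (hmem t ht)), hrt, ?_⟩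
  rw [add_sub_cancel_left, norm_smul, Real.norm_eq_abs, div_mul_eq_mul_div, le_div_iff₀ hc0]
  have : |t| * c ≤ |r z| := by
    rw [← htc]
    exact mul_le_mul_of_nonneg_right (abs_le.2 ht) hc0.le
  nlinarith [norm_nonneg v]

lemma exists_local_bound {ι : Type*} [Fintype ι] (F : ι → Sm n) (q : Fin n → ℂ) :
    ∃ L, 0 ≤ L ∧ ∃ U ∈ 𝓝 q, ∀ x ∈ U, ∀ y ∈ U, ∀ i,
      ‖ev x (F i) - ev y (F i)‖ ≤ L * ‖x - y‖ ∧ ‖ev x (F i)‖ ≤ L := by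
  have h : ∀ i, ∃ L : ℝ, 0 ≤ L ∧ ∃ U ∈ 𝓝 q, ∀ x ∈ U, ∀ y ∈ U,
      ‖ev x (F i) - ev y (F i)‖ ≤ L * ‖x - y‖ ∧ ‖ev x (F i)‖ ≤ L := by
    intro i
    obtain ⟨K, U, hU, hK⟩ := ((Sm_contDiff (F i)).of_le (by exact_mod_cast le_top) :
      ContDiff ℝ 1 _).contDiffAt.exists_lipschitzOnWith (x := q)
    have hb : ∀ᶠ x in 𝓝 q, ‖ev x (F i)‖ < ‖ev q (F i)‖ + 1 :=
      (continuous_ev (F i)).norm.tendsto q |>.eventually (gt_mem_nhds (by linarith))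
    refine ⟨K + (‖ev q (F i)‖ + 1), by positivity, _, inter_mem hU hb,
      fun x hx y hy => ⟨?_, ?_⟩⟩
    · refine (hK.norm_sub_le hx.1 hy.1).trans ?_
      exact mul_le_mul_of_nonneg_right (le_add_of_nonneg_right (by positivity)) (norm_nonneg _)
    · have := hx.2
      have hK0 : (0 : ℝ) ≤ K := K.2
      simp only [Set.mem_ofPred_eq] at this
      linarith
  choose L hL U hU hLU using h
  refine ⟨∑ i, L i, Finset.sum_nonneg fun i _ => hL i, ⋂ i, U i, iInter_mem.2 hU,
    fun x hx y hy i => ?_⟩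
  obtain ⟨h1, h2⟩ := hLU i x (Set.mem_iInter.1 hx i) y (Set.mem_iInter.1 hy i)
  have : L i ≤ ∑ i, L i := Finset.single_le_sum (fun i _ => hL i) (Finset.mem_univ i)
  exact ⟨h1.trans (mul_le_mul_of_nonneg_right this (norm_nonneg _)), h2.trans this⟩

lemma norm_form_le {a : Fin n → Fin n → ℂ} {L : ℝ} (ha : ∀ j k, ‖a j k‖ ≤ L) (X Y : Fin n → ℂ) :
    ‖∑ j, ∑ k, a j k * X j * (starRingEnd ℂ) (Y k)‖ ≤ n * (n * L) * ‖X‖ * ‖Y‖ := by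
  calc _ ≤ ∑ _j : Fin n, ∑ _k : Fin n, L * ‖X‖ * ‖Y‖ := by
        refine norm_sum_le_of_le _ fun j _ => norm_sum_le_of_le _ fun k _ => ?_
        rw [norm_mul, norm_mul, RCLike.norm_conj]
        have hL : 0 ≤ L := (norm_nonneg _).trans (ha j k)
        gcongr
        · exact ha j k
        · exact norm_le_pi_norm X j
        · exact norm_le_pi_norm Y k
    _ = _ := by simp; ring

lemma norm_lin_le {a : Fin n → ℂ} {L : ℝ} (ha : ∀ j, ‖a j‖ ≤ L) (X : Fin n → ℂ) :
    ‖∑ j, X j * a j‖ ≤ n * L * ‖X‖ := by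
  calc _ ≤ ∑ _j : Fin n, ‖X‖ * L := by
        refine norm_sum_le_of_le _ fun j _ => ?_
        rw [norm_mul]
        exact mul_le_mul (norm_le_pi_norm X j) (ha j) (norm_nonneg _) (norm_nonneg _)
    _ = _ := by simp; ring

end Projection

section Pseudoconvex

open Metric Filter

variable {n : ℕ}

lemma pscAt_bound {B W D d C₁ R S s' N lz lp lt N' : ℝ} (hB : 0 ≤ B) (hW : 0 ≤ W)
    (hD : D = 2 * B * W * (1 + B * W) + B ^ 2 * W ^ 2) (hdR : d ≤ C₁ * R)
    (hN : 0 ≤ N) (hs' : 0 ≤ s') (hlz : lp - B * d * N ^ 2 ≤ lz)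
    (hlp : lt - 2 * (s' * (B * N' * W)) - s' ^ 2 * (B * W ^ 2) ≤ lp) (hlt : 0 ≤ lt)
    (hN' : N' ≤ N + s' * W) (hs1 : s' ≤ B * N) (hs2 : s' ≤ S + B * d * N) (hC₁ : 0 ≤ C₁)
    (hR : 0 ≤ R) (hS : 0 ≤ S) :
    -((B + D * B) * C₁ + D) * (R * N ^ 2 + N * S) ≤ lz := by
  have hD0 : 0 ≤ D := by rw [hD]; positivity
  have e1 : N' ≤ (1 + B * W) * N := by nlinarith
  have e2 : s' * (B * N' * W) ≤ s' * (B * ((1 + B * W) * N) * W) := by gcongr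
  have e3 : s' ^ 2 * (B * W ^ 2) ≤ s' * (B * N) * (B * W ^ 2) := by
    rw [sq]; gcongr
  have e4 : lp ≥ -(D * (s' * N)) := by
    rw [hD]; nlinarith
  have e5 : D * (s' * N) ≤ D * ((S + B * d * N) * N) := by gcongr
  have e6 : (B + D * B) * N ^ 2 * d ≤ (B + D * B) * N ^ 2 * (C₁ * R) := by gcongr
  have g1 : 0 ≤ (B + D * B) * C₁ * (N * S) := by positivity
  have g2 : 0 ≤ D * (R * N ^ 2) := by positivity
  nlinarith

lemma exists_transverse {ρ : Sm n} (hρ : star ρ = ρ) {q : Fin n → ℂ} (h0 : ev q ρ = 0)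
    (hd : ∃ i, ev q (dl i ρ) ≠ 0) : ∃ v : Fin n → ℂ,
      (∃ c > 0, ∀ᶠ z in 𝓝 q, c < ‖∑ j, v j * ev z (dl j ρ)‖) ∧
      ∃ C, 0 ≤ C ∧ ∀ U ∈ 𝓝 q, ∀ᶠ z in 𝓝 q, ∃ p ∈ U, ev p ρ = 0 ∧ ‖p - z‖ ≤ C * ‖ev z ρ‖ := by
  have hre : ∀ z, ((ev z ρ).re : ℂ) = ev z ρ := ofReal_re_ev hρ
  let v : Fin n → ℂ := fun j => (starRingEnd ℂ) (ev q (dl j ρ))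
  let G : (Fin n → ℂ) → ℂ := fun z => ∑ j, v j * ev z (dl j ρ)
  have hG : Continuous G := continuous_finsetSum _ fun j _ =>
    continuous_const.mul (continuous_ev (dl j ρ))
  have hGq : G q = ((∑ j, normSq (ev q (dl j ρ)) : ℝ) : ℂ) := by
    simp only [G, v, ofReal_sum]
    exact Finset.sum_congr rfl fun j _ => by rw [mul_comm, mul_conj]
  have hpos : 0 < ∑ j, normSq (ev q (dl j ρ)) := by
    obtain ⟨i, hi⟩ := hd
    exact Finset.sum_pos' (fun j _ => normSq_nonneg _) ⟨i, Finset.mem_univ i, normSq_pos.2 hi⟩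
  have hstrict : HasStrictFDerivAt (fun z => (ev z ρ).re)
      (reCLM ∘L fderiv ℝ (ρ : (Fin n → ℂ) → ℂ) q) q :=
    reCLM.hasStrictFDerivAt.comp q
      ((Sm_contDiff ρ).contDiffAt.hasStrictFDerivAt (by simp))
  have hv : 0 < (reCLM ∘L fderiv ℝ (ρ : (Fin n → ℂ) → ℂ) q) v := by
    rw [ContinuousLinearMap.comp_apply, fderiv_eq_sum, Finset.sum_add_distrib, reCLM_apply]
    have e1 : ∑ j, ev q (dl j ρ) * v j = G q := by
      simp only [G]
      exact Finset.sum_congr rfl fun j _ => mul_comm _ _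
    have e2 : ∑ j, ev q (db j ρ) * (starRingEnd ℂ) (v j) = G q := by
      simp only [G, v, conj_conj]
      refine Finset.sum_congr rfl fun j _ => ?_
      rw [← ev_star, ← db_star, hρ]
    rw [e1, e2, hGq, add_re, ofReal_re]
    linarith
  obtain ⟨C₁, hC₁, hproj⟩ := exists_zero_near hstrict (continuous_re.comp (continuous_ev ρ))
    (by rw [h0]; rfl) hv
  refine ⟨v, ⟨(∑ j, normSq (ev q (dl j ρ))) / 2, half_pos hpos, ?_⟩, C₁, hC₁, fun U hU => ?_⟩
  · refine hG.norm.tendsto q |>.eventually (lt_mem_nhds ?_)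
    rw [hGq, norm_real, Real.norm_eq_abs, abs_of_pos hpos]
    linarith
  · filter_upwards [hproj U hU] with z ⟨p, hp, hp0, hpz⟩
    refine ⟨p, hp, ?_, ?_⟩
    · rw [← hre, hp0, ofReal_zero]
    · rwa [← hre z, norm_real, Real.norm_eq_abs]

lemma pscAt_of_tangent {ρ : Sm n} (hρ : star ρ = ρ) {q : Fin n → ℂ} (h0 : ev q ρ = 0)
    (hd : ∃ i, ev q (dl i ρ) ≠ 0)
    (h : ∀ᶠ z in 𝓝 q, ev z ρ = 0 → ∀ X : Fin n → ℂ, ∑ j, X j * ev z (dl j ρ) = 0 →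
      0 ≤ lf ρ X z) : PscAt ρ q := by
  obtain ⟨v, ⟨c, hc, hGc⟩, C₁, hC₁, hproj⟩ := exists_transverse hρ h0 hd
  obtain ⟨L₁, hL₁, U₁, hU₁, hb₁⟩ := exists_local_bound (fun j => dl j ρ) q
  obtain ⟨L₂, hL₂, U₂, hU₂, hb₂⟩ := exists_local_bound
    (fun i : Fin n × Fin n => dl i.1 (db i.2 ρ)) q
  set B : ℝ := n * L₁ + n * (n * L₂) with hBdef
  have hB : 0 ≤ B := by positivity
  set W := ‖v‖ / c with hWdef
  have hW : 0 ≤ W := by positivity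
  set D := 2 * B * W * (1 + B * W) + B ^ 2 * W ^ 2 with hD
  have hD0 : 0 ≤ D := by positivity
  refine ⟨(B + D * B) * C₁ + D, by positivity, ?_⟩
  filter_upwards [hproj _ (inter_mem (inter_mem hU₁ hU₂) (inter_mem hGc h)), hU₁, hU₂]
    with z ⟨p, ⟨⟨hp1, hp2⟩, hpG, hpT⟩, hp0, hdR⟩ hz1 hz2 Z
  set Gp := ∑ j, v j * ev p (dl j ρ) with hGp
  have hpG' : Gp ≠ 0 := norm_pos_iff.1 (hc.trans hpG)
  set s := ∑ j, Z j * ev p (dl j ρ) with hs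
  set S := ∑ j, Z j * ev z (dl j ρ) with hS
  set w : Fin n → ℂ := Gp⁻¹ • v with hw
  set Z' := Z - s • w with hZ'
  have hwW : ‖w‖ ≤ W := by
    rw [hw, norm_smul, norm_inv, hWdef, inv_mul_eq_div]
    exact div_le_div_of_nonneg_left (norm_nonneg v) hc hpG.le
  have hw1 : ∑ j, w j * ev p (dl j ρ) = 1 := by
    simp only [hw, Pi.smul_apply, smul_eq_mul, mul_assoc, ← Finset.mul_sum]
    exact inv_mul_cancel₀ hpG'
  have hZt : ∑ j, Z' j * ev p (dl j ρ) = 0 := by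
    simp only [hZ', Pi.sub_apply, Pi.smul_apply, smul_eq_mul, sub_mul, Finset.sum_sub_distrib,
      mul_assoc, ← Finset.mul_sum, hw1]
    rw [← hs]; ring
  have hlt := hpT hp0 Z' hZt
  have hbf : ∀ X Y, ‖bf ρ p X Y‖ ≤ B * ‖X‖ * ‖Y‖ := by
    intro X Y
    refine (norm_form_le (fun j k => (hb₂ p hp2 p hp2 (j, k)).2) X Y).trans ?_
    gcongr
    rw [hBdef]
    exact le_add_of_nonneg_left (by positivity)
  have hlz : lf ρ Z p - B * ‖p - z‖ * ‖Z‖ ^ 2 ≤ lf ρ Z z := by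
    have e : bf ρ p Z Z - bf ρ z Z Z = ∑ j, ∑ k,
        (ev p (dl j (db k ρ)) - ev z (dl j (db k ρ))) * Z j * (starRingEnd ℂ) (Z k) := by
      simp only [bf, ← Finset.sum_sub_distrib, sub_mul]
    have k := norm_form_le (a := fun j k => ev p (dl j (db k ρ)) - ev z (dl j (db k ρ)))
      (fun j k => (hb₂ p hp2 z hz2 (j, k)).1) Z Z
    rw [← e] at k
    have k2 := (le_abs_self _).trans ((abs_re_le_norm _).trans k)
    rw [sub_re, ← lf_eq_bf, ← lf_eq_bf] at k2
    have k3 : (n : ℝ) * (n * (L₂ * ‖p - z‖)) * ‖Z‖ * ‖Z‖ ≤ B * ‖p - z‖ * ‖Z‖ ^ 2 := by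
      have : (n : ℝ) * (n * (L₂ * ‖p - z‖)) * ‖Z‖ * ‖Z‖ = n * (n * L₂) * ‖p - z‖ * ‖Z‖ ^ 2 := by
        ring
      rw [this]
      gcongr
      exact le_add_of_nonneg_left (by positivity)
    linarith
  have hlp : lf ρ Z' p - 2 * (‖s‖ * (B * ‖Z'‖ * W)) - ‖s‖ ^ 2 * (B * W ^ 2) ≤ lf ρ Z p := by
    have eZ : Z = Z' + s • w := by rw [hZ', sub_add_cancel]
    have e := congrArg re (bf_add_smul ρ p Z' w s)
    rw [← eZ, bf_swap hρ p Z' w, add_re, add_re, add_re, ← lf_eq_bf, ← lf_eq_bf] at e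
    have b1 : ‖bf ρ p Z' w‖ ≤ B * ‖Z'‖ * W := (hbf _ _).trans (by gcongr)
    have b2 : ‖bf ρ p w w‖ ≤ B * W ^ 2 := (hbf _ _).trans (by rw [sq, ← mul_assoc]; gcongr)
    have f1 : -(‖s‖ * (B * ‖Z'‖ * W)) ≤ ((starRingEnd ℂ) s * bf ρ p Z' w).re := by
      refine neg_le.1 ((neg_le_abs _).trans ((abs_re_le_norm _).trans ?_))
      rw [norm_mul, RCLike.norm_conj]; gcongr
    have f2 : -(‖s‖ * (B * ‖Z'‖ * W)) ≤ (s * (starRingEnd ℂ) (bf ρ p Z' w)).re := by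
      refine neg_le.1 ((neg_le_abs _).trans ((abs_re_le_norm _).trans ?_))
      rw [norm_mul, RCLike.norm_conj]; gcongr
    have f3 : -(‖s‖ ^ 2 * (B * W ^ 2)) ≤ (s * (starRingEnd ℂ) s * bf ρ p w w).re := by
      refine neg_le.1 ((neg_le_abs _).trans ((abs_re_le_norm _).trans ?_))
      rw [norm_mul, norm_mul, RCLike.norm_conj, ← sq]; gcongr
    linarith
  have hN' : ‖Z'‖ ≤ ‖Z‖ + ‖s‖ * W := by
    refine (norm_sub_le _ _).trans ?_
    rw [norm_smul]; gcongr
  have hs1 : ‖s‖ ≤ B * ‖Z‖ := by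
    refine (norm_lin_le (fun j => (hb₁ p hp1 p hp1 j).2) Z).trans ?_
    gcongr
    exact le_add_of_nonneg_right (by positivity)
  have hs2 : ‖s‖ ≤ ‖S‖ + B * ‖p - z‖ * ‖Z‖ := by
    have e : s - S = ∑ j, Z j * (ev p (dl j ρ) - ev z (dl j ρ)) := by
      simp only [hs, hS, mul_sub, Finset.sum_sub_distrib]
    have k := norm_lin_le (a := fun j => ev p (dl j ρ) - ev z (dl j ρ))
      (fun j => (hb₁ p hp1 z hz1 j).1) Z
    rw [← e] at k
    have k3 : (n : ℝ) * (L₁ * ‖p - z‖) * ‖Z‖ ≤ B * ‖p - z‖ * ‖Z‖ := by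
      rw [← mul_assoc]
      gcongr
      exact le_add_of_nonneg_right (by positivity)
    have := norm_sub_norm_le s S
    linarith
  rw [← lf_eq ρ Z z]
  exact pscAt_bound hB hW hD hdR (norm_nonneg Z) (norm_nonneg s) hlz hlp hlt hN' hs1 hs2
    hC₁ (norm_nonneg _) (norm_nonneg _)

end Pseudoconvex

section Globalization

open Filter Set

open scoped Manifold ContDiff

variable {n : ℕ}

lemma exists_cutoff {A B : Set (Fin n → ℂ)} (hA : IsClosed A) (hB : IsClosed B)
    (h : Disjoint A B) : ∃ c : Sm n, star c = c ∧ (∀ z, 0 ≤ (ev z c).re ∧ (ev z c).re ≤ 1) ∧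
      (∀ᶠ z in 𝓝ˢ A, ev z c = 0) ∧ ∀ᶠ z in 𝓝ˢ B, ev z c = 1 := by
  obtain ⟨f, h0, h1, hf⟩ := exists_contMDiffMap_zero_one_nhds_of_isClosed
    (n := ⊤) 𝓘(ℝ, Fin n → ℂ) hA hB h
  have hs : ContDiff ℝ (⊤ : ℕ∞) f := contMDiff_iff_contDiff.1 f.contMDiff
  refine ⟨⟨fun z => (f z : ℝ), ofRealCLM.contDiff.comp hs⟩, ?_, fun z => ?_, ?_, ?_⟩
  · ext z; exact conj_ofReal _
  · exact hf z
  · filter_upwards [h0] with z hz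
    rw [ev_apply]; simp [hz]
  · filter_upwards [h1] with z hz
    rw [ev_apply]; simp [hz]

lemma exists_global {g : (Fin n → ℂ) → ℝ} {V A : Set (Fin n → ℂ)} (hV : IsOpen V)
    (hg : ContDiffOn ℝ (⊤ : ℕ∞) g V) (hA : IsClosed A) (hAV : A ⊆ V) :
    ∃ F : Sm n, star F = F ∧ ∀ᶠ z in 𝓝ˢ A, ev z F = (g z : ℂ) := by
  obtain ⟨c, hc, -, h0, h1⟩ := exists_cutoff hV.isClosed_compl hA
    (disjoint_left.2 fun z hz hzA => hz (hAV hzA))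
  have hsm : ContDiff ℝ (⊤ : ℕ∞) fun z => ev z c * (g z : ℂ) := by
    rw [contDiff_iff_contDiffAt]
    intro z
    by_cases hz : z ∈ V
    · exact (Sm_contDiff c).contDiffAt.mul
        (ofRealCLM.contDiff.contDiffAt.comp z (hg.contDiffAt (hV.mem_nhds hz)))
    · refine (contDiffAt_const (c := (0 : ℂ))).congr_of_eventuallyEq ?_
      filter_upwards [mem_nhdsSet_iff_forall.1 h0 z hz] with w hw
      have hw : ev w c = 0 := hw
      rw [hw, zero_mul]
  refine ⟨⟨_, hsm⟩, ?_, ?_⟩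
  · ext z
    change (starRingEnd ℂ) (ev z c * (g z : ℂ)) = ev z c * (g z : ℂ)
    rw [map_mul, ← ev_star, hc, conj_ofReal]
  · filter_upwards [h1] with z hz
    change ev z c * (g z : ℂ) = _
    rw [hz, one_mul]

lemma ev_dl_eq {F : Sm n} {f : (Fin n → ℂ) → ℂ} {z : Fin n → ℂ} (h : ∀ᶠ w in 𝓝 z, ev w F = f w)
    (j : Fin n) : ev z (dl j F) = dz j f z := by
  have : (F : (Fin n → ℂ) → ℂ) =ᶠ[𝓝 z] f := h
  rw [ev_apply, dl_apply, dz, dz, this.fderiv_eq]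

lemma ev_db_eq {F : Sm n} {f : (Fin n → ℂ) → ℂ} {z : Fin n → ℂ} (h : ∀ᶠ w in 𝓝 z, ev w F = f w)
    (j : Fin n) : ev z (db j F) = dzbar j f z := by
  have : (F : (Fin n → ℂ) → ℂ) =ᶠ[𝓝 z] f := h
  rw [ev_apply, db_apply, dzbar, dzbar, this.fderiv_eq]

lemma levi_re_eq {F : Sm n} {g : (Fin n → ℂ) → ℝ} {z : Fin n → ℂ}
    (h : ∀ᶠ w in 𝓝 z, ev w F = (g w : ℂ)) (X : Fin n → ℂ) :
    (levi g X X z).re = lf F X z := by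
  rw [lf_eq, levi]
  congr 1
  refine Finset.sum_congr rfl fun j _ => Finset.sum_congr rfl fun k _ => ?_
  rw [ev_dl_eq (f := fun w => dzbar k (cplx g) w) ?_ j]
  filter_upwards [h.eventually_nhds] with w hw
  exact ev_db_eq hw k

lemma dirDeriv_eq {F : Sm n} {g : (Fin n → ℂ) → ℝ} {z : Fin n → ℂ}
    (h : ∀ᶠ w in 𝓝 z, ev w F = (g w : ℂ)) (X : Fin n → ℂ) :
    dirDeriv X (cplx g) z = ∑ j, X j * ev z (dl j F) := by
  rw [dirDeriv]
  exact Finset.sum_congr rfl fun j _ => by rw [ev_dl_eq (f := cplx g) h j]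

lemma fderiv_eq_of_germ {F : Sm n} {g : (Fin n → ℂ) → ℝ} {z : Fin n → ℂ}
    (h : ∀ᶠ w in 𝓝 z, ev w F = (g w : ℂ)) (v : Fin n → ℂ) :
    (fderiv ℝ g z v : ℂ) = fderiv ℝ (F : (Fin n → ℂ) → ℂ) z v := by
  have h1 : g =ᶠ[𝓝 z] fun w => (ev w F).re := by
    filter_upwards [h] with w hw
    rw [hw, ofReal_re]
  have hd : DifferentiableAt ℝ g z := h1.differentiableAt_iff.2
    (reCLM.differentiableAt.comp z (Sm_differentiable F z))
  have h2 : (F : (Fin n → ℂ) → ℂ) =ᶠ[𝓝 z] fun w => (g w : ℂ) := h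
  have h3 : HasFDerivAt (fun w => (g w : ℂ)) (ofRealCLM.comp (fderiv ℝ g z)) z :=
    ofRealCLM.hasFDerivAt.comp z hd.hasFDerivAt
  rw [h2.fderiv_eq, h3.fderiv]
  rfl

/-- A globally defined smooth function extending the germ of a defining function along the
closure of the domain. -/
structure IsExt (Ω : Set (Fin n → ℂ)) (ρ : (Fin n → ℂ) → ℝ) (r : Sm n) : Prop where
  real : star r = r
  germ : ∀ z ∈ closure Ω, ∀ᶠ w in 𝓝 z, ev w r = (ρ w : ℂ)

lemma IsDefFn.exists_isExt {Ω V : Set (Fin n → ℂ)} {ρ : (Fin n → ℂ) → ℝ} (h : IsDefFn Ω V ρ) :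
    ∃ r, IsExt Ω ρ r := by
  obtain ⟨r, hr, hg⟩ := exists_global h.isOpen h.smooth isClosed_closure h.subset
  exact ⟨r, hr, fun z hz => mem_nhdsSet_iff_forall.1 hg z hz⟩

section Boundary

variable {Ω V : Set (Fin n → ℂ)} {ρ : (Fin n → ℂ) → ℝ} {r : Sm n}

lemma IsDefFn.eq_zero (h : IsDefFn Ω V ρ) (hΩ : IsOpen Ω) {q : Fin n → ℂ}
    (hq : q ∈ frontier Ω) : ρ q = 0 := by
  have hqc : q ∈ closure Ω := frontier_subset_closure hq
  have hqV := h.subset hqc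
  have hqΩ : q ∉ Ω := fun hm => by
    rw [frontier, hΩ.interior_eq] at hq; exact hq.2 hm
  apply le_antisymm
  · have hc : ContinuousAt ρ q := (h.smooth.contDiffAt (h.isOpen.mem_nhds hqV)).continuousAt
    have : ρ q ∈ closure (Iio (0 : ℝ)) := by
      refine hc.continuousWithinAt.mem_closure (s := Ω) hqc fun z hz => ?_
      rw [h.eq] at hz; exact hz.2
    rwa [closure_Iio] at this
  · by_contra hlt
    exact hqΩ (by rw [h.eq]; exact ⟨hqV, not_le.1 hlt⟩)

lemma IsExt.ev_eq_zero (hr : IsExt Ω ρ r) (h : IsDefFn Ω V ρ) (hΩ : IsOpen Ω) {q : Fin n → ℂ}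
    (hq : q ∈ frontier Ω) : ev q r = 0 := by
  rw [(hr.germ q (frontier_subset_closure hq)).self_of_nhds, IsDefFn.eq_zero h hΩ hq, ofReal_zero]

lemma IsExt.exists_dl_ne (hr : IsExt Ω ρ r) (h : IsDefFn Ω V ρ) {q : Fin n → ℂ}
    (hq : q ∈ frontier Ω) : ∃ i, ev q (dl i r) ≠ 0 := by
  by_contra! h0
  refine h.grad_ne q hq (ContinuousLinearMap.ext fun v => ?_)
  rw [← ofReal_inj, fderiv_eq_of_germ (hr.germ q (frontier_subset_closure hq)), fderiv_eq_sum]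
  have h1 : ∀ j, ev q (db j r) = 0 := fun j => by
    rw [← hr.real, db_star, ev_star, h0, map_zero]
  simp [h0, h1]

lemma IsExt.eventually_mem_closure (hr : IsExt Ω ρ r) (h : IsDefFn Ω V ρ) {q : Fin n → ℂ}
    (hq : q ∈ frontier Ω) : ∀ᶠ z in 𝓝 q, ρ z = 0 → z ∈ closure Ω := by
  obtain ⟨i, hi⟩ := hr.exists_dl_ne h hq
  have hqc := frontier_subset_closure hq
  filter_upwards [(continuous_ev (dl i r)).continuousAt.eventually_ne hi,
    (hr.germ q hqc).eventually_nhds, h.isOpen.mem_nhds (h.subset hqc)] with z hz hzg hzV hz0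
  by_contra hzc
  have hmin : IsLocalMin ρ z := by
    filter_upwards [h.isOpen.mem_nhds hzV, isClosed_closure.isOpen_compl.mem_nhds hzc]
      with w hwV hwc
    rw [hz0]
    by_contra hlt
    exact hwc (subset_closure (by rw [h.eq]; exact ⟨hwV, not_le.1 hlt⟩))
  apply hz
  have h0 : ∀ v, fderiv ℝ (r : (Fin n → ℂ) → ℂ) z v = 0 := fun v => by
    rw [← fderiv_eq_of_germ hzg, hmin.fderiv_eq_zero]; simp
  rw [ev_apply, dl_apply, dz, h0, h0]
  simp

lemma IsExt.eventually_pos (hr : IsExt Ω ρ r) (h : IsDefFn Ω V ρ) {q : Fin n → ℂ}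
    (hq : q ∈ frontier Ω) : ∀ᶠ z in 𝓝 q, z ∉ closure Ω → 0 < ρ z := by
  filter_upwards [hr.eventually_mem_closure h hq,
    h.isOpen.mem_nhds (h.subset (frontier_subset_closure hq))] with z hz hzV hzc
  refine lt_of_le_of_ne ?_ fun h0 => hzc (hz h0.symm)
  by_contra hlt
  exact hzc (subset_closure (by rw [h.eq]; exact ⟨hzV, not_le.1 hlt⟩))

lemma IsExt.pscAt (hr : IsExt Ω ρ r) (h : IsDefFn Ω V ρ) (hΩ : IsOpen Ω)
    (hpsc : ∀ q ∈ frontier Ω, LeviPseudoconvexAt ρ q) {q : Fin n → ℂ} (hq : q ∈ frontier Ω) :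
    PscAt r q := by
  refine pscAt_of_tangent hr.real (hr.ev_eq_zero h hΩ hq) (hr.exists_dl_ne h hq) ?_
  filter_upwards [hr.eventually_mem_closure h hq,
    (hr.germ q (frontier_subset_closure hq)).eventually_nhds] with z hz hzg hz0 X hX
  have hρ : ρ z = 0 := by
    have := hzg.self_of_nhds
    rw [hz0] at this
    exact_mod_cast this.symm
  have hzf : z ∈ frontier Ω := by
    refine ⟨hz hρ, ?_⟩
    rw [hΩ.interior_eq, h.eq]
    exact fun hm => absurd hm.2 (by rw [hρ]; exact lt_irrefl 0)
  rw [← levi_re_eq hzg]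
  exact hpsc z hzf X (by rw [dirDeriv_eq hzg]; exact hX)

end Boundary

end Globalization

section Profile

open Filter Set

open scoped ContDiff

variable {n : ℕ}

/-- A smooth function whose derivative `k` vanishes on the negative axis and grows at least
exponentially with rate `A` on the positive axis. -/
lemma exists_profile {A : ℝ} (hA : 0 ≤ A) : ∃ h k : ℝ → ℝ, ContDiff ℝ (⊤ : ℕ∞) h ∧
    ContDiff ℝ (⊤ : ℕ∞) k ∧ deriv h = k ∧ (∀ t ≤ 0, k t = 0) ∧ Monotone k ∧ (∀ t, 0 ≤ k t) ∧
    (∀ t ≤ 3, k t ≤ 1) ∧ 0 < k 1 ∧ ∀ t, A * k t ≤ deriv k t := by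
  let k : ℝ → ℝ := fun t => Real.exp (A * (t - 3)) * expNegInvGlue t
  have hk : ContDiff ℝ (⊤ : ℕ∞) k :=
    (contDiff_const.mul (contDiff_id.sub contDiff_const)).exp.mul expNegInvGlue.contDiff
  have hd : ∀ t, HasDerivAt (fun t => ∫ x in (0 : ℝ)..t, k x) (k t) t := fun t =>
    (hk.continuous.integral_hasStrictDerivAt 0 t).hasDerivAt
  have hmono : Monotone expNegInvGlue := expNegInvGlue.monotone
  have hmonok : Monotone k := fun s t hst =>
    mul_le_mul (Real.exp_le_exp.2 (by nlinarith)) (hmono hst) (expNegInvGlue.nonneg _)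
      (Real.exp_pos _).le
  have hle : ∀ t, expNegInvGlue t ≤ 1 := fun t => by
    rcases le_or_gt t 0 with ht | ht
    · rw [expNegInvGlue.zero_of_nonpos ht]; exact zero_le_one
    · rw [expNegInvGlue, if_neg (not_le.2 ht)]
      exact Real.exp_le_one_iff.2 (neg_nonpos.2 (inv_nonneg.2 ht.le))
  refine ⟨_, k, contDiff_infty_iff_deriv.2 ⟨fun t => (hd t).differentiableAt, ?_⟩, hk,
    funext fun t => (hd t).deriv, fun t ht => ?_, hmonok,
    fun t => mul_nonneg (Real.exp_pos _).le (expNegInvGlue.nonneg _), fun t ht => ?_,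
    mul_pos (Real.exp_pos _) (expNegInvGlue.pos_of_pos one_pos), fun t => ?_⟩
  · rw [funext fun t => (hd t).deriv]; exact hk
  · simp only [k, expNegInvGlue.zero_of_nonpos ht, mul_zero]
  · exact mul_le_one₀ (Real.exp_le_one_iff.2 (by nlinarith)) (expNegInvGlue.nonneg _) (hle t)
  · have h1 : HasDerivAt (fun t => Real.exp (A * (t - 3))) (Real.exp (A * (t - 3)) * A) t := by
      simpa using (((hasDerivAt_id t).sub_const 3).const_mul A).exp
    have h2 : HasDerivAt expNegInvGlue (deriv expNegInvGlue t) t :=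
      (expNegInvGlue.contDiff (n := 1).differentiable one_ne_zero t).hasDerivAt
    have h3 : 0 ≤ deriv expNegInvGlue t := hmono.deriv_nonneg
    have h4 : deriv k t = _ := (h1.mul h2).deriv
    rw [h4]
    have := mul_nonneg (Real.exp_pos (A * (t - 3))).le h3
    simp only [k]
    nlinarith

/-- Composition of a real smooth function on the line with the real part of an element of `Sm n`. -/
def compS {h : ℝ → ℝ} (hh : ContDiff ℝ (⊤ : ℕ∞) h) (f : Sm n) : Sm n :=
  ⟨fun z => (h (ev z f).re : ℝ),
    ofRealCLM.contDiff.comp (hh.comp (reCLM.contDiff.comp (Sm_contDiff f)))⟩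

lemma ev_compS {h : ℝ → ℝ} (hh : ContDiff ℝ (⊤ : ℕ∞) h) (f : Sm n) (z : Fin n → ℂ) :
    ev z (compS hh f) = (h (ev z f).re : ℝ) := rfl

lemma compS_star {h : ℝ → ℝ} (hh : ContDiff ℝ (⊤ : ℕ∞) h) (f : Sm n) :
    star (compS hh f) = compS hh f := by
  ext z; exact conj_ofReal _

lemma pd_compS {h k : ℝ → ℝ} (hh : ContDiff ℝ (⊤ : ℕ∞) h) (hk : ContDiff ℝ (⊤ : ℕ∞) k)
    (hd : deriv h = k) {f : Sm n} (hf : star f = f) (v : Fin n → ℂ) :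
    pd v (compS hh f) = compS hk f * pd v f := by
  ext z
  have h1 : HasFDerivAt (fun z => (ev z f).re)
      (reCLM.comp (fderiv ℝ (f : (Fin n → ℂ) → ℂ) z)) z :=
    reCLM.hasFDerivAt.comp z (Sm_differentiable f z).hasFDerivAt
  have h2 : HasDerivAt h (k (ev z f).re) (ev z f).re := by
    rw [← hd]
    exact (hh.differentiable (by simp) _).hasDerivAt
  have h3 := ofRealCLM.hasFDerivAt.comp z (h2.comp_hasFDerivAt z h1)
  have h4 : star (pd v f) = pd v f := by rw [← pd_star, hf]
  rw [pd_apply]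
  change fderiv ℝ (fun z => ((h (ev z f).re : ℝ) : ℂ)) z v =
    ((k (ev z f).re : ℝ) : ℂ) * ev z (pd v f)
  rw [← ofReal_re_ev h4 z]
  erw [h3.fderiv]
  simp [ev_apply, pd_apply]

lemma fld_compS {h k : ℝ → ℝ} (hh : ContDiff ℝ (⊤ : ℕ∞) h) (hk : ContDiff ℝ (⊤ : ℕ∞) k)
    (hd : deriv h = k) {f : Sm n} (hf : star f = f) (X : Fin n → Sm n) (b : Bool) :
    fld X b (compS hh f) = compS hk f * fld X b f := by
  have h1 : ∀ j, dl j (compS hh f) = compS hk f * dl j f := fun j => by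
    simp only [dl, Derivation.smul_apply, Derivation.sub_apply, pd_compS hh hk hd hf,
      mul_smul_comm, mul_sub]
  have h2 : ∀ j, db j (compS hh f) = compS hk f * db j f := fun j => by
    simp only [db, Derivation.smul_apply, Derivation.add_apply, pd_compS hh hk hd hf,
      mul_smul_comm, mul_add]
  cases b
  · simp only [fld, sum_derivation_apply, Derivation.smul_apply, h2, Finset.mul_sum, smul_eq_mul]
    exact Finset.sum_congr rfl fun j _ => by ring
  · simp only [fld, sum_derivation_apply, Derivation.smul_apply, h1, Finset.mul_sum, smul_eq_mul]
    exact Finset.sum_congr rfl fun j _ => by ring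

lemma ev_D_compS {h k : ℝ → ℝ} (hh : ContDiff ℝ (⊤ : ℕ∞) h) (hk : ContDiff ℝ (⊤ : ℕ∞) k)
    (hd : deriv h = k) {f : Sm n} (hf : star f = f) (X z : Fin n → ℂ) :
    ev z (fld (cst X) true (compS hh f)) = (k (ev z f).re : ℝ) * ev z (fld (cst X) true f) := by
  rw [fld_compS hh hk hd hf, map_mul, ev_compS]

lemma lf_compS {h k : ℝ → ℝ} (hh : ContDiff ℝ (⊤ : ℕ∞) h) (hk : ContDiff ℝ (⊤ : ℕ∞) k)
    (hd : deriv h = k) {f : Sm n} (hf : star f = f) (X z : Fin n → ℂ) :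
    lf (compS hh f) X z = k (ev z f).re * lf f X z +
      deriv k (ev z f).re * normSq (ev z (fld (cst X) true f)) := by
  have hk' : ContDiff ℝ (⊤ : ℕ∞) (deriv k) := (contDiff_infty_iff_deriv.1 hk).2
  rw [lf, fld_compS hh hk hd hf, Derivation.leibniz, map_add, smul_eq_mul, smul_eq_mul,
    fld_compS hk hk' rfl hf, map_mul, map_mul, map_mul, ev_Db hf, ev_compS, ev_compS,
    mul_left_comm, mul_comm (starRingEnd ℂ _), mul_conj, add_re, ← ofReal_mul, re_ofReal_mul,
    ofReal_re, lf]

end Profile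

section Local

open Filter Set

variable {n : ℕ}

lemma levi_exp {g : (Fin n → ℂ) → ℝ} {L : Sm n} (hL : star L = L) {η : ℝ} {z : Fin n → ℂ}
    (h : ∀ᶠ w in 𝓝 z, g w = Real.exp (η * (ev w L).re)) (X : Fin n → ℂ) :
    (levi g X X z).re = Real.exp (η * (ev z L).re) *
      (η * (lf L X z + η * normSq (ev z (fld (cst X) true L)))) := by
  have hs := star_smul_real η hL
  rw [levi_re_eq (F := expS ((η : ℂ) • L)) ?_, lf_expS hs, lf_smul, Derivation.map_smul,
    map_smul (ev z) _ (fld (cst X) true L), smul_eq_mul, normSq_mul, normSq_ofReal, ev_smul_re]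
  · ring
  · filter_upwards [h] with w hw
    rw [ev_expS_real hs, ev_smul_re, hw]

lemma levi_core {l m k k' η a : ℝ} (u f : ℂ) (ha : 0 < a) (hk : 0 ≤ k)
    (hη : 0 ≤ η) (hk' : η ^ 2 / a * k ≤ k') :
    l + η * normSq u + k * (m - a * normSq u) ≤
      l + (k * m + k' * normSq f) + η * normSq (u + (k : ℝ) * f) := by
  have h1 : normSq (u + (k : ℝ) * f) = normSq u + k ^ 2 * normSq f +
      2 * k * (u * (starRingEnd ℂ) f).re := by
    simp only [normSq_apply, add_re, add_im, mul_re, mul_im, ofReal_re, ofReal_im, conj_re, conj_im]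
    ring
  have h2 : 0 ≤ η ^ 2 / a * normSq f + a * normSq u + 2 * η * (u * (starRingEnd ℂ) f).re := by
    have h3 : η ^ 2 / a * normSq f + a * normSq u + 2 * η * (u * (starRingEnd ℂ) f).re =
        normSq ((a : ℝ) * u + (η : ℝ) * f) / a := by
      field_simp
      simp only [normSq_apply, add_re, add_im, mul_re, mul_im, ofReal_re, ofReal_im, conj_re,
        conj_im]
      ring
    rw [h3]
    exact div_nonneg (normSq_nonneg _) ha.le
  have h4 := mul_le_mul_of_nonneg_right hk' (normSq_nonneg f)
  have h5 := mul_nonneg hk h2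
  have h6 : 0 ≤ η * (k ^ 2 * normSq f) := by have := normSq_nonneg f; positivity
  rw [h1]
  nlinarith

lemma norm_sq_le_enormSq (X : Fin n → ℂ) : ‖X‖ ^ 2 ≤ enormSq X := by
  have : ‖X‖ ≤ Real.sqrt (enormSq X) := (pi_norm_le_iff_of_nonneg (Real.sqrt_nonneg _)).2
    fun i => Real.le_sqrt_of_sq_le (by
      have := norm_mul_norm_le_enormSq X i i
      rwa [← sq] at this)
  calc ‖X‖ ^ 2 ≤ Real.sqrt (enormSq X) ^ 2 := by gcongr
    _ = _ := Real.sq_sqrt (enormSq_nonneg X)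

lemma enormSq_pos {X : Fin n → ℂ} (hX : X ≠ 0) : 0 < enormSq X :=
  (pow_pos (norm_pos_iff.2 hX) 2).trans_le (norm_sq_le_enormSq X)

/-- The estimate in the definition of `PscAt` holds with a uniform constant near compact sets. -/
lemma exists_psc_const {r : Sm n} {K : Set (Fin n → ℂ)} (hK : IsCompact K)
    (h : ∀ q ∈ K, PscAt r q) : ∃ C : ℝ, 0 ≤ C ∧ ∀ᶠ z in 𝓝ˢ K, ∀ Z : Fin n → ℂ,
      -C * (‖ev z r‖ * ‖Z‖ ^ 2 + ‖Z‖ * ‖ev z (fld (cst Z) true r)‖) ≤ lf r Z z := by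
  refine hK.induction_on (p := fun s => ∃ C : ℝ, 0 ≤ C ∧ ∀ᶠ z in 𝓝ˢ s, ∀ Z : Fin n → ℂ,
      -C * (‖ev z r‖ * ‖Z‖ ^ 2 + ‖Z‖ * ‖ev z (fld (cst Z) true r)‖) ≤ lf r Z z)
    ⟨0, le_rfl, by simp⟩ (fun s t hst ⟨C, hC, ht⟩ => ⟨C, hC, ht.filter_mono (nhdsSet_mono hst)⟩)
    ?_ ?_
  · rintro s t ⟨C, hC, hs⟩ ⟨D, hD, ht⟩
    refine ⟨C + D, by positivity, ?_⟩
    rw [nhdsSet_union, eventually_sup]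
    constructor
    · filter_upwards [hs] with z hz Z
      refine le_trans ?_ (hz Z)
      have : 0 ≤ D * (‖ev z r‖ * ‖Z‖ ^ 2 + ‖Z‖ * ‖ev z (fld (cst Z) true r)‖) := by positivity
      nlinarith
    · filter_upwards [ht] with z hz Z
      refine le_trans ?_ (hz Z)
      have : 0 ≤ C * (‖ev z r‖ * ‖Z‖ ^ 2 + ‖Z‖ * ‖ev z (fld (cst Z) true r)‖) := by positivity
      nlinarith
  · intro q hq
    obtain ⟨C, hC, hev⟩ := h q hq
    obtain ⟨t, ht, hto, hqt⟩ := mem_nhds_iff.1 hev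
    refine ⟨t, mem_nhdsWithin_of_mem_nhds (hto.mem_nhds hqt), C, hC, ?_⟩
    rw [hto.nhdsSet_eq, eventually_principal]
    intro z hz Z
    rw [lf_eq, ev_D]
    exact ht hz Z

lemma psc_log {r L : Sm n} (hL : star L = L) {z : Fin n → ℂ}
    (hrL : ∀ᶠ w in 𝓝 z, ev w r = ev w (expS L)) {C a η : ℝ} (ha : 0 < a) (hη : η = 1 + 2 * a)
    {X : Fin n → ℂ}
    (h : -C * (‖ev z r‖ * ‖X‖ ^ 2 + ‖X‖ * ‖ev z (fld (cst X) true r)‖) ≤ lf r X z) (hC : 0 ≤ C) :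
    a * normSq (ev z (fld (cst X) true L)) - (C + C ^ 2 / (4 * a)) * enormSq X ≤
      lf L X z + η * normSq (ev z (fld (cst X) true L)) := by
  rw [lf_congr hrL, ev_D_congr hrL, hrL.self_of_nhds, fld_expS, map_mul, lf_expS hL,
    ev_expS_real hL, norm_mul, norm_real, Real.norm_of_nonneg (Real.exp_pos _).le] at h
  rw [normSq_eq_norm_sq] at h ⊢
  set R := Real.exp (ev z L).re
  set u := ‖ev z (fld (cst X) true L)‖
  have hR : 0 < R := Real.exp_pos _
  have h1 : -C * (‖X‖ ^ 2 + ‖X‖ * u) ≤ lf L X z + u ^ 2 := by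
    refine le_of_mul_le_mul_left (le_trans (le_of_eq ?_) h) hR
    ring
  have h2 : C * ‖X‖ * u ≤ a * u ^ 2 + C ^ 2 / (4 * a) * ‖X‖ ^ 2 := by
    have : a * u ^ 2 + C ^ 2 / (4 * a) * ‖X‖ ^ 2 - C * ‖X‖ * u =
        (2 * a * u - C * ‖X‖) ^ 2 / (4 * a) := by
      field_simp; ring
    have h3 : 0 ≤ (2 * a * u - C * ‖X‖) ^ 2 / (4 * a) := by positivity
    linarith
  have h3 := mul_le_mul_of_nonneg_left (norm_sq_le_enormSq X)
    (show 0 ≤ C + C ^ 2 / (4 * a) by positivity)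
  rw [hη]
  nlinarith

end Local

section WrapUp

open Filter Set

variable {n : ℕ} {Ω V : Set (Fin n → ℂ)} {ρ : (Fin n → ℂ) → ℝ}

lemma IsDefFn.exists_log (h : IsDefFn Ω V ρ) {z : Fin n → ℂ} (hzV : z ∈ V) (hz : 0 < ρ z) :
    ∃ L : Sm n, star L = L ∧ ∀ᶠ w in 𝓝 z, 0 < ρ w ∧ ev w L = (Real.log (ρ w) : ℝ) := by
  have ho : IsOpen (V ∩ ρ ⁻¹' Ioi 0) :=
    h.smooth.continuousOn.isOpen_inter_preimage h.isOpen isOpen_Ioi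
  obtain ⟨L, hL, hg⟩ := exists_global (g := fun w => Real.log (ρ w)) ho
    ((h.smooth.mono inter_subset_left).log fun w hw => (ne_of_gt hw.2))
    (isClosed_singleton (x := z)) (singleton_subset_iff.2 ⟨hzV, hz⟩)
  rw [nhdsSet_singleton] at hg
  refine ⟨L, hL, ?_⟩
  filter_upwards [hg, ho.mem_nhds ⟨hzV, hz⟩] with w hw hw2
  exact ⟨hw2.2, hw⟩

lemma IsDefFn.mul_exp (h : IsDefFn Ω V ρ) (hΩ : IsOpen Ω) (ψ : Sm n) :
    IsDefFn Ω V fun z => ρ z * Real.exp (ev z ψ).re := by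
  have hψ : ContDiff ℝ (⊤ : ℕ∞) fun z => Real.exp (ev z ψ).re :=
    (reCLM.contDiff.comp (Sm_contDiff ψ)).exp
  refine ⟨h.isOpen, h.subset, h.smooth.mul hψ.contDiffOn, ?_, fun q hq hd => h.grad_ne q hq ?_⟩
  · conv_lhs => rw [h.eq]
    ext z
    simp only [Set.mem_ofPred_eq, mul_neg_iff, Real.exp_pos, (Real.exp_pos _).not_gt, and_true,
      and_false, false_or]
  · have hV := h.isOpen.mem_nhds (h.subset (frontier_subset_closure hq))
    have h1 : DifferentiableAt ℝ ρ q := (h.smooth.contDiffAt hV).differentiableAt (by simp)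
    have h2 := h1.hasFDerivAt.mul (hψ.differentiable (by simp) q).hasFDerivAt
    have h3 : fderiv ℝ (fun z => ρ z * Real.exp (ev z ψ).re) q = _ := h2.fderiv
    rw [h3, IsDefFn.eq_zero h hΩ hq, zero_smul, zero_add] at hd
    exact (smul_eq_zero.1 hd).resolve_left (Real.exp_pos _).ne'

lemma pos_of_core {q t m k a E C : ℝ} (hE : 0 < E) (hk : 0 ≤ k) (hk1 : k ≤ 1)
    (hq : a * t - C * E ≤ q)
    (h : (0 < q ∧ (0 < k → (C + 1) * E ≤ m)) ∨ (0 ≤ a * t ∧ ∃ k₀ > 0, k₀ ≤ k ∧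
      (C / k₀ + 1) * E ≤ m ∧ 0 ≤ C)) :
    0 < q + k * (m - a * t) := by
  rcases h with ⟨hq0, hm⟩ | ⟨ht, k₀, hk₀, hk₀k, hm, hC⟩
  · rcases hk.eq_or_lt with rfl | hkpos
    · simpa using hq0
    · nlinarith [hm hkpos, mul_le_mul_of_nonneg_left (hm hkpos) hk, mul_pos hkpos hE,
        mul_le_mul_of_nonneg_left hq hk, mul_nonneg (sub_nonneg.2 hk1) hq0.le]
  · have h1 : C * E ≤ k * (C / k₀ * E) := by
      have : C * E = k₀ * (C / k₀ * E) := by field_simp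
      rw [this]
      have : 0 ≤ C / k₀ * E := by positivity
      gcongr
    have hkpos := hk₀.trans_le hk₀k
    nlinarith [mul_le_mul_of_nonneg_left hm hk, mul_pos hkpos hE,
      mul_nonneg (sub_nonneg.2 hk1) ht]

theorem exists_isDefFn {r : Sm n} (h : IsDefFn Ω V ρ) (hΩ : IsOpen Ω)
    (hbd : Bornology.IsBounded Ω) (hr : IsExt Ω ρ r)
    (hpsc : ∀ q ∈ frontier Ω, LeviPseudoconvexAt ρ q) {W : Set (Fin n → ℂ)} (hW : IsOpen W)
    {η : ℝ} (hη : 1 < η) (hpsh : StrictPSHOn (fun z => ρ z ^ η) ((closure Ω)ᶜ ∩ W))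
    {O : Set (Fin n → ℂ)} (hO : IsOpen O) (hWO : frontier Ω \ W ⊆ O)
    (hPM : ∀ M, PM (frontier Ω ∩ closure O) M) :
    ∃ ψ : Sm n, ∃ U : Set (Fin n → ℂ), IsOpen U ∧ frontier Ω ⊆ U ∧
      StrictPSHOn (fun z => (ρ z * Real.exp (ev z ψ).re) ^ η) ((closure Ω)ᶜ ∩ U) := by
  have hFc : IsCompact (frontier Ω) :=
    hbd.isCompact_closure.of_isClosed_subset isClosed_frontier frontier_subset_closure
  have hKc : IsCompact (frontier Ω ∩ closure O) := hFc.inter_right isClosed_closure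
  set K := frontier Ω ∩ closure O with hK
  obtain ⟨C, hC, hCb⟩ := exists_psc_const hFc fun q hq => hr.pscAt h hΩ hpsc hq
  set a := (η - 1) / 2 with ha
  have ha0 : 0 < a := by rw [ha]; linarith
  have hηa : η = 1 + 2 * a := by rw [ha]; ring
  set C₁ := C + C ^ 2 / (4 * a) with hC₁
  have hC₁0 : 0 ≤ C₁ := by positivity
  have hη0 : 0 < η := by linarith
  obtain ⟨g, k, hg, hk, hgk, hk0, hkm, hkn, hk1, hk1p, hkd⟩ :=
    exists_profile (A := η ^ 2 / a) (by positivity)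
  obtain ⟨c, hc, hc01, hcO, hcW⟩ := exists_cutoff hO.isClosed_compl
    (isClosed_frontier.inter hW.isClosed_compl : IsClosed (frontier Ω \ W))
    (disjoint_left.2 fun z hz hzA => hz (hWO hzA))
  obtain ⟨D, hD, hDb⟩ := exists_lf_bound c hKc
  set N := max (C₁ + 1) (C₁ / k 1 + 1) with hN
  obtain ⟨l, hl, hl1, M', hM', hlM⟩ := hPM (N + 1 + 4 * D)
  have hlo : IsOpen {z | |(ev z l).re| < 1} :=
    isOpen_lt (continuous_re.comp (continuous_ev l)).abs continuous_const
  obtain ⟨χ, hχ, hχ01, hχ0, hχ1⟩ := exists_cutoff hlo.isClosed_compl hKc.isClosed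
    (disjoint_left.2 fun z hz hzK => hz (hl1 z hzK))
  set φ : Sm n := ((4 : ℝ) : ℂ) • c + χ * l - ((2 : ℝ) : ℂ) • 1 with hφ
  have h1s : star (1 : Sm n) = 1 := star_one _
  have hχl : star (χ * l) = χ * l := by rw [star_mul' (R := Sm n), hχ, hl]
  have hφs : star φ = φ := by
    rw [hφ, star_sub (R := Sm n), star_add (R := Sm n), star_smul_real _ hc, hχl,
      star_smul_real _ h1s]
  have hφre : ∀ z, (ev z φ).re = 4 * (ev z c).re + (ev z χ).re * (ev z l).re - 2 := fun z => by
    rw [hφ, map_sub, map_add, sub_re, add_re, ev_smul_re, ev_smul_re, ev_mul_re hχ hl, map_one,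
      one_re, mul_one]
  have hχl1 : ∀ z, |(ev z χ).re * (ev z l).re| ≤ 1 := fun z => by
    by_cases hz : |(ev z l).re| < 1
    · rw [abs_mul, abs_of_nonneg (hχ01 z).1]
      exact mul_le_one₀ (hχ01 z).2 (abs_nonneg _) hz.le
    · have : ev z χ = 0 := hχ0.self_of_nhdsSet z hz
      rw [this]; simp
  have hφ3 : ∀ z, (ev z φ).re ≤ 3 := fun z => by
    rw [hφre]; linarith [(hc01 z).2, (abs_le.1 (hχl1 z)).2]
  have hlfφ : ∀ p ∈ K, ∀ᶠ z in 𝓝 p, ∀ X, N * enormSq X ≤ lf φ X z := fun p hp => by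
    refine eventually_lf_ge (c := N + 1) (by linarith) fun X => ?_
    have hχp : ∀ᶠ w in 𝓝 p, ev w χ = 1 := mem_nhdsSet_iff_forall.1 hχ1 p hp
    have h2 : ∀ᶠ w in 𝓝 p, ev w φ =
        ev w (((4 : ℝ) : ℂ) • c + l + ((-2 : ℝ) : ℂ) • (1 : Sm n)) := by
      filter_upwards [hχp] with w hw
      simp [hφ, hw]; ring
    have h3 : lf (1 : Sm n) X p = 0 := by
      simp [lf]
    rw [lf_congr h2, lf_add, lf_add, lf_smul, lf_smul, h3]
    have h4 := (abs_le.1 (hDb p hp X)).1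
    have h5 := hlM p hp X
    have h6 := mul_le_mul_of_nonneg_right hM'.le (enormSq_nonneg X)
    nlinarith
  refine ⟨compS hg φ, interior {z | z ∉ closure Ω → ∀ X, X ≠ 0 →
    0 < (levi (fun z => (ρ z * Real.exp (ev z (compS hg φ)).re) ^ η) X X z).re},
    isOpen_interior, fun p hp => ?_, fun z hz X hX => interior_subset hz.2 hz.1 X hX⟩
  rw [mem_interior_iff_mem_nhds]
  have hkey : ∀ᶠ z in 𝓝 p, ∀ X : Fin n → ℂ, ∀ q t : ℝ, 0 ≤ t → z ∉ closure Ω → X ≠ 0 →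
      (z ∈ W → 0 < q) → (0 < q ∧ (0 < k (ev z φ).re → (C₁ + 1) * enormSq X ≤ lf φ X z)) ∨
        (0 ≤ a * t ∧ ∃ k₀ > 0, k₀ ≤ k (ev z φ).re ∧
          (C₁ / k₀ + 1) * enormSq X ≤ lf φ X z ∧ 0 ≤ C₁) := by
    by_cases hpW : p ∈ W
    · by_cases hpO : p ∈ O
      · filter_upwards [hW.mem_nhds hpW, hlfφ p ⟨hp, subset_closure hpO⟩]
          with z hzW hz X q t ht hzc hX hq
        refine Or.inl ⟨hq hzW, fun _ => le_trans ?_ (hz X)⟩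
        exact mul_le_mul_of_nonneg_right (le_max_left _ _) (enormSq_nonneg X)
      · have h4 : (ev p φ).re < 0 := by
          have : ev p c = 0 := hcO.self_of_nhdsSet p hpO
          rw [hφre, this, zero_re]
          linarith [(abs_le.1 (hχl1 p)).2]
        filter_upwards [hW.mem_nhds hpW, (continuous_re.comp
          (continuous_ev φ)).continuousAt.eventually_lt continuousAt_const h4]
          with z hzW hz X q t ht hzc hX hq
        refine Or.inl ⟨hq hzW, fun hk' => absurd hk' ?_⟩
        exact (hk0 _ (le_of_lt hz)).not_gt
    · have hpc : ∀ᶠ w in 𝓝 p, ev w c = 1 := mem_nhdsSet_iff_forall.1 hcW p ⟨hp, hpW⟩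
      filter_upwards [hpc, hlfφ p ⟨hp, subset_closure (hWO ⟨hp, hpW⟩)⟩]
        with z hzc hz X q t ht _ hX hq
      refine Or.inr ⟨by positivity, k 1, hk1p, hkm ?_, le_trans ?_ (hz X), hC₁0⟩
      · rw [hφre, hzc, one_re]
        linarith [(abs_le.1 (hχl1 z)).1]
      · exact mul_le_mul_of_nonneg_right (le_max_right _ _) (enormSq_nonneg X)
  filter_upwards [hkey, hr.eventually_pos h hp, mem_nhdsSet_iff_forall.1 hCb p hp,
    h.isOpen.mem_nhds (h.subset (frontier_subset_closure hp)),
    (hr.germ p (frontier_subset_closure hp)).eventually_nhds]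
    with z hz hzpos hzC hzV hzg hzc X hX
  obtain ⟨L, hL, hLg⟩ := IsDefFn.exists_log h hzV (hzpos hzc)
  have hrL : ∀ᶠ w in 𝓝 z, ev w r = ev w (expS L) := by
    filter_upwards [hLg, hzg] with w hw hwg
    rw [hwg, ev_expS_real hL, hw.2, ofReal_re, Real.exp_log hw.1]
  have hQ := psc_log hL hrL ha0 hηa (hzC X) hC
  have hψs := compS_star hg φ
  have hLψ : star (L + compS hg φ) = L + compS hg φ := by
    rw [star_add (R := Sm n), hL, hψs]
  have e1 : ∀ᶠ w in 𝓝 z, (ρ w * Real.exp (ev w (compS hg φ)).re) ^ η =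
      Real.exp (η * (ev w (L + compS hg φ)).re) := by
    filter_upwards [hLg] with w hw
    rw [map_add, add_re, hw.2, ofReal_re, Real.rpow_def_of_pos (mul_pos hw.1 (Real.exp_pos _)),
      Real.log_mul hw.1.ne' (Real.exp_pos _).ne', Real.log_exp, mul_comm]
  have e2 : ∀ᶠ w in 𝓝 z, ρ w ^ η = Real.exp (η * (ev w L).re) := by
    filter_upwards [hLg] with w hw
    rw [hw.2, ofReal_re, Real.rpow_def_of_pos hw.1, mul_comm]
  rw [levi_exp hLψ e1]
  refine mul_pos (Real.exp_pos _) (mul_pos hη0 ?_)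
  rw [lf_add, map_add, map_add, ev_D_compS hg hk hgk hφs, lf_compS hg hk hgk hφs]
  refine lt_of_lt_of_le ?_ (levi_core _ _ ha0 (hkn _) hη0.le (hkd _))
  refine pos_of_core (enormSq_pos hX) (hkn _) (hk1 _ (hφ3 z)) hQ
    (hz X _ _ (normSq_nonneg _) hzc hX fun hzW => ?_)
  have h5 := hpsh z ⟨hzc, hzW⟩ X hX
  rw [levi_exp hL e2] at h5
  exact (mul_pos_iff_of_pos_left hη0).1 ((mul_pos_iff_of_pos_left (Real.exp_pos _)).1 h5)

theorem exists_isDefFn_of_finiteType (h : IsDefFn Ω V ρ) (hΩ : IsOpen Ω)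
    (hbd : Bornology.IsBounded Ω) (hpsc : ∀ q ∈ frontier Ω, LeviPseudoconvexAt ρ q)
    {W : Set (Fin n → ℂ)} (hW : IsOpen W) (hWsup : {p ∈ frontier Ω | ¬ FiniteTypePt ρ p} ⊆ W)
    {η : ℝ} (hη : 1 < η) (hpsh : StrictPSHOn (fun z => ρ z ^ η) ((closure Ω)ᶜ ∩ W)) :
    ∃ (Vt : Set (Fin n → ℂ)) (ρt : (Fin n → ℂ) → ℝ), IsDefFn Ω Vt ρt ∧
      ∃ U : Set (Fin n → ℂ), IsOpen U ∧ frontier Ω ⊆ U ∧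
        StrictPSHOn (fun z => ρt z ^ η) ((closure Ω)ᶜ ∩ U) := by
  obtain ⟨r, hr⟩ := IsDefFn.exists_isExt h
  have hFc : IsCompact (frontier Ω) :=
    hbd.isCompact_closure.of_isClosed_subset isClosed_frontier frontier_subset_closure
  let B : Set (Fin n → ℂ) := closure {q | ∃ γ, Isotropic r q γ ∧ ∃ j, PowerSeries.coeff 1 (γ j) ≠ 0}
  have hK0 : IsCompact (frontier Ω \ W) := hFc.inter_right hW.isClosed_compl
  have hdisj : Disjoint (frontier Ω \ W) B := disjoint_left.2 fun p hp hpB => by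
    obtain ⟨γ, hγ, hne⟩ := exists_isotropic_of_mem_closure hpB
    exact hp.2 (hWsup ⟨hp.1, not_finiteTypePt_of_isotropic
      (hr.germ p (frontier_subset_closure hp.1)) hγ hne⟩)
  obtain ⟨O, hO, hKO, hOB⟩ := normal_exists_closure_subset hK0.isClosed
    (isClosed_closure (s := {q | ∃ γ, Isotropic r q γ ∧
      ∃ j, PowerSeries.coeff 1 (γ j) ≠ 0})).isOpen_compl hdisj.subset_compl_right
  obtain ⟨ψ, U, hU, hFU, hpshU⟩ := exists_isDefFn h hΩ hbd hr hpsc hW hη hpsh hO hKO fun M => by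
    by_contra hM
    obtain ⟨q, hq, hbad⟩ := exists_isotropic_of_not_PM (hFc.inter_right isClosed_closure) hM hr.real
      (fun z hz => hr.ev_eq_zero h hΩ hz.1) (fun z hz => hr.exists_dl_ne h hz.1)
      (fun z hz => hr.pscAt h hΩ hpsc hz.1)
    exact hOB hq.2 (subset_closure hbad)
  exact ⟨V, _, IsDefFn.mul_exp h hΩ ψ, U, hU, hFU, hpshU⟩

end WrapUp

end Stein

/-- Lemma 6.2: if `ρ^{η₂}` is strictly plurisubharmonic outside `cl Ω`
near the set `Σ_∞` of infinite type boundary points, then there is a defining function `ρ̃`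
such that `ρ̃^{η₂}` is strictly plurisubharmonic outside `cl Ω` near all of `∂Ω`. -/
theorem lemma_finite_type {n : ℕ} (hn : 2 ≤ n) (Ω V : Set (Fin n → ℂ))
    (ρ : (Fin n → ℂ) → ℝ)
    (hΩ : IsOpen Ω) (hbd : Bornology.IsBounded Ω)
    (hdef : IsDefFn Ω V ρ) (hpsc : ∀ q ∈ frontier Ω, LeviPseudoconvexAt ρ q)
    (W : Set (Fin n → ℂ)) (hW : IsOpen W)
    (hWsup : {p ∈ frontier Ω | ¬ FiniteTypePt ρ p} ⊆ W)
    (η₂ : ℝ) (hη : 1 < η₂)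
    (hpsh : StrictPSHOn (fun z => ρ z ^ η₂) ((closure Ω)ᶜ ∩ W)) :
    ∃ (Vt : Set (Fin n → ℂ)) (ρt : (Fin n → ℂ) → ℝ), IsDefFn Ω Vt ρt ∧
      ∃ U : Set (Fin n → ℂ), IsOpen U ∧ frontier Ω ⊆ U ∧
        StrictPSHOn (fun z => ρt z ^ η₂) ((closure Ω)ᶜ ∩ U) := by
  exact Stein.exists_isDefFn_of_finiteType hdef hΩ hbd hpsc hW hWsup hη hpsh
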